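/- arXiv:1011.6355 — 2 statements merged into one kernel-verified Lean document; each statement's English description precedes it below -/
import Mathlib

section
/- Under assumptions (A1)–(A3), fix ε ∈ (0,1), 0 < A_0 < A_∞, a > 0, and set q = q(u) = a u^{−2/α} and n_x = ⌊x m(u)⌋. Divide [0, n_x] into n_x unit intervals and split each unit interval [j−1, j] into an initial subinterval I_j^⋆ of length ε followed by a subinterval I_j of length 1 − ε. Then |P(X(kq) ≤ u for all k with kq ∈ ∪_{j=1}^{n_x} I_j) − Π_{j=1}^{n_x} P(X(kq) ≤ u for all k with kq ∈ I_j)| → 0 as u → ∞, uniformly for x ∈ [A_0, A_∞]. -/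
open MeasureTheory ProbabilityTheory Filter Set Topology


section P1
open FourierTransform

/-- Fourier representation of a smooth compactly supported function and its derivative. -/
lemma gpa_fourier_repr (φ : ℝ → ℝ) (hs : HasCompactSupport φ) (hd : ContDiff ℝ ((⊤ : ℕ∞) : WithTop ℕ∞) φ) :
    ∃ g : ℝ → ℂ, Integrable g ∧ Integrable (fun ξ : ℝ => (ξ : ℂ) * g ξ) ∧
      (∀ x : ℝ, ((φ x : ℝ) : ℂ) = ∫ ξ : ℝ, g ξ * Complex.exp (((ξ * x : ℝ) : ℂ) * Complex.I)) ∧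
      (∀ x : ℝ, ((deriv φ x : ℝ) : ℂ) * (-Complex.I) =
        ∫ ξ : ℝ, ((ξ : ℂ) * g ξ) * Complex.exp (((ξ * x : ℝ) : ℂ) * Complex.I)) := by
  have hs' : HasCompactSupport (fun x => ((φ x : ℝ) : ℂ)) := hs.comp_left (g := fun y : ℝ => (y : ℂ)) (by simp)
  have hd' : ContDiff ℝ ((⊤ : ℕ∞) : WithTop ℕ∞) (fun x => ((φ x : ℝ) : ℂ)) :=
    Complex.ofRealCLM.contDiff.comp hd
  set f : SchwartzMap ℝ ℂ := hs'.toSchwartzMap hd' with hf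
  have hfx : ∀ x, f x = ((φ x : ℝ) : ℂ) := fun x => rfl
  have hfc : (f : ℝ → ℂ) = fun x => ((φ x : ℝ) : ℂ) := rfl
  set G : SchwartzMap ℝ ℂ := 𝓕 f with hG
  have hdf : ∀ x, deriv (f : ℝ → ℂ) x = ((deriv φ x : ℝ) : ℂ) := by
    intro x
    rw [hfc]
    exact ((hd.differentiable (by simp)).differentiableAt.hasDerivAt.ofReal_comp).deriv
  set f' : SchwartzMap ℝ ℂ := SchwartzMap.derivCLM ℂ ℂ f with hf'
  have hf'x : ∀ x, f' x = ((deriv φ x : ℝ) : ℂ) := by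
    intro x; rw [hf', SchwartzMap.derivCLM_apply, hdf]
  have hf'c : (f' : ℝ → ℂ) = deriv (f : ℝ → ℂ) := by
    ext x; rw [hf', SchwartzMap.derivCLM_apply]
  have hG' : ∀ x : ℝ, (𝓕 f' : SchwartzMap ℝ ℂ) x = (2 * Real.pi * Complex.I * x) * G x := by
    intro x
    have h1 := Real.fourier_deriv (f := (f : ℝ → ℂ)) f.integrable f.differentiable
      (by rw [← hf'c]; exact f'.integrable)
    have h2 := congrFun h1 x
    rw [SchwartzMap.fourier_coe, hf'c, h2, hG, SchwartzMap.fourier_coe, smul_eq_mul]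
  have hpi : (2 * Real.pi) ≠ 0 := by positivity
  have inv1 : ∀ (h : SchwartzMap ℝ ℂ) (x : ℝ), h x =
      ∫ ξ : ℝ, (((2 * Real.pi)⁻¹ : ℝ) : ℂ) * (𝓕 h : SchwartzMap ℝ ℂ) ((2 * Real.pi)⁻¹ * ξ) *
        Complex.exp (((ξ * x : ℝ) : ℂ) * Complex.I) := by
    intro h x
    have h1 : h x = (𝓕⁻ (𝓕 h : SchwartzMap ℝ ℂ) : SchwartzMap ℝ ℂ) x := by
      rw [fourierInv_fourier_eq]
    rw [h1, SchwartzMap.fourierInv_coe, Real.fourierInv_eq']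
    have h2 := MeasureTheory.Measure.integral_comp_mul_left (fun ξ : ℝ =>
      (𝓕 h : SchwartzMap ℝ ℂ) ((2 * Real.pi)⁻¹ * ξ) *
        Complex.exp (((ξ * x : ℝ) : ℂ) * Complex.I)) (2 * Real.pi)
    have h3 : (∫ ξ : ℝ, (((2 * Real.pi)⁻¹ : ℝ) : ℂ) * (𝓕 h : SchwartzMap ℝ ℂ) ((2 * Real.pi)⁻¹ * ξ) *
        Complex.exp (((ξ * x : ℝ) : ℂ) * Complex.I)) = |(2 * Real.pi)⁻¹| • ∫ ξ : ℝ,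
      (𝓕 h : SchwartzMap ℝ ℂ) ((2 * Real.pi)⁻¹ * ξ) *
        Complex.exp (((ξ * x : ℝ) : ℂ) * Complex.I) := by
      rw [abs_of_nonneg (by positivity), ← integral_smul]
      congr 1; ext ξ
      rw [Complex.real_smul]; ring
    rw [h3, ← h2]
    congr 1; ext ξ
    rw [smul_eq_mul, inv_mul_cancel_left₀ hpi, mul_comm]
    congr 4
    simp; ring
  refine ⟨fun ξ => (((2 * Real.pi)⁻¹ : ℝ) : ℂ) * G ((2 * Real.pi)⁻¹ * ξ), ?_, ?_, ?_, ?_⟩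
  · exact (G.integrable.comp_mul_left' (inv_ne_zero hpi)).const_mul _
  · have h1 : Integrable (fun ξ : ℝ => (-Complex.I) * ((((2 * Real.pi)⁻¹ : ℝ) : ℂ) *
        (𝓕 f' : SchwartzMap ℝ ℂ) ((2 * Real.pi)⁻¹ * ξ))) :=
      (((𝓕 f' : SchwartzMap ℝ ℂ).integrable.comp_mul_left' (inv_ne_zero hpi)).const_mul _).const_mul _
    refine h1.congr (Eventually.of_forall fun ξ => ?_)
    simp only [hG']
    have : (Real.pi : ℂ) ≠ 0 := by exact_mod_cast Real.pi_ne_zero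
    push_cast; field_simp
    linear_combination (-(ξ * G (ξ / (2 * Real.pi)))) * Complex.I_sq
  · intro x
    rw [← hfx, inv1 f x]
  · intro x
    rw [← hf'x, inv1 f' x, ← integral_mul_const]
    congr 1; ext ξ
    rw [hG']
    have : (Real.pi : ℂ) ≠ 0 := by exact_mod_cast Real.pi_ne_zero
    push_cast; field_simp
    linear_combination (-(ξ * G (ξ / (2 * Real.pi)))) * Complex.I_sq

lemma gpa_deriv_trans_int : Integrable (fun x => |deriv Real.smoothTransition x|) := by
  have h1 : ContDiff ℝ ((1 : ℕ∞) : WithTop ℕ∞) Real.smoothTransition := Real.smoothTransition.contDiff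
  have hc : Continuous (deriv Real.smoothTransition) := h1.continuous_deriv (by simp)
  have : HasCompactSupport (deriv Real.smoothTransition) := by
    refine HasCompactSupport.intro (isCompact_Icc (a := (0:ℝ)) (b := 1)) ?_
    intro x hx
    rw [mem_Icc, not_and_or, not_le, not_le] at hx
    rcases hx with hx | hx
    · have : Real.smoothTransition =ᶠ[𝓝 x] fun _ => 0 := by
        filter_upwards [Iio_mem_nhds hx] with y hy
        exact Real.smoothTransition.zero_of_nonpos hy.le
      rw [this.deriv_eq]; simp
    · have : Real.smoothTransition =ᶠ[𝓝 x] fun _ => 1 := by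
        filter_upwards [Ioi_mem_nhds hx] with y hy
        exact Real.smoothTransition.one_of_one_le hy.le
      rw [this.deriv_eq]; simp
  exact (hc.integrable_of_hasCompactSupport this).abs

/-- smooth cut-off approximating the indicator of `(-∞, u]`. -/
noncomputable def gpaBump (u : ℝ) (N : ℕ) (x : ℝ) : ℝ :=
  Real.smoothTransition (x + (u + N + 1)) * Real.smoothTransition (1 - (N + 1) * (x - u))

lemma gpaBump_contDiff (u : ℝ) (N : ℕ) : ContDiff ℝ ((⊤ : ℕ∞) : WithTop ℕ∞) (gpaBump u N) := by
  unfold gpaBump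
  refine ContDiff.mul ?_ ?_
  · exact Real.smoothTransition.contDiff.comp (by fun_prop)
  · exact Real.smoothTransition.contDiff.comp (by fun_prop)

lemma gpaBump_compact (u : ℝ) (N : ℕ) : HasCompactSupport (gpaBump u N) := by
  refine HasCompactSupport.intro (isCompact_Icc (a := -(u+N+1)) (b := u + 1)) ?_
  intro x hx
  rw [mem_Icc, not_and_or, not_le, not_le] at hx
  unfold gpaBump
  rcases hx with hx | hx
  · rw [Real.smoothTransition.zero_of_nonpos (by linarith), zero_mul]
  · rw [Real.smoothTransition.zero_of_nonpos (x := 1 - (N + 1) * (x - u)), mul_zero]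
    have : (0:ℝ) ≤ N := Nat.cast_nonneg N
    nlinarith

lemma gpaBump_nonneg (u : ℝ) (N : ℕ) (x : ℝ) : 0 ≤ gpaBump u N x :=
  mul_nonneg (Real.smoothTransition.nonneg _) (Real.smoothTransition.nonneg _)

lemma gpaBump_le_one (u : ℝ) (N : ℕ) (x : ℝ) : gpaBump u N x ≤ 1 :=
  mul_le_one₀ (Real.smoothTransition.le_one _) (Real.smoothTransition.nonneg _) (Real.smoothTransition.le_one _)

lemma gpaBump_tendsto (u : ℝ) (x : ℝ) :
    Tendsto (fun N : ℕ => gpaBump u N x) atTop (𝓝 (if x ≤ u then 1 else 0)) := by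
  split_ifs with h
  · refine tendsto_const_nhds.congr' ?_
    filter_upwards [eventually_ge_atTop ⌈-x - u⌉₊] with N hN
    have h1 : -x - u ≤ N := Nat.ceil_le.mp hN
    have : (0:ℝ) ≤ N := Nat.cast_nonneg N
    unfold gpaBump
    rw [Real.smoothTransition.one_of_one_le (by linarith), Real.smoothTransition.one_of_one_le (by nlinarith), mul_one]
  · push Not at h
    refine tendsto_const_nhds.congr' ?_
    filter_upwards [eventually_ge_atTop ⌈1 / (x - u)⌉₊] with N hN
    have h1 : 1 / (x - u) ≤ N := Nat.ceil_le.mp hN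
    rw [div_le_iff₀ (by linarith)] at h1
    unfold gpaBump
    rw [Real.smoothTransition.zero_of_nonpos (x := 1 - (N + 1) * (x - u)) (by nlinarith), mul_zero]

lemma gpaBump_deriv_zero (u : ℝ) (N : ℕ) (x : ℝ) (hx : |x| < u) : deriv (gpaBump u N) x = 0 := by
  have : gpaBump u N =ᶠ[𝓝 x] fun _ => 1 := by
    have h1 : ∀ᶠ y in 𝓝 x, |y| < u := (continuous_abs.tendsto x).eventually (gt_mem_nhds hx)
    filter_upwards [h1] with y hy
    have h2 := abs_lt.mp hy
    have : (0:ℝ) ≤ N := Nat.cast_nonneg N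
    unfold gpaBump
    rw [Real.smoothTransition.one_of_one_le (by linarith), Real.smoothTransition.one_of_one_le (by nlinarith), mul_one]
  rw [this.deriv_eq]; simp

lemma gpaBump_deriv_int (u : ℝ) (N : ℕ) : Integrable (fun x => |deriv (gpaBump u N) x|) := by
  have h2 : ContDiff ℝ ((1 : ℕ∞) : WithTop ℕ∞) (gpaBump u N) := (gpaBump_contDiff u N).of_le (by exact_mod_cast le_top)
  exact ((h2.continuous_deriv (by simp)).integrable_of_hasCompactSupport (gpaBump_compact u N).deriv).abs

lemma gpaBump_deriv_bound (u : ℝ) (N : ℕ) :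
    ∫ x, |deriv (gpaBump u N) x| ≤ 2 * ∫ x, |deriv Real.smoothTransition x| := by
  set S' := deriv Real.smoothTransition
  have hS : ∀ x, HasDerivAt Real.smoothTransition (S' x) x := fun x =>
    ((Real.smoothTransition.contDiff (n := 1)).differentiable (by simp)).differentiableAt.hasDerivAt
  have hN : (0:ℝ) < N + 1 := by positivity
  have key : ∀ x, |deriv (gpaBump u N) x| ≤ |S' (x + (u+N+1))| + (N+1) * |S' (1 - (N + 1) * (x - u))| := by
    intro x
    have hA : HasDerivAt (fun x : ℝ => x + (u+N+1)) 1 x := (hasDerivAt_id x).add_const _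
    have hB : HasDerivAt (fun x : ℝ => 1 - ((N:ℝ) + 1) * (x - u)) (-((N+1))) x := by
      have := (((hasDerivAt_id x).sub_const u).const_mul ((N:ℝ)+1)).const_sub 1
      simpa using this
    have h1 := ((hS (x + (u+N+1))).comp x hA).mul ((hS (1 - (N + 1) * (x - u))).comp x hB)
    have h2 : deriv (gpaBump u N) x = _ := h1.deriv
    rw [h2]
    refine (abs_add_le _ _).trans ?_
    simp only [Function.comp, mul_one, abs_mul, abs_neg, abs_of_pos hN]
    have e1 := Real.smoothTransition.nonneg (1 - (N + 1) * (x - u))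
    have e2 := Real.smoothTransition.le_one (1 - (N + 1) * (x - u))
    have e3 := Real.smoothTransition.nonneg (x + (u+N+1))
    have e4 := Real.smoothTransition.le_one (x + (u+N+1))
    rw [abs_of_nonneg e1, abs_of_nonneg e3]
    have f1 := abs_nonneg (S' (x + (u+N+1)))
    have f2 := abs_nonneg (S' (1 - (N + 1) * (x - u)))
    have f3 := mul_nonneg f2 hN.le
    nlinarith
  have i0 := gpa_deriv_trans_int
  have i1 : Integrable (fun x => |S' (x + (u+N+1))|) := i0.comp_add_right (u+N+1)
  have e1 : ∫ x, |S' (x + (u+N+1))| = ∫ x, |S' x| := integral_add_right_eq_self (fun x => |S' x|) (u+N+1)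
  have i2 : Integrable (fun x => |S' (1 - (N + 1) * (x - u))|) := by
    have := ((i0.comp_add_right (1 + (N+1)*u)).comp_mul_left' (R := -((N:ℝ)+1)) (by linarith))
    refine this.congr (Eventually.of_forall fun x => ?_)
    simp only; congr 2; ring
  have e2 : ∫ x, (N+1) * |S' (1 - (N + 1) * (x - u))| = ∫ x, |S' x| := by
    rw [integral_const_mul]
    have h1 := MeasureTheory.Measure.integral_comp_mul_left (fun x => |S' (x + (1 + (N+1)*u))|) (-((N:ℝ)+1))
    rw [integral_add_right_eq_self (fun x => |S' x|) (1 + (N+1)*u)] at h1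
    have h2 : ∫ x, |S' (1 - (N + 1) * (x - u))| = ∫ x : ℝ, |S' (-((N:ℝ)+1) * x + (1 + (N+1)*u))| := by
      congr 1; ext x; congr 2; ring
    rw [h2, h1, smul_eq_mul, abs_inv, abs_neg, abs_of_pos hN]
    field_simp
  calc ∫ x, |deriv (gpaBump u N) x| ≤ ∫ x, (|S' (x + (u+N+1))| + (N+1) * |S' (1 - (N + 1) * (x - u))|) := by
        refine integral_mono (gpaBump_deriv_int u N) (i1.add (i2.const_mul _)) key
    _ = _ := by
        rw [integral_add i1 (i2.const_mul _), e1, e2]; ring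

end P1


section P2

/-- A family with Gaussian characteristic function `exp(-Q/2)`. -/
structure GpaFam {ι Ω : Type*} [Fintype ι] [MeasurableSpace Ω] (P : Measure Ω) (Z : ι → Ω → ℝ)
    (Q : (ι → ℝ) → ℝ) : Prop where
  meas : ∀ i, Measurable (Z i)
  char : ∀ c : ι → ℝ, ∫ ω, Complex.exp (((∑ i, c i * Z i ω : ℝ) : ℂ) * Complex.I) ∂P
    = Complex.exp (((-(Q c) / 2 : ℝ) : ℂ))

lemma GpaFam.fourier {ι Ω : Type*} [Fintype ι] [MeasurableSpace Ω] {P : Measure Ω}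
    [IsProbabilityMeasure P] {Z : ι → Ω → ℝ} {Q : (ι → ℝ) → ℝ} (hZ : GpaFam P Z Q)
    (h : ι → ℝ → ℂ) (hi : ∀ i, Integrable (h i)) :
    ∫ ω, ∏ i, (∫ ξ : ℝ, h i ξ * Complex.exp (((ξ * Z i ω : ℝ) : ℂ) * Complex.I)) ∂P
      = ∫ ξ : ι → ℝ, (∏ i, h i (ξ i)) * Complex.exp (((-(Q ξ) / 2 : ℝ) : ℂ)) := by
  have h1 : ∀ ω, ∏ i, (∫ ξ : ℝ, h i ξ * Complex.exp (((ξ * Z i ω : ℝ) : ℂ) * Complex.I))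
      = ∫ ξ : ι → ℝ, (∏ i, h i (ξ i)) * Complex.exp (((∑ i, ξ i * Z i ω : ℝ) : ℂ) * Complex.I) := by
    intro ω
    rw [← integral_fintype_prod_volume_eq_prod
      (fun i ξ => h i ξ * Complex.exp (((ξ * Z i ω : ℝ) : ℂ) * Complex.I))]
    congr 1; ext ξ
    rw [Finset.prod_mul_distrib, ← Complex.exp_sum, Complex.ofReal_sum, Finset.sum_mul]
  simp_rw [h1]
  have hG : Integrable (fun ξ : ι → ℝ => ∏ i, h i (ξ i)) := Integrable.fintype_prod hi
  have hm := hZ.meas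
  rw [integral_integral_swap]
  · congr 1; ext ξ
    rw [integral_const_mul, hZ.char]
  · have h2 : Integrable (fun p : Ω × (ι → ℝ) => ∏ i, h i (p.2 i)) (P.prod volume) := hG.comp_snd P
    have := h2.mul_bdd (c := 1) (g := fun p : Ω × (ι → ℝ) =>
      Complex.exp (((∑ i, p.2 i * Z i p.1 : ℝ) : ℂ) * Complex.I)) ?_ ?_
    · exact this
    · apply Measurable.aestronglyMeasurable
      fun_prop
    · refine Eventually.of_forall fun p => ?_
      rw [Complex.norm_exp_ofReal_mul_I]

lemma gpa_mvt {E : Type*} [MeasurableSpace E] (μ : Measure E) (G : E → ℂ) (Q₁ Q₀ : E → ℝ)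
    (hQ1 : Measurable Q₁) (hQ0 : Measurable Q₀) (h1 : ∀ x, 0 ≤ Q₁ x) (h0 : ∀ x, 0 ≤ Q₀ x)
    (hG : Integrable G μ) (hGD : Integrable (fun x => G x * ((Q₁ x - Q₀ x : ℝ) : ℂ)) μ) (B : ℝ)
    (hB : ∀ t ∈ Ioo (0:ℝ) 1, ‖∫ x, G x * ((Q₁ x - Q₀ x : ℝ) : ℂ) *
      Complex.exp (((-(t * Q₁ x + (1 - t) * Q₀ x) / 2 : ℝ) : ℂ)) ∂μ‖ ≤ B) :
    |(∫ x, G x * Complex.exp (((-(Q₁ x) / 2 : ℝ) : ℂ)) ∂μ).re -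
      (∫ x, G x * Complex.exp (((-(Q₀ x) / 2 : ℝ) : ℂ)) ∂μ).re| ≤ B / 2 := by
  set e : ℝ → E → ℂ := fun t x => Complex.exp (((-(t * Q₁ x + (1 - t) * Q₀ x) / 2 : ℝ) : ℂ)) with he
  have hem : ∀ t, Measurable (e t) := by intro t; simp only [he]; fun_prop
  have hen : ∀ t ∈ Icc (0:ℝ) 1, ∀ x, ‖e t x‖ ≤ 1 := by
    intro t ht x
    simp only [he]
    rw [Complex.norm_exp_ofReal, Real.exp_le_one_iff]
    have := mul_nonneg ht.1 (h1 x)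
    have := mul_nonneg (sub_nonneg.2 ht.2) (h0 x)
    linarith
  set F : ℝ → ℂ := fun t => ∫ x, G x * e t x ∂μ with hF
  have hder : ∀ t ∈ Ioo (0:ℝ) 1, HasDerivAt F (∫ x, G x * ((Q₁ x - Q₀ x : ℝ) : ℂ) * e t x * (-1/2) ∂μ) t := by
    intro t ht
    refine (hasDerivAt_integral_of_dominated_loc_of_deriv_le (s := Ioo (0:ℝ) 1)
      (bound := fun x => ‖G x * ((Q₁ x - Q₀ x : ℝ) : ℂ)‖)
      (F := fun t x => G x * e t x)
      (F' := fun t x => G x * ((Q₁ x - Q₀ x : ℝ) : ℂ) * e t x * (-1/2)) (Ioo_mem_nhds ht.1 ht.2) ?_ ?_ ?_ ?_ ?_ ?_).2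
    · exact Eventually.of_forall fun t => hG.1.mul (hem t).aestronglyMeasurable
    · exact hG.mul_bdd (hem t).aestronglyMeasurable (Eventually.of_forall (hen t ⟨ht.1.le, ht.2.le⟩))
    · exact (hGD.1.mul (hem t).aestronglyMeasurable).mul_const _
    · refine Eventually.of_forall fun x s hs => ?_
      rw [norm_mul, norm_mul]
      have := hen s ⟨hs.1.le, hs.2.le⟩ x
      have h3 : ‖(-1/2 : ℂ)‖ = 1/2 := by norm_num
      rw [h3]
      have := norm_nonneg (G x * ((Q₁ x - Q₀ x : ℝ) : ℂ))
      have := norm_nonneg (e s x)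
      nlinarith [mul_le_mul_of_nonneg_left (hen s ⟨hs.1.le, hs.2.le⟩ x) (norm_nonneg (G x * ((Q₁ x - Q₀ x : ℝ) : ℂ)))]
    · exact hGD.norm
    · refine Eventually.of_forall fun x s hs => ?_
      have h4 : HasDerivAt (fun t : ℝ => -(t * Q₁ x + (1 - t) * Q₀ x) / 2) (-(Q₁ x - Q₀ x)/2) s := by
        have := ((((hasDerivAt_id s).mul_const (Q₁ x)).add (((hasDerivAt_id s).const_sub 1).mul_const (Q₀ x))).neg.div_const 2)
        refine this.congr_deriv ?_
        ring
      have h5 := (h4.ofReal_comp.cexp).const_mul (G x)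
      refine h5.congr_deriv ?_
      simp only [he]; push_cast; ring
  have hcon : ContinuousOn F (Icc 0 1) := by
    refine continuousOn_of_dominated (bound := fun x => ‖G x‖) ?_ ?_ hG.norm ?_
    · exact fun t ht => hG.1.mul (hem t).aestronglyMeasurable
    · intro t ht
      refine Eventually.of_forall fun x => ?_
      rw [norm_mul]
      exact mul_le_of_le_one_right (norm_nonneg _) (hen t ht x)
    · refine Eventually.of_forall fun x => ?_
      simp only [he]; fun_prop
  obtain ⟨c, hc, hc'⟩ := exists_hasDerivAt_eq_slope (fun t => (F t).re)
    (fun t => (∫ x, G x * ((Q₁ x - Q₀ x : ℝ) : ℂ) * e t x * (-1/2) ∂μ).re) zero_lt_one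
    (Complex.continuous_re.comp_continuousOn hcon)
    (fun t ht => by
      have := (Complex.reCLM.hasFDerivAt.comp_hasDerivAt t (hder t ht))
      exact this)
  have hF1 : F 1 = ∫ x, G x * Complex.exp (((-(Q₁ x) / 2 : ℝ) : ℂ)) ∂μ := by simp [hF, he]
  have hF0 : F 0 = ∫ x, G x * Complex.exp (((-(Q₀ x) / 2 : ℝ) : ℂ)) ∂μ := by simp [hF, he]
  rw [← hF1, ← hF0]
  simp only [sub_zero, div_one] at hc'
  rw [← hc']
  refine (Complex.abs_re_le_norm _).trans ?_
  rw [integral_mul_const, norm_mul]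
  have h3 : ‖(-1/2 : ℂ)‖ = 1/2 := by norm_num
  rw [h3]
  have := hB c hc
  simp only [he]
  linarith

end P2


section P3

lemma gpa_bivar_law {Ω : Type*} [MeasurableSpace Ω] (P : Measure Ω) [IsProbabilityMeasure P]
    (U V : Ω → ℝ) (hU : Measurable U) (hV : Measurable V) (ρ : ℝ) (hρ : |ρ| < 1)
    (hc : ∀ a b : ℝ, ∫ ω, Complex.exp (((a * U ω + b * V ω : ℝ) : ℂ) * Complex.I) ∂P
      = Complex.exp (((-(a ^ 2 + 2 * ρ * a * b + b ^ 2) / 2 : ℝ) : ℂ))) :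
    P.map (fun ω => (U ω, V ω)) =
      ((gaussianReal 0 1).prod (gaussianReal 0 1)).map
        (fun p : ℝ × ℝ => (p.1, ρ * p.1 + Real.sqrt (1 - ρ ^ 2) * p.2)) := by
  have hm : Measurable (fun ω => (U ω, V ω)) := hU.prodMk hV
  have hm2 : Measurable (fun p : ℝ × ℝ => (p.1, ρ * p.1 + Real.sqrt (1 - ρ ^ 2) * p.2)) := by fun_prop
  have : IsProbabilityMeasure (P.map (fun ω => (U ω, V ω))) := Measure.isProbabilityMeasure_map hm.aemeasurable
  have : IsProbabilityMeasure (((gaussianReal 0 1).prod (gaussianReal 0 1)).map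
        (fun p : ℝ × ℝ => (p.1, ρ * p.1 + Real.sqrt (1 - ρ ^ 2) * p.2))) :=
    Measure.isProbabilityMeasure_map hm2.aemeasurable
  apply Measure.ext_of_charFunDual
  ext L
  set a := L (1, 0)
  set b := L (0, 1)
  have hL : ∀ x y : ℝ, L (x, y) = a * x + b * y := by
    intro x y
    have : ((x, y) : ℝ × ℝ) = x • (1, 0) + y • (0, 1) := by ext <;> simp
    rw [this, map_add, map_smul, map_smul]
    simp only [smul_eq_mul, a, b]; ring
  have hLm : Measurable L := L.continuous.measurable
  rw [charFunDual_apply, charFunDual_apply, integral_map hm.aemeasurable (by apply Measurable.aestronglyMeasurable; fun_prop),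
    integral_map hm2.aemeasurable (by apply Measurable.aestronglyMeasurable; fun_prop)]
  simp only [hL]
  rw [hc a b]
  set σ := Real.sqrt (1 - ρ ^ 2) with hσ
  have hσ2 : σ ^ 2 = 1 - ρ ^ 2 := by
    apply Real.sq_sqrt
    have := (sq_lt_one_iff_abs_lt_one ρ).2 hρ
    linarith
  have h1 : ∀ p : ℝ × ℝ, Complex.exp (((a * p.1 + b * (ρ * p.1 + σ * p.2) : ℝ) : ℂ) * Complex.I)
    = Complex.exp (((a + b * ρ : ℝ) : ℂ) * p.1 * Complex.I) * Complex.exp (((b * σ : ℝ) : ℂ) * p.2 * Complex.I) := by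
    intro p
    rw [← Complex.exp_add]; congr 1; push_cast; ring
  simp_rw [h1]
  rw [integral_prod_mul (fun x : ℝ => Complex.exp (((a + b * ρ : ℝ) : ℂ) * x * Complex.I))
    (fun y : ℝ => Complex.exp (((b * σ : ℝ) : ℂ) * y * Complex.I)),
    ← charFun_apply_real, ← charFun_apply_real, charFun_gaussianReal, charFun_gaussianReal, ← Complex.exp_add]
  congr 1
  push_cast
  have : (σ : ℂ) ^ 2 = 1 - (ρ : ℂ) ^ 2 := by exact_mod_cast hσ2
  linear_combination (b^2/2 : ℂ) * this

lemma gpa_bivar_bound {Ω : Type*} [MeasurableSpace Ω] (P : Measure Ω) [IsProbabilityMeasure P]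
    (U V : Ω → ℝ) (hU : Measurable U) (hV : Measurable V) (ρ : ℝ) (hρ : |ρ| < 1)
    (hc : ∀ a b : ℝ, ∫ ω, Complex.exp (((a * U ω + b * V ω : ℝ) : ℂ) * Complex.I) ∂P
      = Complex.exp (((-(a ^ 2 + 2 * ρ * a * b + b ^ 2) / 2 : ℝ) : ℂ)))
    (d : ℝ → ENNReal) (hd : Measurable d) (u : ℝ) (hu : 0 < u) (hd0 : ∀ x, |x| < u → d x = 0) :
    ∫⁻ ω, d (U ω) * d (V ω) ∂P ≤
      ENNReal.ofReal ((Real.sqrt (1 - ρ ^ 2))⁻¹ * Real.exp (-u ^ 2 / (1 + |ρ|))) * (∫⁻ x, d x) ^ 2 := by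
  set σ := Real.sqrt (1 - ρ ^ 2) with hσ
  have hρ2 : 0 < 1 - ρ ^ 2 := by
    have := (sq_lt_one_iff_abs_lt_one ρ).2 hρ
    linarith
  have hσ0 : 0 < σ := Real.sqrt_pos.2 hρ2
  have hσ2 : σ ^ 2 = 1 - ρ ^ 2 := Real.sq_sqrt hρ2.le
  have hm : Measurable (fun ω => (U ω, V ω)) := hU.prodMk hV
  have hm2 : Measurable (fun p : ℝ × ℝ => (p.1, ρ * p.1 + σ * p.2)) := by fun_prop
  have hdd : Measurable (fun p : ℝ × ℝ => d p.1 * d p.2) := by fun_prop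
  have e1 : ∫⁻ ω, d (U ω) * d (V ω) ∂P = ∫⁻ p, d p.1 * d p.2 ∂(P.map (fun ω => (U ω, V ω))) := by
    rw [lintegral_map hdd hm]
  rw [e1, gpa_bivar_law P U V hU hV ρ hρ hc, lintegral_map hdd hm2,
    lintegral_prod _ (by fun_prop)]
  set v : NNReal := ⟨σ ^ 2, sq_nonneg _⟩ with hv
  have hvv : (v : ℝ) = σ ^ 2 := rfl
  have hv0 : v ≠ 0 := by
    intro h
    have : (v : ℝ) = 0 := by rw [h]; rfl
    rw [hvv] at this; exact (pow_pos hσ0 2).ne' this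
  have e2 : ∀ x : ℝ, ∫⁻ y, d x * d (ρ * x + σ * y) ∂(gaussianReal 0 1) =
      ∫⁻ z, gaussianPDF (ρ * x) v z * (d x * d z) := by
    intro x
    have h1 : (gaussianReal 0 1).map (fun y => ρ * x + σ * y) = gaussianReal (ρ * x) v := by
      have h2 : (fun y => ρ * x + σ * y) = (fun y => ρ * x + y) ∘ (fun y => σ * y) := rfl
      rw [h2, ← Measure.map_map (by fun_prop) (by fun_prop), gaussianReal_map_const_mul, gaussianReal_map_const_add]
      congr 1
      · simp
      · ext; simp [hvv]
    have h3 : ∫⁻ y, d x * d (ρ * x + σ * y) ∂(gaussianReal 0 1) =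
        ∫⁻ z, d x * d z ∂((gaussianReal 0 1).map (fun y => ρ * x + σ * y)) := by
      rw [lintegral_map (by fun_prop) (by fun_prop)]
    rw [h3, h1, gaussianReal_of_var_ne_zero _ hv0, lintegral_withDensity_eq_lintegral_mul _ (measurable_gaussianPDF _ _) (by fun_prop)]
    rfl
  simp_rw [e2]
  rw [gaussianReal_of_var_ne_zero _ one_ne_zero, lintegral_withDensity_eq_lintegral_mul _ (measurable_gaussianPDF _ _)]
  swap
  · have hg : Measurable (fun p : ℝ × ℝ => gaussianPDF (ρ * p.1) v p.2 * (d p.1 * d p.2)) := by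
      have h5 := measurable_uncurry_gaussianPDF
      have : Measurable (fun p : ℝ × ℝ => gaussianPDF (ρ * p.1) v p.2) :=
        h5.comp (f := fun p : ℝ × ℝ => (ρ * p.1, v, p.2)) (by fun_prop)
      fun_prop
    exact hg.lintegral_prod_right'
  have hbound : ∀ x z : ℝ, gaussianPDF 0 1 x * (gaussianPDF (ρ * x) v z * (d x * d z)) ≤
      ENNReal.ofReal (σ⁻¹ * Real.exp (-u ^ 2 / (1 + |ρ|))) * (d x * d z) := by
    intro x z
    by_cases hx : |x| < u
    · rw [hd0 x hx]; simp
    by_cases hz : |z| < u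
    · rw [hd0 z hz]; simp
    push Not at hx hz
    rw [← mul_assoc]
    gcongr
    rw [gaussianPDF, gaussianPDF, ← ENNReal.ofReal_mul (gaussianPDFReal_nonneg _ _ _)]
    apply ENNReal.ofReal_le_ofReal
    rw [gaussianPDFReal, gaussianPDFReal, hvv]
    have hpi : 1 ≤ 2 * Real.pi := by have := Real.pi_gt_three; linarith
    have k1 : (Real.sqrt (2 * Real.pi * (1 : NNReal)))⁻¹ ≤ 1 := by
      apply inv_le_one_of_one_le₀
      rw [Real.one_le_sqrt]; simpa using hpi
    have k2 : (Real.sqrt (2 * Real.pi * σ ^ 2))⁻¹ ≤ σ⁻¹ := by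
      apply inv_anti₀ hσ0
      apply Real.le_sqrt_of_sq_le
      nlinarith [sq_nonneg σ]
    have k3 : Real.exp (-(x - 0) ^ 2 / (2 * (1 : NNReal))) * Real.exp (-(z - ρ * x) ^ 2 / (2 * σ ^ 2)) ≤
        Real.exp (-u ^ 2 / (1 + |ρ|)) := by
      rw [← Real.exp_add]
      apply Real.exp_le_exp.2
      rw [hσ2]
      have hab : 0 ≤ |ρ| := abs_nonneg ρ
      have habs : ρ ^ 2 = |ρ| ^ 2 := (sq_abs ρ).symm
      have hx2 : u ^ 2 ≤ x ^ 2 := by rw [← sq_abs x]; gcongr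
      have hz2 : u ^ 2 ≤ z ^ 2 := by rw [← sq_abs z]; gcongr
      have e3 : -(x - 0) ^ 2 / (2 * ((1 : NNReal) : ℝ)) + -(z - ρ * x) ^ 2 / (2 * (1 - ρ ^ 2)) =
        -((x ^ 2 - 2 * ρ * x * z + z ^ 2) / (2 * (1 - ρ ^ 2))) := by
        rw [NNReal.coe_one]
        field_simp
        ring
      rw [e3, neg_div, neg_le_neg_iff, div_le_div_iff₀ (by linarith) (by linarith)]
      have e4 : ρ * x * z ≤ |ρ| * (x ^ 2 + z ^ 2) / 2 := by
        have h6 : ρ * x * z ≤ |ρ| * (|x| * |z|) := by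
          rw [← abs_mul, ← abs_mul, ← mul_assoc]; exact le_abs_self _
        have h7 : |x| * |z| ≤ (x ^ 2 + z ^ 2) / 2 := by
          rw [← sq_abs x, ← sq_abs z]; nlinarith [sq_nonneg (|x| - |z|)]
        nlinarith [mul_le_mul_of_nonneg_left h7 hab]
      have e5 : (1 - |ρ|) * (2 * u ^ 2) ≤ x ^ 2 - 2 * ρ * x * z + z ^ 2 := by
        nlinarith [mul_le_mul_of_nonneg_left (add_le_add hx2 hz2) (sub_nonneg.2 hρ.le)]
      rw [habs]
      nlinarith [mul_le_mul_of_nonneg_right e5 (by linarith : 0 ≤ 1 + |ρ|)]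
    calc _ = ((Real.sqrt (2 * Real.pi * (1 : NNReal)))⁻¹ * (Real.sqrt (2 * Real.pi * σ ^ 2))⁻¹) *
          (Real.exp (-(x - 0) ^ 2 / (2 * (1 : NNReal))) * Real.exp (-(z - ρ * x) ^ 2 / (2 * σ ^ 2))) := by ring
      _ ≤ (1 * σ⁻¹) * Real.exp (-u ^ 2 / (1 + |ρ|)) := by gcongr
      _ = _ := by ring
  have hpm : ∀ x : ℝ, Measurable (fun z => gaussianPDF (ρ * x) v z) := fun x => measurable_gaussianPDF _ _
  calc _ = ∫⁻ x, ∫⁻ z, gaussianPDF 0 1 x * (gaussianPDF (ρ * x) v z * (d x * d z)) := by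
        refine lintegral_congr fun x => ?_
        simp only [Pi.mul_apply]
        have hq := hpm x
        rw [lintegral_const_mul _ (by fun_prop)]
    _ ≤ ∫⁻ x, ∫⁻ z, ENNReal.ofReal (σ⁻¹ * Real.exp (-u ^ 2 / (1 + |ρ|))) * (d x * d z) :=
        lintegral_mono fun x => lintegral_mono fun z => hbound x z
    _ = _ := by
        have : ∀ x, ∫⁻ z, ENNReal.ofReal (σ⁻¹ * Real.exp (-u ^ 2 / (1 + |ρ|))) * (d x * d z) =
          ENNReal.ofReal (σ⁻¹ * Real.exp (-u ^ 2 / (1 + |ρ|))) * (d x * ∫⁻ z, d z) := by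
          intro x
          rw [lintegral_const_mul _ (by fun_prop), lintegral_const_mul _ hd]
        simp_rw [this]
        rw [lintegral_const_mul _ (by fun_prop), lintegral_mul_const _ hd, pow_two (∫⁻ x, d x)]

end P3


section P4

/-- quadratic form of a matrix -/
noncomputable def gpaQ {ι : Type*} [Fintype ι] (Λ : ι → ι → ℝ) (c : ι → ℝ) : ℝ :=
  ∑ i, ∑ j, c i * c j * Λ i j

lemma gpaQ_meas {ι : Type*} [Fintype ι] (Λ : ι → ι → ℝ) : Measurable (gpaQ Λ) := by
  unfold gpaQ; fun_prop

lemma GpaFam.nonneg {ι Ω : Type*} [Fintype ι] [MeasurableSpace Ω] {P : Measure Ω}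
    [IsProbabilityMeasure P] {Z : ι → Ω → ℝ} {Q : (ι → ℝ) → ℝ} (hZ : GpaFam P Z Q) (c : ι → ℝ) :
    0 ≤ Q c := by
  have h1 := hZ.char c
  have h2 : ‖∫ ω, Complex.exp (((∑ i, c i * Z i ω : ℝ) : ℂ) * Complex.I) ∂P‖ ≤ 1 * P.real univ :=
    norm_integral_le_of_norm_le_const (Eventually.of_forall fun ω => by rw [Complex.norm_exp_ofReal_mul_I])
  rw [h1, Complex.norm_exp_ofReal] at h2
  simp at h2
  linarith

lemma gpaQ_interp {ι : Type*} [Fintype ι] (Λ₁ Λ₀ : ι → ι → ℝ) (t : ℝ) (c : ι → ℝ) :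
    gpaQ (fun i j => t * Λ₁ i j + (1 - t) * Λ₀ i j) c = t * gpaQ Λ₁ c + (1 - t) * gpaQ Λ₀ c := by
  unfold gpaQ
  rw [Finset.mul_sum, Finset.mul_sum, ← Finset.sum_add_distrib]
  refine Finset.sum_congr rfl fun i _ => ?_
  rw [Finset.mul_sum, Finset.mul_sum, ← Finset.sum_add_distrib]
  refine Finset.sum_congr rfl fun j _ => ?_
  ring

lemma gpaQ_scale {ι : Type*} [Fintype ι] (Λ : ι → ι → ℝ) (s : ℝ) (c : ι → ℝ) :
    gpaQ Λ (fun i => s * c i) = s ^ 2 * gpaQ Λ c := by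
  unfold gpaQ
  rw [Finset.mul_sum]
  refine Finset.sum_congr rfl fun i _ => ?_
  rw [Finset.mul_sum]
  refine Finset.sum_congr rfl fun j _ => ?_
  ring

lemma GpaFam.interp {ι Ω₁ Ω₀ : Type*} [Fintype ι] [MeasurableSpace Ω₁] [MeasurableSpace Ω₀]
    {P₁ : Measure Ω₁} {P₀ : Measure Ω₀} [IsProbabilityMeasure P₁] [IsProbabilityMeasure P₀]
    {Z₁ : ι → Ω₁ → ℝ} {Z₀ : ι → Ω₀ → ℝ} {Λ₁ Λ₀ : ι → ι → ℝ}
    (h₁ : GpaFam P₁ Z₁ (gpaQ Λ₁)) (h₀ : GpaFam P₀ Z₀ (gpaQ Λ₀)) (t : ℝ) (ht : t ∈ Icc (0:ℝ) 1) :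
    GpaFam (P₁.prod P₀) (fun i p => Real.sqrt t * Z₁ i p.1 + Real.sqrt (1 - t) * Z₀ i p.2)
      (gpaQ (fun i j => t * Λ₁ i j + (1 - t) * Λ₀ i j)) := by
  have m1 := h₁.meas
  have m0 := h₀.meas
  refine ⟨fun i => by fun_prop, fun c => ?_⟩
  have e1 : ∀ p : Ω₁ × Ω₀, Complex.exp (((∑ i, c i * (Real.sqrt t * Z₁ i p.1 + Real.sqrt (1 - t) * Z₀ i p.2) : ℝ) : ℂ) * Complex.I)
      = Complex.exp (((∑ i, (Real.sqrt t * c i) * Z₁ i p.1 : ℝ) : ℂ) * Complex.I) *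
        Complex.exp (((∑ i, (Real.sqrt (1 - t) * c i) * Z₀ i p.2 : ℝ) : ℂ) * Complex.I) := by
    intro p
    rw [← Complex.exp_add, ← add_mul, ← Complex.ofReal_add, ← Finset.sum_add_distrib]
    congr 3
    refine Finset.sum_congr rfl fun i _ => ?_
    ring
  simp_rw [e1]
  rw [integral_prod_mul (fun ω => Complex.exp (((∑ i, (Real.sqrt t * c i) * Z₁ i ω : ℝ) : ℂ) * Complex.I))
    (fun ω => Complex.exp (((∑ i, (Real.sqrt (1 - t) * c i) * Z₀ i ω : ℝ) : ℂ) * Complex.I)),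
    h₁.char, h₀.char, ← Complex.exp_add, ← Complex.ofReal_add, gpaQ_interp, gpaQ_scale, gpaQ_scale,
    Real.sq_sqrt ht.1, Real.sq_sqrt (sub_nonneg.2 ht.2)]
  congr 2; ring

lemma GpaFam.pair {ι Ω : Type*} [Fintype ι] [DecidableEq ι] [MeasurableSpace Ω] {P : Measure Ω}
    [IsProbabilityMeasure P] {Z : ι → Ω → ℝ} {Λ : ι → ι → ℝ} (hZ : GpaFam P Z (gpaQ Λ))
    (i j : ι) (hij : i ≠ j) (hs : Λ i j = Λ j i) (hi : Λ i i = 1) (hj : Λ j j = 1) (a b : ℝ) :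
    ∫ ω, Complex.exp (((a * Z i ω + b * Z j ω : ℝ) : ℂ) * Complex.I) ∂P
      = Complex.exp (((-(a ^ 2 + 2 * (Λ i j) * a * b + b ^ 2) / 2 : ℝ) : ℂ)) := by
  have h1 := hZ.char (fun k => (if k = i then a else 0) + (if k = j then b else 0))
  have h2 : ∀ ω, ∑ k, ((if k = i then a else 0) + (if k = j then b else 0)) * Z k ω = a * Z i ω + b * Z j ω := by
    intro ω
    simp [add_mul, Finset.sum_add_distrib]
  simp_rw [h2] at h1
  rw [h1]
  congr 4
  unfold gpaQ
  simp [add_mul, mul_add, Finset.sum_add_distrib]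
  rw [hi, hj, ← hs]; ring

lemma gpa_pair_term {ι Ω : Type*} [Fintype ι] [DecidableEq ι] [MeasurableSpace Ω] {P : Measure Ω}
    [IsProbabilityMeasure P] {Z : ι → Ω → ℝ} {Λ : ι → ι → ℝ} (hZ : GpaFam P Z (gpaQ Λ))
    (i j : ι) (hij : i ≠ j) (hs : Λ i j = Λ j i) (hi : Λ i i = 1) (hj : Λ j j = 1)
    (hρ : |Λ i j| < 1)
    (u : ℝ) (hu : 0 < u) (N : ℕ) (g : ℝ → ℂ) (hg : Integrable g)
    (hg' : Integrable (fun ξ : ℝ => (ξ : ℂ) * g ξ))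
    (hφ : ∀ x : ℝ, ((gpaBump u N x : ℝ) : ℂ) = ∫ ξ : ℝ, g ξ * Complex.exp (((ξ * x : ℝ) : ℂ) * Complex.I))
    (hdphi : ∀ x : ℝ, ((deriv (gpaBump u N) x : ℝ) : ℂ) * (-Complex.I) =
        ∫ ξ : ℝ, ((ξ : ℂ) * g ξ) * Complex.exp (((ξ * x : ℝ) : ℂ) * Complex.I)) :
    ‖∫ ξ : ι → ℝ, ((ξ i : ℂ) * (ξ j : ℂ) * ∏ k, g (ξ k)) * Complex.exp (((-(gpaQ Λ ξ) / 2 : ℝ) : ℂ))‖ ≤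
      (Real.sqrt (1 - (Λ i j) ^ 2))⁻¹ * Real.exp (-u ^ 2 / (1 + |Λ i j|)) *
        (2 * ∫ x, |deriv Real.smoothTransition x|) ^ 2 := by
  classical
  set dphi := deriv (gpaBump u N) with hdphidef
  have hcdphi : Continuous dphi := by
    have h2 : ContDiff ℝ ((1 : ℕ∞) : WithTop ℕ∞) (gpaBump u N) := (gpaBump_contDiff u N).of_le (by exact_mod_cast le_top)
    exact h2.continuous_deriv (by simp)
  set h : ι → ℝ → ℂ := fun k ξ => if k = i ∨ k = j then (ξ : ℂ) * g ξ else g ξ with hh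
  have hhi : ∀ k, Integrable (h k) := by
    intro k
    by_cases hk : k = i ∨ k = j
    · simp only [hh, hk, if_true]; exact hg'
    · simp only [hh, hk, if_false]; exact hg
  have hprod : ∀ ξ : ι → ℝ, (ξ i : ℂ) * (ξ j : ℂ) * ∏ k, g (ξ k) = ∏ k, h k (ξ k) := by
    intro ξ
    have : ∀ k, h k (ξ k) = ((if k = i then (ξ k : ℂ) else 1) * (if k = j then (ξ k : ℂ) else 1)) * g (ξ k) := by
      intro k
      simp only [hh]
      by_cases h1 : k = i
      · have : k ≠ j := fun h2 => hij (h1.symm.trans h2)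
        simp [h1, this, hij]
      · by_cases h2 : k = j <;> simp [h1, h2, Ne.symm hij]
    simp_rw [this]
    rw [Finset.prod_mul_distrib, Finset.prod_mul_distrib]
    simp
  simp_rw [hprod]
  rw [← hZ.fourier h hhi]
  set w : Ω → ℂ := fun ω => ∏ k, ∫ ξ : ℝ, h k ξ * Complex.exp (((ξ * Z k ω : ℝ) : ℂ) * Complex.I) with hw
  have hwb : ∀ ω, ‖w ω‖ₑ ≤ ‖dphi (Z i ω)‖ₑ * ‖dphi (Z j ω)‖ₑ := by
    intro ω
    have hk : ∀ k, ‖∫ ξ : ℝ, h k ξ * Complex.exp (((ξ * Z k ω : ℝ) : ℂ) * Complex.I)‖ ≤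
        (if k = i then ‖dphi (Z k ω)‖ else 1) * (if k = j then ‖dphi (Z k ω)‖ else 1) := by
      intro k
      by_cases hk : k = i ∨ k = j
      · simp only [hh, hk, if_true]
        rw [← hdphi, norm_mul, norm_neg, Complex.norm_I, mul_one, Complex.norm_real]
        by_cases h1 : k = i
        · have : k ≠ j := fun h2 => hij (h1.symm.trans h2)
          simp [h1, hij]
        · have h2 := hk.resolve_left h1
          simp [h2, Ne.symm hij]
      · simp only [hh, hk, if_false]
        push Not at hk
        rw [← hφ, Complex.norm_real, Real.norm_of_nonneg (gpaBump_nonneg _ _ _)]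
        simp [hk.1, hk.2, gpaBump_le_one]
    have : ‖w ω‖ ≤ ‖dphi (Z i ω)‖ * ‖dphi (Z j ω)‖ := by
      rw [hw]; simp only
      rw [norm_prod]
      refine (Finset.prod_le_prod (fun k _ => norm_nonneg _) (fun k _ => hk k)).trans (le_of_eq ?_)
      rw [Finset.prod_mul_distrib]
      simp
    rw [← ofReal_norm, ← ofReal_norm, ← ofReal_norm, ← ENNReal.ofReal_mul (norm_nonneg _)]
    exact ENNReal.ofReal_le_ofReal this
  have hK : 0 ≤ ∫ x, |deriv Real.smoothTransition x| := integral_nonneg fun x => abs_nonneg _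
  have hb := gpa_bivar_bound P (Z i) (Z j) (hZ.meas i) (hZ.meas j) (Λ i j) hρ
    (hZ.pair i j hij hs hi hj) (fun x => ‖dphi x‖ₑ) (by fun_prop) u hu
    (fun x hx => by rw [hdphidef, gpaBump_deriv_zero u N x hx]; simp)
  have hl : ∫⁻ x, ‖dphi x‖ₑ ≤ ENNReal.ofReal (2 * ∫ x, |deriv Real.smoothTransition x|) := by
    have h1 : ∫⁻ x, ‖dphi x‖ₑ = ENNReal.ofReal (∫ x, |dphi x|) := by
      rw [ofReal_integral_eq_lintegral_ofReal (gpaBump_deriv_int u N) (Eventually.of_forall fun x => abs_nonneg _)]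
      refine lintegral_congr fun x => ?_
      rw [← ofReal_norm, Real.norm_eq_abs]
    rw [h1]
    exact ENNReal.ofReal_le_ofReal (gpaBump_deriv_bound u N)
  have hfin : ‖∫ ω, w ω ∂P‖ₑ ≤ ENNReal.ofReal ((Real.sqrt (1 - (Λ i j) ^ 2))⁻¹ * Real.exp (-u ^ 2 / (1 + |Λ i j|)) *
        (2 * ∫ x, |deriv Real.smoothTransition x|) ^ 2) := by
    calc ‖∫ ω, w ω ∂P‖ₑ ≤ ∫⁻ ω, ‖w ω‖ₑ ∂P := enorm_integral_le_lintegral_enorm _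
      _ ≤ ∫⁻ ω, ‖dphi (Z i ω)‖ₑ * ‖dphi (Z j ω)‖ₑ ∂P := lintegral_mono hwb
      _ ≤ _ := hb
      _ ≤ ENNReal.ofReal ((Real.sqrt (1 - (Λ i j) ^ 2))⁻¹ * Real.exp (-u ^ 2 / (1 + |Λ i j|))) *
          (ENNReal.ofReal (2 * ∫ x, |deriv Real.smoothTransition x|)) ^ 2 := by gcongr
      _ = _ := by
          rw [← ENNReal.ofReal_pow (by positivity), ← ENNReal.ofReal_mul (by positivity)]
  rw [← ofReal_norm] at hfin
  exact (ENNReal.ofReal_le_ofReal_iff (by positivity)).1 hfin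

lemma gpa_smooth_comparison {ι Ω₁ Ω₀ : Type*} [Fintype ι] [DecidableEq ι] [MeasurableSpace Ω₁] [MeasurableSpace Ω₀]
    {P₁ : Measure Ω₁} {P₀ : Measure Ω₀} [IsProbabilityMeasure P₁] [IsProbabilityMeasure P₀]
    {Z₁ : ι → Ω₁ → ℝ} {Z₀ : ι → Ω₀ → ℝ} {Λ₁ Λ₀ : ι → ι → ℝ}
    (h₁ : GpaFam P₁ Z₁ (gpaQ Λ₁)) (h₀ : GpaFam P₀ Z₀ (gpaQ Λ₀))
    (s₁ : ∀ i j, Λ₁ i j = Λ₁ j i) (s₀ : ∀ i j, Λ₀ i j = Λ₀ j i)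
    (d₁ : ∀ i, Λ₁ i i = 1) (d₀ : ∀ i, Λ₀ i i = 1) (δ : ℝ) (hδ1 : δ < 1)
    (hD : ∀ i j, Λ₁ i j = Λ₀ i j ∨ (Λ₀ i j = 0 ∧ |Λ₁ i j| ≤ δ))
    (u : ℝ) (hu : 0 < u) (N : ℕ) :
    |∫ ω, ∏ i, gpaBump u N (Z₁ i ω) ∂P₁ - ∫ ω, ∏ i, gpaBump u N (Z₀ i ω) ∂P₀| ≤
      (∑ i, ∑ j, |Λ₁ i j - Λ₀ i j| * ((Real.sqrt (1 - δ ^ 2))⁻¹ * Real.exp (-u ^ 2 / (1 + |Λ₁ i j|)) *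
        (2 * ∫ x, |deriv Real.smoothTransition x|) ^ 2)) / 2 := by
  obtain ⟨g, hg, hg', hφ, hdphi⟩ := gpa_fourier_repr (gpaBump u N) (gpaBump_compact u N) (gpaBump_contDiff u N)
  have hE : ∀ {Ω : Type _} [MeasurableSpace Ω] {P : Measure Ω} [IsProbabilityMeasure P] {Z : ι → Ω → ℝ}
      {Q : (ι → ℝ) → ℝ} (hZ : GpaFam P Z Q), ∫ ω, ∏ i, gpaBump u N (Z i ω) ∂P =
        (∫ ξ : ι → ℝ, (∏ i, g (ξ i)) * Complex.exp (((-(Q ξ) / 2 : ℝ) : ℂ))).re := by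
    intro Ω _ P _ Z Q hZ
    rw [← hZ.fourier (fun _ => g) (fun _ => hg)]
    simp_rw [← hφ]
    have : ∫ ω, ∏ i, ((gpaBump u N (Z i ω) : ℝ) : ℂ) ∂P = ((∫ ω, ∏ i, gpaBump u N (Z i ω) ∂P : ℝ) : ℂ) := by
      rw [← integral_complex_ofReal]
      simp
    rw [this, Complex.ofReal_re]
  have hE' : ∀ {Ω : Type _} [MeasurableSpace Ω] {P : Measure Ω} [IsProbabilityMeasure P] {Z : ι → Ω → ℝ}
      {Q : (ι → ℝ) → ℝ} (hZ : GpaFam P Z Q), ∫ ω, ∏ i, gpaBump u N (Z i ω) ∂P =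
        (∫ ξ : ι → ℝ, (∏ i, g (ξ i)) * Complex.exp (((-(Q ξ) / 2 : ℝ) : ℂ))).re := by
    intro Ω _ P _ Z Q hZ
    rw [← hZ.fourier (fun _ => g) (fun _ => hg)]
    simp_rw [← hφ]
    have : ∫ ω, ∏ i, ((gpaBump u N (Z i ω) : ℝ) : ℂ) ∂P = ((∫ ω, ∏ i, gpaBump u N (Z i ω) ∂P : ℝ) : ℂ) := by
      rw [← integral_complex_ofReal]
      simp
    rw [this, Complex.ofReal_re]
  rw [hE h₁, hE' h₀]
  have hG : Integrable (fun ξ : ι → ℝ => ∏ i, g (ξ i)) := Integrable.fintype_prod (fun _ => hg)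
  have hDiff : ∀ ξ : ι → ℝ, (∏ i, g (ξ i)) * ((gpaQ Λ₁ ξ - gpaQ Λ₀ ξ : ℝ) : ℂ) =
      ∑ i, ∑ j, ((Λ₁ i j - Λ₀ i j : ℝ) : ℂ) * ((ξ i : ℂ) * (ξ j : ℂ) * ∏ k, g (ξ k)) := by
    intro ξ
    unfold gpaQ
    rw [← Finset.sum_sub_distrib, Complex.ofReal_sum, Finset.mul_sum]
    refine Finset.sum_congr rfl fun i _ => ?_
    rw [← Finset.sum_sub_distrib, Complex.ofReal_sum, Finset.mul_sum]
    refine Finset.sum_congr rfl fun j _ => ?_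
    push_cast; ring
  have hInt : ∀ i j, i ≠ j → Integrable (fun ξ : ι → ℝ => ((ξ i : ℂ) * (ξ j : ℂ) * ∏ k, g (ξ k))) := by
    intro i j hij
    have : Integrable (fun ξ : ι → ℝ => ∏ k, (fun x : ℝ => if k = i ∨ k = j then (x : ℂ) * g x else g x) (ξ k)) := by
      refine Integrable.fintype_prod (f := fun (k : ι) (x : ℝ) => if k = i ∨ k = j then (x : ℂ) * g x else g x)
        (μ := fun _ => volume) fun k => ?_
      by_cases hk : k = i ∨ k = j
      · simp only [hk, if_true]; exact hg'
      · simp only [hk, if_false]; exact hg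
    refine this.congr (Eventually.of_forall fun ξ => ?_)
    have h3 : ∀ k, (if k = i ∨ k = j then (ξ k : ℂ) * g (ξ k) else g (ξ k)) = ((if k = i then (ξ k : ℂ) else 1) * (if k = j then (ξ k : ℂ) else 1)) * g (ξ k) := by
      intro k
      by_cases h1 : k = i
      · have : k ≠ j := fun h2 => hij (h1.symm.trans h2)
        simp [h1, hij]
      · by_cases h2 : k = j <;> simp [h1, h2, Ne.symm hij]
    simp_rw [h3]
    rw [Finset.prod_mul_distrib, Finset.prod_mul_distrib]
    simp
  have hInt2 : ∀ i j, Integrable (fun ξ : ι → ℝ => ((Λ₁ i j - Λ₀ i j : ℝ) : ℂ) * ((ξ i : ℂ) * (ξ j : ℂ) * ∏ k, g (ξ k))) := by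
    intro i j
    by_cases hij : i = j
    · subst hij
      rw [d₁, d₀]; simp
    · exact (hInt i j hij).const_mul _
  refine gpa_mvt volume (fun ξ : ι → ℝ => ∏ i, g (ξ i)) (gpaQ Λ₁) (gpaQ Λ₀) (gpaQ_meas _) (gpaQ_meas _)
    h₁.nonneg h₀.nonneg hG ?_ _ ?_
  · simp_rw [hDiff]
    exact integrable_finsetSum _ fun i _ => integrable_finsetSum _ fun j _ => hInt2 i j
  · intro t ht
    have ht' : t ∈ Icc (0:ℝ) 1 := ⟨ht.1.le, ht.2.le⟩
    have hZt := h₁.interp h₀ t ht'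
    set Λ : ι → ι → ℝ := fun i j => t * Λ₁ i j + (1 - t) * Λ₀ i j with hΛ
    simp_rw [hDiff, ← gpaQ_interp, ← hΛ, Finset.sum_mul]
    have hem : Measurable (fun ξ => Complex.exp (((-(gpaQ Λ ξ) / 2 : ℝ) : ℂ))) := by
      have := gpaQ_meas Λ
      fun_prop
    have hen : ∀ ξ, ‖Complex.exp (((-(gpaQ Λ ξ) / 2 : ℝ) : ℂ))‖ ≤ 1 := by
      intro ξ
      rw [Complex.norm_exp_ofReal, Real.exp_le_one_iff]
      have := hZt.nonneg ξ
      linarith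
    have hInt3 : ∀ i j, Integrable (fun ξ : ι → ℝ => ((Λ₁ i j - Λ₀ i j : ℝ) : ℂ) * ((ξ i : ℂ) * (ξ j : ℂ) * ∏ k, g (ξ k)) *
        Complex.exp (((-(gpaQ Λ ξ) / 2 : ℝ) : ℂ))) := fun i j =>
      (hInt2 i j).mul_bdd hem.aestronglyMeasurable (Eventually.of_forall hen)
    rw [integral_finsetSum _ (fun i _ => integrable_finsetSum _ fun j _ => hInt3 i j)]
    refine (norm_sum_le _ _).trans (Finset.sum_le_sum fun i _ => ?_)
    rw [integral_finsetSum _ (fun j _ => hInt3 i j)]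
    refine (norm_sum_le _ _).trans (Finset.sum_le_sum fun j _ => ?_)
    simp_rw [mul_assoc (((Λ₁ i j - Λ₀ i j : ℝ) : ℂ))]
    rw [integral_const_mul, norm_mul, Complex.norm_real, Real.norm_eq_abs]
    by_cases hz : Λ₁ i j = Λ₀ i j
    · rw [hz]; simp
    obtain ⟨hz0, hzδ⟩ := (hD i j).resolve_left hz
    have hij : i ≠ j := by
      rintro rfl
      exact hz (by rw [d₁, d₀])
    have hΛij : |Λ i j| ≤ |Λ₁ i j| := by
      simp only [hΛ, hz0, mul_zero, add_zero, abs_mul, abs_of_pos ht.1]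
      exact mul_le_of_le_one_left (abs_nonneg _) ht.2.le
    gcongr
    refine (gpa_pair_term hZt i j hij (by simp only [hΛ]; rw [s₁ i j, s₀ i j]) (by simp [hΛ, d₁, d₀]) (by simp [hΛ, d₁, d₀])
      (by linarith) u hu N g hg hg' hφ hdphi).trans ?_
    have hsq : Λ i j ^ 2 ≤ δ ^ 2 := by
      rw [← sq_abs]; gcongr; linarith
    have hδ0 : 0 ≤ δ := (abs_nonneg _).trans hzδ
    have hpos : 0 < 1 - δ ^ 2 := by nlinarith
    have a1 : (Real.sqrt (1 - (Λ i j) ^ 2))⁻¹ ≤ (Real.sqrt (1 - δ ^ 2))⁻¹ := by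
      apply inv_anti₀ (Real.sqrt_pos.2 hpos)
      apply Real.sqrt_le_sqrt; linarith
    have a2 : Real.exp (-u ^ 2 / (1 + |Λ i j|)) ≤ Real.exp (-u ^ 2 / (1 + |Λ₁ i j|)) := by
      apply Real.exp_le_exp.2
      rw [neg_div, neg_div, neg_le_neg_iff]
      gcongr
    gcongr

lemma gpa_comparison {ι Ω₁ Ω₀ : Type*} [Fintype ι] [DecidableEq ι] [MeasurableSpace Ω₁] [MeasurableSpace Ω₀]
    {P₁ : Measure Ω₁} {P₀ : Measure Ω₀} [IsProbabilityMeasure P₁] [IsProbabilityMeasure P₀]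
    {Z₁ : ι → Ω₁ → ℝ} {Z₀ : ι → Ω₀ → ℝ} {Λ₁ Λ₀ : ι → ι → ℝ}
    (h₁ : GpaFam P₁ Z₁ (gpaQ Λ₁)) (h₀ : GpaFam P₀ Z₀ (gpaQ Λ₀))
    (s₁ : ∀ i j, Λ₁ i j = Λ₁ j i) (s₀ : ∀ i j, Λ₀ i j = Λ₀ j i)
    (d₁ : ∀ i, Λ₁ i i = 1) (d₀ : ∀ i, Λ₀ i i = 1) (δ : ℝ) (hδ1 : δ < 1)
    (hD : ∀ i j, Λ₁ i j = Λ₀ i j ∨ (Λ₀ i j = 0 ∧ |Λ₁ i j| ≤ δ))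
    (u : ℝ) (hu : 0 < u) :
    |P₁.real {ω | ∀ i, Z₁ i ω ≤ u} - P₀.real {ω | ∀ i, Z₀ i ω ≤ u}| ≤
      (∑ i, ∑ j, |Λ₁ i j - Λ₀ i j| * ((Real.sqrt (1 - δ ^ 2))⁻¹ * Real.exp (-u ^ 2 / (1 + |Λ₁ i j|)) *
        (2 * ∫ x, |deriv Real.smoothTransition x|) ^ 2)) / 2 := by
  have hlim : ∀ {Ω : Type _} [MeasurableSpace Ω] (P : Measure Ω) [IsProbabilityMeasure P] (Z : ι → Ω → ℝ)
      (hZ : ∀ i, Measurable (Z i)), Tendsto (fun N => ∫ ω, ∏ i, gpaBump u N (Z i ω) ∂P) atTop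
        (𝓝 (P.real {ω | ∀ i, Z i ω ≤ u})) := by
    intro Ω _ P _ Z hZ
    have hms : MeasurableSet {ω | ∀ i, Z i ω ≤ u} := by
      rw [ofPred_forall]
      exact MeasurableSet.iInter fun i => measurableSet_le (hZ i) measurable_const
    rw [← integral_indicator_one hms]
    refine tendsto_integral_of_dominated_convergence (fun _ => 1) ?_ (integrable_const _) ?_ ?_
    · intro N
      have := (gpaBump_contDiff u N).continuous.measurable
      apply Measurable.aestronglyMeasurable
      fun_prop
    · intro N
      refine Eventually.of_forall fun ω => ?_
      rw [norm_prod]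
      refine Finset.prod_le_one (fun i _ => norm_nonneg _) fun i _ => ?_
      rw [Real.norm_of_nonneg (gpaBump_nonneg _ _ _)]
      exact gpaBump_le_one _ _ _
    · refine Eventually.of_forall fun ω => ?_
      have h1 : Tendsto (fun N => ∏ i, gpaBump u N (Z i ω)) atTop (𝓝 (∏ i, if Z i ω ≤ u then 1 else 0)) :=
        tendsto_finsetProd _ fun i _ => gpaBump_tendsto u (Z i ω)
      convert h1 using 2
      rw [Finset.prod_ite_zero]
      simp [indicator_apply]
  have hlim' : ∀ {Ω : Type _} [MeasurableSpace Ω] (P : Measure Ω) [IsProbabilityMeasure P] (Z : ι → Ω → ℝ)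
      (hZ : ∀ i, Measurable (Z i)), Tendsto (fun N => ∫ ω, ∏ i, gpaBump u N (Z i ω) ∂P) atTop
        (𝓝 (P.real {ω | ∀ i, Z i ω ≤ u})) := by
    intro Ω _ P _ Z hZ
    have hms : MeasurableSet {ω | ∀ i, Z i ω ≤ u} := by
      rw [ofPred_forall]
      exact MeasurableSet.iInter fun i => measurableSet_le (hZ i) measurable_const
    rw [← integral_indicator_one hms]
    refine tendsto_integral_of_dominated_convergence (fun _ => 1) ?_ (integrable_const _) ?_ ?_
    · intro N
      have := (gpaBump_contDiff u N).continuous.measurable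
      apply Measurable.aestronglyMeasurable
      fun_prop
    · intro N
      refine Eventually.of_forall fun ω => ?_
      rw [norm_prod]
      refine Finset.prod_le_one (fun i _ => norm_nonneg _) fun i _ => ?_
      rw [Real.norm_of_nonneg (gpaBump_nonneg _ _ _)]
      exact gpaBump_le_one _ _ _
    · refine Eventually.of_forall fun ω => ?_
      have h1 : Tendsto (fun N => ∏ i, gpaBump u N (Z i ω)) atTop (𝓝 (∏ i, if Z i ω ≤ u then 1 else 0)) :=
        tendsto_finsetProd _ fun i _ => gpaBump_tendsto u (Z i ω)
      convert h1 using 2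
      rw [Finset.prod_ite_zero]
      simp [indicator_apply]
  have h := ((hlim P₁ Z₁ h₁.meas).sub (hlim' P₀ Z₀ h₀.meas)).abs
  exact le_of_tendsto h (Eventually.of_forall fun N =>
    gpa_smooth_comparison h₁ h₀ s₁ s₀ d₁ d₀ δ hδ1 hD u hu N)

end P4


section P5

lemma gpa_aemeas {Ω : Type*} [MeasurableSpace Ω] (P : Measure Ω) [IsProbabilityMeasure P]
    (X : ℝ → Ω → ℝ) (r : ℝ → ℝ)
    (hGauss : ∀ (n : ℕ) (c : Fin n → ℝ) (t : Fin n → ℝ), (∀ i, 0 ≤ t i) →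
      Measure.map (fun ω => ∑ i, c i * X (t i) ω) P
        = gaussianReal 0 (Real.toNNReal (∑ i, ∑ j, c i * c j * r (|t i - t j|))))
    (t : ℝ) (ht : 0 ≤ t) : AEMeasurable (X t) P := by
  have h := hGauss 1 (fun _ => 1) (fun _ => t) (fun _ => ht)
  simp only [Finset.univ_unique, Finset.sum_singleton, one_mul] at h
  by_contra hn
  rw [Measure.map_of_not_aemeasurable hn] at h
  have := congrArg (fun μ : Measure ℝ => μ univ) h
  simp at this

lemma gpa_gauss_memLp {Ω : Type*} [MeasurableSpace Ω] (P : Measure Ω) [IsProbabilityMeasure P]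
    (Y : Ω → ℝ) (hY : AEMeasurable Y P) (v : NNReal) (h : P.map Y = gaussianReal 0 v) :
    MemLp Y 2 P := by
  have h1 : MemLp id 2 (P.map Y) := by rw [h]; exact memLp_id_gaussianReal' 2 (by simp)
  exact (memLp_map_measure_iff (by fun_prop) hY).1 h1

lemma gpa_gauss_sq {Ω : Type*} [MeasurableSpace Ω] (P : Measure Ω) [IsProbabilityMeasure P]
    (Y : Ω → ℝ) (hY : AEMeasurable Y P) (v : NNReal) (h : P.map Y = gaussianReal 0 v) :
    ∫ ω, (Y ω) ^ 2 ∂P = v := by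
  have h1 : ∫ ω, (Y ω) ^ 2 ∂P = ∫ x, x ^ 2 ∂(P.map Y) := by
    rw [integral_map hY (by fun_prop)]
  rw [h1, h]
  have h2 := variance_fun_id_gaussianReal (μ := 0) (v := v)
  rw [variance_of_integral_eq_zero (by fun_prop) integral_id_gaussianReal] at h2
  exact h2

lemma gpa_gauss_char {Ω : Type*} [MeasurableSpace Ω] (P : Measure Ω) [IsProbabilityMeasure P]
    (Y : Ω → ℝ) (hY : AEMeasurable Y P) (v : NNReal) (h : P.map Y = gaussianReal 0 v) :
    ∫ ω, Complex.exp ((Y ω : ℂ) * Complex.I) ∂P = Complex.exp (((-(v : ℝ) / 2 : ℝ) : ℂ)) := by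
  have h1 : ∫ ω, Complex.exp ((Y ω : ℂ) * Complex.I) ∂P = ∫ x : ℝ, Complex.exp (((1 : ℝ) : ℂ) * x * Complex.I) ∂(P.map Y) := by
    rw [integral_map hY (by apply Measurable.aestronglyMeasurable; fun_prop)]
    simp
  rw [h1, h, ← charFun_apply_real, charFun_gaussianReal]
  congr 1
  push_cast; ring

lemma gpa_memLp {Ω : Type*} [MeasurableSpace Ω] (P : Measure Ω) [IsProbabilityMeasure P]
    (X : ℝ → Ω → ℝ) (r : ℝ → ℝ)
    (hGauss : ∀ (n : ℕ) (c : Fin n → ℝ) (t : Fin n → ℝ), (∀ i, 0 ≤ t i) →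
      Measure.map (fun ω => ∑ i, c i * X (t i) ω) P
        = gaussianReal 0 (Real.toNNReal (∑ i, ∑ j, c i * c j * r (|t i - t j|))))
    (t : ℝ) (ht : 0 ≤ t) : MemLp (X t) 2 P := by
  have h := hGauss 1 (fun _ => 1) (fun _ => t) (fun _ => ht)
  simp only [Finset.univ_unique, Finset.sum_singleton, one_mul] at h
  exact gpa_gauss_memLp P _ (gpa_aemeas P X r hGauss t ht) _ h

lemma gpa_moment {Ω : Type*} [MeasurableSpace Ω] (P : Measure Ω) [IsProbabilityMeasure P]
    (X : ℝ → Ω → ℝ) (r : ℝ → ℝ)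
    (hGauss : ∀ (n : ℕ) (c : Fin n → ℝ) (t : Fin n → ℝ), (∀ i, 0 ≤ t i) →
      Measure.map (fun ω => ∑ i, c i * X (t i) ω) P
        = gaussianReal 0 (Real.toNNReal (∑ i, ∑ j, c i * c j * r (|t i - t j|))))
    (n : ℕ) (c : Fin n → ℝ) (t : Fin n → ℝ) (ht : ∀ i, 0 ≤ t i) :
    ∫ ω, (∑ i, c i * X (t i) ω) ^ 2 ∂P = max (∑ i, ∑ j, c i * c j * r (|t i - t j|)) 0 := by
  have hm : AEMeasurable (fun ω => ∑ i, c i * X (t i) ω) P :=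
    Finset.aemeasurable_fun_sum _ fun i _ => (gpa_aemeas P X r hGauss (t i) (ht i)).const_mul (c i)
  rw [gpa_gauss_sq P _ hm _ (hGauss n c t ht), Real.coe_toNNReal']

lemma gpa_moment2 {Ω : Type*} [MeasurableSpace Ω] (P : Measure Ω) [IsProbabilityMeasure P]
    (X : ℝ → Ω → ℝ) (r : ℝ → ℝ)
    (hGauss : ∀ (n : ℕ) (c : Fin n → ℝ) (t : Fin n → ℝ), (∀ i, 0 ≤ t i) →
      Measure.map (fun ω => ∑ i, c i * X (t i) ω) P
        = gaussianReal 0 (Real.toNNReal (∑ i, ∑ j, c i * c j * r (|t i - t j|))))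
    (a b s t : ℝ) (hs : 0 ≤ s) (ht : 0 ≤ t) :
    a ^ 2 * ∫ ω, X s ω * X s ω ∂P + 2 * a * b * ∫ ω, X s ω * X t ω ∂P + b ^ 2 * ∫ ω, X t ω * X t ω ∂P
      = max (a ^ 2 * r 0 + 2 * a * b * r |s - t| + b ^ 2 * r 0) 0 := by
  have h := gpa_moment P X r hGauss 2 ![a, b] ![s, t] (by intro i; fin_cases i <;> simpa)
  simp only [Fin.sum_univ_two, Matrix.cons_val_zero, Matrix.cons_val_one, sub_self, abs_zero] at h
  rw [abs_sub_comm t s] at h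
  have e : a * a * r 0 + a * b * r |s - t| + (b * a * r |s - t| + b * b * r 0) =
    a ^ 2 * r 0 + 2 * a * b * r |s - t| + b ^ 2 * r 0 := by ring
  rw [e] at h
  rw [← h]
  have i1 : Integrable (fun ω => X s ω * X s ω) P := (gpa_memLp P X r hGauss s hs).integrable_mul (gpa_memLp P X r hGauss s hs)
  have i2 : Integrable (fun ω => X s ω * X t ω) P := (gpa_memLp P X r hGauss s hs).integrable_mul (gpa_memLp P X r hGauss t ht)
  have i3 : Integrable (fun ω => X t ω * X t ω) P := (gpa_memLp P X r hGauss t ht).integrable_mul (gpa_memLp P X r hGauss t ht)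
  have i4 : Integrable (fun ω => a ^ 2 * (X s ω * X s ω) + 2 * a * b * (X s ω * X t ω)) P :=
    (i1.const_mul (a ^ 2)).add (i2.const_mul (2 * a * b))
  rw [← integral_const_mul, ← integral_const_mul, ← integral_const_mul, ← integral_add (i1.const_mul _) (i2.const_mul _),
    ← integral_add i4 (i3.const_mul (b ^ 2))]
  congr 1; ext ω
  ring

lemma gpa_r0_pos {Ω : Type*} [MeasurableSpace Ω] (P : Measure Ω) [IsProbabilityMeasure P]
    (X : ℝ → Ω → ℝ) (r : ℝ → ℝ)
    (hGauss : ∀ (n : ℕ) (c : Fin n → ℝ) (t : Fin n → ℝ), (∀ i, 0 ≤ t i) →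
      Measure.map (fun ω => ∑ i, c i * X (t i) ω) P
        = gaussianReal 0 (Real.toNNReal (∑ i, ∑ j, c i * c j * r (|t i - t j|))))
    (h1 : Tendsto r (𝓝[>] 0) (𝓝 1)) : 0 < r 0 := by
  by_contra hn
  push Not at hn
  have hz : ∀ t, 0 ≤ t → X t =ᵐ[P] 0 := by
    intro t ht
    have h := gpa_moment2 P X r hGauss 1 0 t t ht ht
    simp [hn] at h
    have i1 := (gpa_memLp P X r hGauss t ht).integrable_mul (gpa_memLp P X r hGauss t ht)
    have h2 := (integral_eq_zero_iff_of_nonneg (fun ω => mul_self_nonneg (X t ω)) i1).1 h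
    filter_upwards [h2] with ω hω
    simpa using hω
  have h2 : ∀ᶠ t in 𝓝[>] (0:ℝ), 1/2 < r t := h1.eventually (lt_mem_nhds (by norm_num))
  obtain ⟨η, hη, hη2⟩ := mem_nhdsGT_iff_exists_Ioo_subset.1 h2
  rw [mem_Ioi] at hη
  obtain ⟨n, hn1⟩ := exists_nat_gt (1 - 2 * r 0)
  have hnpos : (0:ℝ) < n := by linarith
  set t : Fin n → ℝ := fun i => (i : ℝ) * (η / n) with htdef
  have ht : ∀ i, 0 ≤ t i := fun i => by positivity
  have h := gpa_moment P X r hGauss n (fun _ => 1) t ht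
  have h0 : ∫ ω, (∑ i, (1:ℝ) * X (t i) ω) ^ 2 ∂P = 0 := by
    have : (fun ω => (∑ i, (1:ℝ) * X (t i) ω) ^ 2) =ᵐ[P] fun _ => 0 := by
      have h3 : ∀ᵐ ω ∂P, ∀ i, X (t i) ω = 0 := ae_all_iff.2 fun i => hz (t i) (ht i)
      filter_upwards [h3] with ω hω
      simp [hω]
    rw [integral_congr_ae this]; simp
  rw [h0] at h
  have h4 : ∑ i, ∑ j, (1:ℝ) * 1 * r (|t i - t j|) ≤ 0 := by
    rw [h]; exact le_max_left _ _
  have h5 : ∀ i j : Fin n, i ≠ j → 1/2 ≤ r (|t i - t j|) := by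
    intro i j hij
    have e : t i - t j = ((i:ℝ) - j) * (η / n) := by simp only [htdef]; ring
    have hq : 0 < η / n := by positivity
    have hne : (i:ℝ) - j ≠ 0 := by
      rw [sub_ne_zero]; intro h; exact hij (Fin.ext (by exact_mod_cast h))
    have habs : |(i:ℝ) - j| < n := by
      have a1 : (i:ℝ) < n := by exact_mod_cast i.2
      have a2 : (j:ℝ) < n := by exact_mod_cast j.2
      have a3 : (0:ℝ) ≤ i := by positivity
      have a4 : (0:ℝ) ≤ j := by positivity
      rw [abs_lt]; constructor <;> linarith
    refine (hη2 ⟨?_, ?_⟩ : 1/2 < r (|t i - t j|)).le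
    · rw [e]; positivity
    · rw [e, abs_mul, abs_of_pos hq]
      calc |(i:ℝ) - j| * (η / n) < n * (η / n) := by gcongr
        _ = η := by field_simp
  have h6 : ∀ i : Fin n, r 0 + ((n:ℝ) - 1) * (1/2) ≤ ∑ j, (1:ℝ) * 1 * r (|t i - t j|) := by
    intro i
    rw [← Finset.add_sum_erase _ _ (Finset.mem_univ i)]
    have : ((n:ℝ) - 1) * (1/2) = ∑ j ∈ Finset.univ.erase i, (1/2 : ℝ) := by
      rw [Finset.sum_const, Finset.card_erase_of_mem (Finset.mem_univ i)]
      simp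
      rw [Nat.cast_sub (by exact_mod_cast hnpos)]; simp
    rw [this]
    refine add_le_add (by simp) (Finset.sum_le_sum fun j hj => ?_)
    rw [one_mul, one_mul]
    exact h5 i j (Finset.ne_of_mem_erase hj).symm
  have h7 : (n:ℝ) * (r 0 + ((n:ℝ) - 1) * (1/2)) ≤ ∑ i, ∑ j, (1:ℝ) * 1 * r (|t i - t j|) := by
    have := Finset.sum_le_sum fun (i : Fin n) (_ : i ∈ Finset.univ) => h6 i
    rw [Finset.sum_const, Finset.card_univ, Fintype.card_fin, nsmul_eq_mul] at this
    exact this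
  have h8 : 0 < r 0 + ((n:ℝ) - 1) * (1/2) := by linarith
  exact absurd (lt_of_lt_of_le (mul_pos hnpos h8) (h7.trans h4)) (lt_irrefl _)

lemma gpa_cov {Ω : Type*} [MeasurableSpace Ω] (P : Measure Ω) [IsProbabilityMeasure P]
    (X : ℝ → Ω → ℝ) (r : ℝ → ℝ)
    (hGauss : ∀ (n : ℕ) (c : Fin n → ℝ) (t : Fin n → ℝ), (∀ i, 0 ≤ t i) →
      Measure.map (fun ω => ∑ i, c i * X (t i) ω) P
        = gaussianReal 0 (Real.toNNReal (∑ i, ∑ j, c i * c j * r (|t i - t j|))))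
    (h0 : 0 < r 0) (s t : ℝ) (hs : 0 ≤ s) (ht : 0 ≤ t) :
    ∫ ω, X s ω * X t ω ∂P = r |s - t| := by
  have a1 := gpa_moment2 P X r hGauss 1 0 s t hs ht
  have a2 := gpa_moment2 P X r hGauss 0 1 s t hs ht
  have a3 := gpa_moment2 P X r hGauss 1 1 s t hs ht
  have a4 := gpa_moment2 P X r hGauss 1 (-1) s t hs ht
  norm_num at a1 a2 a3 a4
  rw [max_eq_left h0.le] at a1 a2
  rcases max_cases (r 0 + 2 * r |s - t| + r 0) 0 with h | h <;>
  rcases max_cases (r 0 + -(2 * r |s - t|) + r 0) 0 with h' | h' <;>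
  linarith [h.1, h.2, h'.1, h'.2]

lemma gpa_form_nonneg {Ω : Type*} [MeasurableSpace Ω] (P : Measure Ω) [IsProbabilityMeasure P]
    (X : ℝ → Ω → ℝ) (r : ℝ → ℝ)
    (hGauss : ∀ (n : ℕ) (c : Fin n → ℝ) (t : Fin n → ℝ), (∀ i, 0 ≤ t i) →
      Measure.map (fun ω => ∑ i, c i * X (t i) ω) P
        = gaussianReal 0 (Real.toNNReal (∑ i, ∑ j, c i * c j * r (|t i - t j|))))
    (h0 : 0 < r 0) (n : ℕ) (c : Fin n → ℝ) (t : Fin n → ℝ) (ht : ∀ i, 0 ≤ t i) :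
    0 ≤ ∑ i, ∑ j, c i * c j * r (|t i - t j|) := by
  have h1 : ∑ i, ∑ j, c i * c j * r (|t i - t j|) = ∫ ω, (∑ i, c i * X (t i) ω) ^ 2 ∂P := by
    have : ∀ ω, (∑ i, c i * X (t i) ω) ^ 2 = ∑ i, ∑ j, c i * c j * (X (t i) ω * X (t j) ω) := by
      intro ω
      rw [sq, Finset.sum_mul_sum]
      refine Finset.sum_congr rfl fun i _ => Finset.sum_congr rfl fun j _ => by ring
    simp_rw [this]
    have hi : ∀ i j, Integrable (fun ω => c i * c j * (X (t i) ω * X (t j) ω)) P := fun i j =>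
      ((gpa_memLp P X r hGauss (t i) (ht i)).integrable_mul (gpa_memLp P X r hGauss (t j) (ht j))).const_mul _
    rw [integral_finsetSum _ fun i _ => integrable_finsetSum _ fun j _ => hi i j]
    refine Finset.sum_congr rfl fun i _ => ?_
    rw [integral_finsetSum _ fun j _ => hi i j]
    refine Finset.sum_congr rfl fun j _ => ?_
    rw [integral_const_mul, gpa_cov P X r hGauss h0 _ _ (ht i) (ht j)]
  rw [h1]
  exact integral_nonneg fun ω => sq_nonneg _

lemma gpa_char {Ω : Type*} [MeasurableSpace Ω] (P : Measure Ω) [IsProbabilityMeasure P]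
    (X : ℝ → Ω → ℝ) (r : ℝ → ℝ)
    (hGauss : ∀ (n : ℕ) (c : Fin n → ℝ) (t : Fin n → ℝ), (∀ i, 0 ≤ t i) →
      Measure.map (fun ω => ∑ i, c i * X (t i) ω) P
        = gaussianReal 0 (Real.toNNReal (∑ i, ∑ j, c i * c j * r (|t i - t j|))))
    (h0 : 0 < r 0) (n : ℕ) (c : Fin n → ℝ) (t : Fin n → ℝ) (ht : ∀ i, 0 ≤ t i) :
    ∫ ω, Complex.exp (((∑ i, c i * X (t i) ω : ℝ) : ℂ) * Complex.I) ∂P =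
      Complex.exp (((-(∑ i, ∑ j, c i * c j * r (|t i - t j|)) / 2 : ℝ) : ℂ)) := by
  have hm : AEMeasurable (fun ω => ∑ i, c i * X (t i) ω) P :=
    Finset.aemeasurable_fun_sum _ fun i _ => (gpa_aemeas P X r hGauss (t i) (ht i)).const_mul (c i)
  rw [gpa_gauss_char P _ hm _ (hGauss n c t ht), Real.coe_toNNReal _ (gpa_form_nonneg P X r hGauss h0 n c t ht)]

lemma gpa_r_cont {Ω : Type*} [MeasurableSpace Ω] (P : Measure Ω) [IsProbabilityMeasure P]
    (X : ℝ → Ω → ℝ) (r : ℝ → ℝ)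
    (hGauss : ∀ (n : ℕ) (c : Fin n → ℝ) (t : Fin n → ℝ), (∀ i, 0 ≤ t i) →
      Measure.map (fun ω => ∑ i, c i * X (t i) ω) P
        = gaussianReal 0 (Real.toNNReal (∑ i, ∑ j, c i * c j * r (|t i - t j|))))
    (hcont : ∀ᵐ ω ∂P, ContinuousOn (fun t => X t ω) (Ici 0))
    (h1 : Tendsto r (𝓝[>] 0) (𝓝 1)) : r 0 = 1 ∧ ContinuousOn r (Ici 0) := by
  have h0 := gpa_r0_pos P X r hGauss h1
  have hΦ : ∀ t, 0 ≤ t → ∫ ω, Complex.exp (((X t ω - X 0 ω : ℝ) : ℂ) * Complex.I) ∂P =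
      Complex.exp (((-(r 0 - r t) : ℝ) : ℂ)) := by
    intro t ht
    have h := gpa_char P X r hGauss h0 2 ![1, -1] ![t, 0] (by intro i; fin_cases i <;> simp [ht])
    simp only [Fin.sum_univ_two, Matrix.cons_val_zero, Matrix.cons_val_one, sub_self, abs_zero, sub_zero, zero_sub, abs_neg,
      abs_of_nonneg ht] at h
    have e : -(1 * 1 * r 0 + 1 * -1 * r t + (-1 * 1 * r t + -1 * -1 * r 0)) / 2 = -(r 0 - r t) := by ring
    rw [e] at h
    rw [← h]
    congr 1; ext ω; congr 3; ring
  have hc : ContinuousOn (fun t => ∫ ω, Complex.exp (((X t ω - X 0 ω : ℝ) : ℂ) * Complex.I) ∂P) (Ici 0) := by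
    refine continuousOn_of_dominated (bound := fun _ => 1) ?_ ?_ (integrable_const _) ?_
    · intro t ht
      have m1 := gpa_aemeas P X r hGauss t ht
      have m2 := gpa_aemeas P X r hGauss 0 le_rfl
      apply AEMeasurable.aestronglyMeasurable
      fun_prop
    · intro t ht
      exact Eventually.of_forall fun ω => by rw [Complex.norm_exp_ofReal_mul_I]
    · filter_upwards [hcont] with ω hω
      have : ContinuousOn (fun t => X t ω - X 0 ω) (Ici 0) := hω.sub continuousOn_const
      exact Complex.continuous_exp.comp_continuousOn ((Complex.continuous_ofReal.comp_continuousOn this).mul continuousOn_const)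
  have hrc : ContinuousOn r (Ici 0) := by
    have h2 : ContinuousOn (fun t => r 0 + Real.log ‖∫ ω, Complex.exp (((X t ω - X 0 ω : ℝ) : ℂ) * Complex.I) ∂P‖) (Ici 0) := by
      refine continuousOn_const.add (hc.norm.log ?_)
      intro t ht
      rw [hΦ t ht, norm_ne_zero_iff]
      exact Complex.exp_ne_zero _
    refine h2.congr fun t ht => ?_
    simp only
    rw [hΦ t ht, Complex.norm_exp_ofReal, Real.log_exp]; ring
  refine ⟨?_, hrc⟩
  have h3 : Tendsto r (𝓝[>] 0) (𝓝 (r 0)) :=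
    (hrc 0 self_mem_Ici).mono_left (nhdsWithin_mono _ Ioi_subset_Ici_self)
  exact tendsto_nhds_unique h3 h1

lemma gpa_r_bound {Ω : Type*} [MeasurableSpace Ω] (P : Measure Ω) [IsProbabilityMeasure P]
    (X : ℝ → Ω → ℝ) (r : ℝ → ℝ)
    (hGauss : ∀ (n : ℕ) (c : Fin n → ℝ) (t : Fin n → ℝ), (∀ i, 0 ≤ t i) →
      Measure.map (fun ω => ∑ i, c i * X (t i) ω) P
        = gaussianReal 0 (Real.toNNReal (∑ i, ∑ j, c i * c j * r (|t i - t j|))))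
    (hr0 : r 0 = 1) (hrc : ContinuousOn r (Ici 0)) (hA2 : ∀ t : ℝ, 0 < t → r t < 1)
    (hr : Tendsto r atTop (𝓝 0)) (ε : ℝ) (hε : 0 < ε) : ∃ δ, 0 < δ ∧ δ < 1 ∧ ∀ t, ε ≤ t → |r t| ≤ δ := by
  have h0 : 0 < r 0 := by rw [hr0]; norm_num
  have hneg : ∀ t, 0 < t → -1 < r t := by
    intro t ht
    have h := gpa_form_nonneg P X r hGauss h0 3 ![1, 2, 1] ![0, t, 2 * t] (by intro i; fin_cases i <;> simp <;> linarith)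
    simp [Fin.sum_univ_three] at h
    have e1 : t - 2 * t = -t := by ring
    have e2 : 2 * t - t = t := by ring
    rw [e1, e2, abs_neg, abs_of_pos ht, hr0] at h
    have h2 := hA2 (2 * t) (by linarith)
    linarith
  have hlt : ∀ t, 0 < t → |r t| < 1 := fun t ht => abs_lt.2 ⟨hneg t ht, hA2 t ht⟩
  have h1 : ∀ᶠ t in atTop, |r t| < 1/2 := by
    have := hr.abs
    rw [abs_zero] at this
    exact this.eventually (gt_mem_nhds (by norm_num))
  obtain ⟨T, hT⟩ := eventually_atTop.1 h1
  have hne : (Icc ε (max ε T)).Nonempty := nonempty_Icc.2 (le_max_left _ _)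
  obtain ⟨s, hs, hmax⟩ := isCompact_Icc.exists_isMaxOn hne
    ((hrc.mono (fun x hx => (hε.le.trans hx.1 : 0 ≤ x))).abs)
  refine ⟨max (1/2) |r s|, by positivity, max_lt (by norm_num) (hlt s (by linarith [hs.1])), fun t ht => ?_⟩
  by_cases h : t ≤ max ε T
  · exact (hmax ⟨ht, h⟩).trans (le_max_right _ _)
  · push Not at h
    exact (hT t ((le_max_right _ _).trans h.le)).le.trans (le_max_left _ _)

end P5


section P6

lemma gpa_r_tendsto_one (r : ℝ → ℝ) (C α : ℝ) (hα : 0 < α)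
    (hA1 : (fun t => r t - (1 - C * |t| ^ α)) =o[𝓝[>] (0:ℝ)] fun t => |t| ^ α) :
    Tendsto r (𝓝[>] 0) (𝓝 1) := by
  have h1 : Tendsto (fun t : ℝ => |t| ^ α) (𝓝[>] 0) (𝓝 0) := by
    have : Tendsto (fun t : ℝ => |t| ^ α) (𝓝 0) (𝓝 (|0| ^ α)) :=
      (continuous_abs.tendsto (0:ℝ)).rpow_const (Or.inr hα.le)
    rw [abs_zero, Real.zero_rpow hα.ne'] at this
    exact this.mono_left nhdsWithin_le_nhds
  have h2 := hA1.isBigO.trans_tendsto h1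
  have h3 := h2.add ((tendsto_const_nhds (x := (1:ℝ))).sub (h1.const_mul C))
  simpa using h3

lemma gpa_r_tendsto_zero (r : ℝ → ℝ) (hA3 : Tendsto (fun t => r t * Real.log t) atTop (𝓝 0)) :
    Tendsto r atTop (𝓝 0) := by
  have h := hA3.mul Real.tendsto_log_atTop.inv_tendsto_atTop
  rw [zero_mul] at h
  refine h.congr' ?_
  filter_upwards [eventually_gt_atTop 1] with t ht
  have := Real.log_pos ht
  simp only [Pi.inv_apply]
  field_simp

lemma gpa_blocks {Ω : Type*} [MeasurableSpace Ω] (P : Measure Ω) [IsProbabilityMeasure P]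
    (X : ℝ → Ω → ℝ) (r : ℝ → ℝ)
    (hGauss : ∀ (n : ℕ) (c : Fin n → ℝ) (t : Fin n → ℝ), (∀ i, 0 ≤ t i) →
      Measure.map (fun ω => ∑ i, c i * X (t i) ω) P
        = gaussianReal 0 (Real.toNNReal (∑ i, ∑ j, c i * c j * r (|t i - t j|))))
    (h0 : r 0 = 1) {ι β : Type} [Fintype ι] [DecidableEq ι] [Fintype β] [DecidableEq β]
    (t : ι → ℝ) (ht : ∀ i, 0 ≤ t i) (b : ι → β) (δ : ℝ) (hδ1 : δ < 1)
    (hδ : ∀ i j, b i ≠ b j → |r (|t i - t j|)| ≤ δ) (u : ℝ) (hu : 0 < u) :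
    |P.real {ω | ∀ i, X (t i) ω ≤ u} - ∏ k, P.real {ω | ∀ i, b i = k → X (t i) ω ≤ u}| ≤
      (∑ i, ∑ j, if b i = b j then 0 else
        |r (|t i - t j|)| * ((√(1-δ^2))⁻¹ * Real.exp (-u^2/(1+|r (|t i - t j|)|)) *
          (2 * ∫ x, |deriv Real.smoothTransition x|)^2)) / 2 := by
  have h0' : 0 < r 0 := by rw [h0]; norm_num
  set Z : ι → Ω → ℝ := fun i => (gpa_aemeas P X r hGauss (t i) (ht i)).mk with hZ
  have hZm : ∀ i, Measurable (Z i) := fun i => (gpa_aemeas P X r hGauss (t i) (ht i)).measurable_mk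
  have hZX : ∀ᵐ ω ∂P, ∀ i, X (t i) ω = Z i ω :=
    ae_all_iff.2 fun i => (gpa_aemeas P X r hGauss (t i) (ht i)).ae_eq_mk
  have hZchar : ∀ c : ι → ℝ, ∫ ω, Complex.exp (((∑ i, c i * Z i ω : ℝ) : ℂ) * Complex.I) ∂P =
      Complex.exp (((-(∑ i, ∑ j, c i * c j * r (|t i - t j|)) / 2 : ℝ) : ℂ)) := by
    intro c
    let e := (Fintype.equivFin ι).symm
    have h := gpa_char P X r hGauss h0' (Fintype.card ι) (c ∘ e) (t ∘ e) (fun i => ht _)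
    have s1 : ∑ i, ∑ j, (c ∘ e) i * (c ∘ e) j * r |(t ∘ e) i - (t ∘ e) j| = ∑ i, ∑ j, c i * c j * r (|t i - t j|) := by
      rw [← e.sum_comp]
      refine Finset.sum_congr rfl fun i _ => ?_
      rw [← e.sum_comp]; rfl
    rw [s1] at h
    rw [← h]
    refine integral_congr_ae ?_
    filter_upwards [hZX] with ω hω
    rw [← e.sum_comp]
    simp only [Function.comp, hω]
  set Λ₁ : ι → ι → ℝ := fun i j => r |t i - t j| with hΛ₁
  set Λ₀ : ι → ι → ℝ := fun i j => if b i = b j then r |t i - t j| else 0 with hΛ₀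
  have f₁ : GpaFam P Z (gpaQ Λ₁) := ⟨hZm, fun c => hZchar c⟩
  have f₀ : GpaFam (Measure.pi (fun _ : β => P)) (fun i (w : β → Ω) => Z i (w (b i))) (gpaQ Λ₀) := by
    refine ⟨fun i => (hZm i).comp (measurable_pi_apply _), fun c => ?_⟩
    have e1 : ∀ w : β → Ω, Complex.exp (((∑ i, c i * Z i (w (b i)) : ℝ) : ℂ) * Complex.I) =
        ∏ k, (fun k (ω : Ω) => Complex.exp (((∑ i, (if b i = k then c i else 0) * Z i ω : ℝ) : ℂ) * Complex.I)) k (w k) := by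
      intro w
      simp only
      rw [← Complex.exp_sum, ← Finset.sum_mul, ← Complex.ofReal_sum, Finset.sum_comm]
      congr 3
      push_cast
      refine Finset.sum_congr rfl fun i _ => ?_
      rw [Finset.sum_eq_single (b i)] <;> simp +contextual
      intro k hk hk'
      exact absurd hk'.symm hk
    simp_rw [e1]
    rw [integral_fintype_prod_eq_prod (fun k (ω : Ω) => Complex.exp (((∑ i, (if b i = k then c i else 0) * Z i ω : ℝ) : ℂ) * Complex.I))]
    simp_rw [hZchar]
    rw [← Complex.exp_sum, ← Complex.ofReal_sum, ← Finset.sum_div, Finset.sum_neg_distrib]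
    congr 4
    simp only [gpaQ]
    rw [Finset.sum_comm]
    refine Finset.sum_congr rfl fun i _ => ?_
    rw [Finset.sum_comm]
    refine Finset.sum_congr rfl fun j _ => ?_
    rw [Finset.sum_eq_single (b i)]
    · simp only [hΛ₀, eq_comm (a := b j)]
      by_cases hb : b i = b j <;> simp [hb]
    · intro k _ hk
      simp [hk.symm]
    · simp
  have hmain := gpa_comparison f₁ f₀ (fun i j => by simp only [hΛ₁, abs_sub_comm])
    (fun i j => by simp only [hΛ₀, abs_sub_comm (t i), eq_comm (a := b i)]) (fun i => by simp [hΛ₁, h0]) (fun i => by simp [hΛ₀, h0])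
    δ hδ1 (fun i j => by
      by_cases hb : b i = b j
      · left; simp [hΛ₁, hΛ₀, hb]
      · right; exact ⟨by simp [hΛ₀, hb], hδ i j hb⟩) u hu
  have g1 : P.real {ω | ∀ i, X (t i) ω ≤ u} = P.real {ω | ∀ i, Z i ω ≤ u} := by
    refine measureReal_congr ?_
    filter_upwards [hZX] with ω hω
    refine propext ⟨fun h i => ?_, fun h i => ?_⟩
    · rw [← hω]; exact h i
    · rw [hω]; exact h i
  have g2 : ∀ k, P.real {ω | ∀ i, b i = k → X (t i) ω ≤ u} = P.real {ω | ∀ i, b i = k → Z i ω ≤ u} := by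
    intro k
    refine measureReal_congr ?_
    filter_upwards [hZX] with ω hω
    refine propext ⟨fun h i hi => ?_, fun h i hi => ?_⟩
    · rw [← hω]; exact h i hi
    · rw [hω]; exact h i hi
  have g3 : (Measure.pi (fun _ : β => P)).real {w | ∀ i, Z i (w (b i)) ≤ u} = ∏ k, P.real {ω | ∀ i, b i = k → Z i ω ≤ u} := by
    have : {w : β → Ω | ∀ i, Z i (w (b i)) ≤ u} = Set.pi univ fun k => {ω | ∀ i, b i = k → Z i ω ≤ u} := by
      ext w
      simp only [mem_setOf_eq, Set.mem_pi, mem_univ, forall_const]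
      exact ⟨fun h k i hi => hi ▸ h i, fun h i => h (b i) i rfl⟩
    rw [this, measureReal_def, Measure.pi_pi, ENNReal.toReal_prod]
    rfl
  rw [g1, Finset.prod_congr rfl fun k _ => g2 k, ← g3]
  refine hmain.trans (le_of_eq ?_)
  congr 1
  refine Finset.sum_congr rfl fun i _ => Finset.sum_congr rfl fun j _ => ?_
  by_cases hb : b i = b j <;> simp [hΛ₀, hΛ₁, hb]

end P6


section P7

lemma gpa_mills : ∃ c : ℝ, 0 < c ∧ ∀ u : ℝ, 1 ≤ u →
    c * Real.exp (-u^2/2) / u ≤ ((gaussianReal 0 1) (Ioi u)).toReal := by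
  refine ⟨(√(2 * Real.pi))⁻¹ * Real.exp (-(3/2)), by positivity, fun u hu => ?_⟩
  have hu0 : 0 < u := by linarith
  rw [← ENNReal.ofReal_le_iff_le_toReal (measure_ne_top _ _)]
  rw [gaussianReal_apply 0 (by norm_num) (Ioi u)]
  calc ENNReal.ofReal ((√(2 * Real.pi))⁻¹ * Real.exp (-(3/2)) * Real.exp (-u^2/2) / u)
      = ENNReal.ofReal ((√(2 * Real.pi))⁻¹ * Real.exp (-(3/2)) * Real.exp (-u^2/2)) * volume (Ioc u (u + 1/u)) := by
        rw [Real.volume_Ioc, ← ENNReal.ofReal_mul (by positivity)]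
        congr 1; field_simp; ring
    _ = ∫⁻ x in Ioc u (u + 1/u), ENNReal.ofReal ((√(2 * Real.pi))⁻¹ * Real.exp (-(3/2)) * Real.exp (-u^2/2)) := by
        rw [setLIntegral_const]
    _ ≤ ∫⁻ x in Ioc u (u + 1/u), gaussianPDF 0 1 x := by
        refine setLIntegral_mono (measurable_gaussianPDF 0 1) fun x hx => ?_
        rw [gaussianPDF_def]
        refine ENNReal.ofReal_le_ofReal ?_
        rw [gaussianPDFReal, mul_assoc, ← Real.exp_add]
        simp only [NNReal.coe_one, mul_one, sub_zero]
        refine mul_le_mul_of_nonneg_left (Real.exp_le_exp.2 ?_) (by positivity)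
        have h1 : 1 / u ≤ 1 := by rw [div_le_one hu0]; exact hu
        have h2 : 0 < 1 / u := by positivity
        have h3 : u * (1 / u) = 1 := by field_simp
        have h4 : x ^ 2 ≤ (u + 1/u) ^ 2 := by
          have := hx.1; have := hx.2
          gcongr
          linarith
        nlinarith
    _ ≤ ∫⁻ x in Ioi u, gaussianPDF 0 1 x := lintegral_mono_set Ioc_subset_Ioi_self

noncomputable def gpaG (r : ℝ → ℝ) (ε u s : ℝ) : ℝ :=
  if ε ≤ s then |r s| * Real.exp (-u^2/(1+|r s|)) else 0

lemma gpaG_nonneg (r : ℝ → ℝ) (ε u s : ℝ) : 0 ≤ gpaG r ε u s := by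
  unfold gpaG; split_ifs <;> positivity

lemma gpaG_le_one (r : ℝ → ℝ) (ε u s δ : ℝ) (hδ : 0 < δ) (hδ1 : δ < 1) (h : ∀ t, ε ≤ t → |r t| ≤ δ) :
    gpaG r ε u s ≤ Real.exp (-u^2/(1+δ)) := by
  unfold gpaG
  split_ifs with hs
  · have h1 := h s hs
    have h2 := abs_nonneg (r s)
    calc |r s| * Real.exp (-u^2/(1+|r s|)) ≤ 1 * Real.exp (-u^2/(1+δ)) := by
          refine mul_le_mul (by linarith) (Real.exp_le_exp.2 ?_) (by positivity) (by norm_num)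
          rw [neg_div, neg_div, neg_le_neg_iff]
          gcongr
      _ = _ := one_mul _
  · positivity

lemma gpaG_le_two (r : ℝ → ℝ) (ε u s s0 : ℝ) (hs0 : 0 ≤ s0) (h : |r s| ≤ s0) :
    gpaG r ε u s ≤ s0 * Real.exp (-u^2 + u^2 * s0) := by
  unfold gpaG
  have h2 := abs_nonneg (r s)
  split_ifs with hs
  · refine mul_le_mul h (Real.exp_le_exp.2 ?_) (by positivity) (by positivity)
    calc -u^2/(1+|r s|) ≤ -u^2/(1+s0) := by
          rw [neg_div, neg_div, neg_le_neg_iff]; gcongr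
      _ ≤ -u^2 + u^2 * s0 := by
          rw [div_le_iff₀ (by positivity)]
          nlinarith [mul_nonneg (sq_nonneg u) (sq_nonneg s0)]
  · positivity

lemma gpa_sum_bound (r : ℝ → ℝ) (ε u q R δ V s0 : ℝ) (M : ℕ) (hq : 0 < q) (hM : (M:ℝ) + 1 ≤ R)
    (hδ : 0 < δ) (hδ1 : δ < 1) (h : ∀ t, ε ≤ t → |r t| ≤ δ) (hV0 : 0 ≤ V) (hs0 : 0 ≤ s0)
    (hV : ∀ t, V < t → |r t| ≤ s0) :
    ∑ p ∈ Finset.range (M+1), gpaG r ε u (p * q) ≤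
      (V/q+1) * Real.exp (-u^2/(1+δ)) + R * (s0 * Real.exp (-u^2 + u^2 * s0)) := by
  rw [← Finset.sum_filter_add_sum_filter_not _ (fun p : ℕ => (p:ℝ) * q ≤ V)]
  refine add_le_add ?_ ?_
  · refine (Finset.sum_le_card_nsmul _ _ (Real.exp (-u^2/(1+δ))) fun p _ => gpaG_le_one r ε u _ δ hδ hδ1 h).trans ?_
    rw [nsmul_eq_mul]
    refine mul_le_mul_of_nonneg_right ?_ (by positivity)
    have hsub : (Finset.range (M+1)).filter (fun p : ℕ => (p:ℝ) * q ≤ V) ⊆ Finset.range (⌊V/q⌋₊ + 1) := by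
      intro p hp
      rw [Finset.mem_filter] at hp
      rw [Finset.mem_range, Nat.lt_succ_iff]
      refine Nat.le_floor ?_
      rw [le_div_iff₀ hq]; exact hp.2
    have := Finset.card_le_card hsub
    rw [Finset.card_range] at this
    calc _ ≤ ((⌊V/q⌋₊ + 1 : ℕ) : ℝ) := by exact_mod_cast this
      _ ≤ V/q + 1 := by push_cast; linarith [Nat.floor_le (show 0 ≤ V/q by positivity)]
  · refine (Finset.sum_le_card_nsmul _ _ (s0 * Real.exp (-u^2 + u^2 * s0)) fun p hp => ?_).trans ?_
    · rw [Finset.mem_filter, not_le] at hp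
      exact gpaG_le_two r ε u _ s0 hs0 (hV _ hp.2)
    · rw [nsmul_eq_mul]
      refine mul_le_mul_of_nonneg_right (le_trans ?_ hM) (by positivity)
      have := Finset.card_filter_le (Finset.range (M+1)) (fun p : ℕ => ¬ (p:ℝ) * q ≤ V)
      rw [Finset.card_range] at this
      exact_mod_cast this

lemma gpa_dist_sum (g : ℝ → ℝ) (hg : ∀ x, 0 ≤ g x) (q : ℝ) (hq : 0 < q) (M k : ℕ) (hk : k ≤ M) :
    ∑ l ∈ Finset.range (M+1), g (|(k:ℝ) * q - l * q|) ≤ 2 * ∑ p ∈ Finset.range (M+1), g (p * q) := by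
  have key : ∀ (s : Finset ℕ) (φ : ℕ → ℕ), Set.InjOn φ s → s.image φ ⊆ Finset.range (M+1) →
      (∀ l ∈ s, |(k:ℝ) * q - l * q| = (φ l : ℝ) * q) →
      ∑ l ∈ s, g (|(k:ℝ) * q - l * q|) ≤ ∑ p ∈ Finset.range (M+1), g (p * q) := by
    intro s φ hφ hs hd
    have h1 : ∑ l ∈ s, g (|(k:ℝ) * q - l * q|) = ∑ p ∈ s.image φ, g (p * q) := by
      rw [Finset.sum_image hφ]
      exact Finset.sum_congr rfl fun l hl => by rw [hd l hl]
    rw [h1]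
    exact Finset.sum_le_sum_of_subset_of_nonneg hs fun _ _ _ => hg _
  rw [← Finset.sum_filter_add_sum_filter_not _ (fun l : ℕ => l ≤ k), two_mul]
  refine add_le_add (key _ (fun l => k - l) ?_ ?_ ?_) (key _ (fun l => l - k) ?_ ?_ ?_)
  · intro x hx y hy hxy
    simp at hx hy hxy; omega
  · intro p hp
    simp only [Finset.mem_image, Finset.mem_filter, Finset.mem_range] at hp ⊢
    omega
  · intro l hl
    have hl2 := (Finset.mem_filter.1 hl).2
    rw [Nat.cast_sub hl2, ← sub_mul, abs_of_nonneg]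
    have : (l:ℝ) ≤ k := by exact_mod_cast hl2
    exact mul_nonneg (by linarith) hq.le
  · intro x hx y hy hxy
    simp at hx hy hxy; omega
  · intro p hp
    simp only [Finset.mem_image, Finset.mem_filter, Finset.mem_range] at hp ⊢
    omega
  · intro l hl
    have hl2 := (not_le.1 (Finset.mem_filter.1 hl).2).le
    rw [Nat.cast_sub hl2, abs_sub_comm, ← sub_mul, abs_of_nonneg]
    have : (k:ℝ) ≤ l := by exact_mod_cast hl2
    exact mul_nonneg (by linarith) hq.le

lemma gpa_decay (γ κ : ℝ) (hκ : 0 < κ) :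
    Tendsto (fun u : ℝ => u ^ γ * Real.exp (-κ * u^2)) atTop (𝓝 0) := by
  refine squeeze_zero' ?_ ?_ (tendsto_rpow_mul_exp_neg_mul_atTop_nhds_zero γ κ hκ)
  · filter_upwards [eventually_gt_atTop 0] with u hu
    positivity
  · filter_upwards [eventually_ge_atTop 1] with u hu
    refine mul_le_mul_of_nonneg_left (Real.exp_le_exp.2 ?_) (by positivity)
    nlinarith [mul_nonneg hκ.le (mul_nonneg (by linarith : (0:ℝ) ≤ u) (by linarith : (0:ℝ) ≤ u - 1))]

/-- The asymptotic estimate for the Berman sum. -/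
lemma gpa_asymp (r : ℝ → ℝ) (hA3 : Tendsto (fun t => r t * Real.log t) atTop (𝓝 0))
    (ε δ : ℝ) (hδ : 0 < δ) (hδ1 : δ < 1) (h : ∀ t, ε ≤ t → |r t| ≤ δ)
    (a γ K : ℝ) (ha : 0 < a) (hγ : 0 ≤ γ) (hK : 0 < K) (e : ℝ) (he : 0 < e) :
    ∀ᶠ u in atTop, ∀ M : ℕ, (M:ℝ) + 1 ≤ K * (u * Real.exp (u^2/2)) →
      ((M:ℝ) + 1) * ∑ p ∈ Finset.range (M+1), gpaG r ε u (p * (a * u ^ (-γ))) < e := by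
  set β : ℝ := (1 - δ) / (2 * (1 + δ)) with hβ
  have hβ0 : 0 < β := by rw [hβ]; apply div_pos <;> linarith
  set κ : ℝ := 1/(1+δ) - 1/2 - β/2 with hκdef
  have hκ : 0 < κ := by
    have : κ = (1 - δ) / (4 * (1 + δ)) := by rw [hκdef, hβ]; field_simp; ring
    rw [this]; apply div_pos <;> linarith
  obtain ⟨η, hη0, hη1, hη2⟩ : ∃ η : ℝ, 0 < η ∧ 2 * η / β ≤ 1 ∧ K^2 * (2 * η / β) * Real.exp 1 < e / 2 := by
    refine ⟨min (β/2) (β * e / (8 * K^2 * Real.exp 1)), by positivity, ?_, ?_⟩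
    · rw [div_le_one hβ0]; linarith [min_le_left (β/2) (β * e / (8 * K^2 * Real.exp 1))]
    · calc _ ≤ K^2 * (2 * (β * e / (8 * K^2 * Real.exp 1)) / β) * Real.exp 1 := by
            gcongr; exact min_le_right _ _
        _ = e / 4 := by field_simp; norm_num
        _ < e / 2 := by linarith
  have hVt : Tendsto (fun u : ℝ => Real.exp (β * u^2/2)) atTop atTop := by
    refine Real.tendsto_exp_atTop.comp ?_
    have : Tendsto (fun u : ℝ => (β/2) * u^2) atTop atTop :=
      (tendsto_pow_atTop (by norm_num)).const_mul_atTop (by positivity)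
    refine this.congr fun u => by ring
  have hr : ∀ᶠ t in atTop, |r t * Real.log t| < η := by
    have := hA3.abs; rw [abs_zero] at this
    exact this.eventually (gt_mem_nhds hη0)
  obtain ⟨t0, ht0⟩ := eventually_atTop.1 hr
  have hd := (gpa_decay (1 + γ) κ hκ).const_mul (K * (1/a + 1))
  rw [mul_zero] at hd
  filter_upwards [hVt.eventually_ge_atTop t0, hd.eventually (gt_mem_nhds (half_pos he)), eventually_ge_atTop 1] with u hu1 hu2 hu3 M hM
  have hu0 : 0 < u := by linarith
  set V := Real.exp (β * u^2/2) with hVdef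
  have hV1 : 1 ≤ V := by rw [hVdef]; exact Real.one_le_exp (by positivity)
  set R := K * (u * Real.exp (u^2/2)) with hR
  have hR0 : 0 < R := by positivity
  have hq : 0 < a * u ^ (-γ) := by positivity
  set s0 := 2 * η / β / u^2 with hs0
  have hs00 : 0 ≤ s0 := by positivity
  have hVs : ∀ t, V < t → |r t| ≤ s0 := by
    intro t ht
    have h1 := ht0 t (hu1.trans ht.le)
    have h2 : β * u^2/2 ≤ Real.log t := by
      rw [Real.le_log_iff_exp_le (by linarith)]; exact ht.le
    have h3 : 0 < β * u^2/2 := by positivity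
    rw [abs_mul, abs_of_pos (h3.trans_le h2)] at h1
    have h4 : |r t| * (β * u^2/2) ≤ η := (mul_le_mul_of_nonneg_left h2 (abs_nonneg _)).trans h1.le
    have : s0 = η / (β * u^2/2) := by rw [hs0]; field_simp
    rw [this, le_div_iff₀ h3]; exact h4
  have hb := gpa_sum_bound r ε u (a * u ^ (-γ)) R δ V s0 M hq hM hδ hδ1 h (by linarith) hs00 hVs
  have hS : 0 ≤ ∑ p ∈ Finset.range (M+1), gpaG r ε u (p * (a * u ^ (-γ))) :=
    Finset.sum_nonneg fun p _ => gpaG_nonneg _ _ _ _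
  have e2 : u^2 * s0 = 2 * η / β := by rw [hs0]; field_simp
  calc _ ≤ R * ((V/(a * u ^ (-γ))+1) * Real.exp (-u^2/(1+δ)) + R * (s0 * Real.exp (-u^2 + u^2 * s0))) :=
        mul_le_mul hM hb hS hR0.le
    _ = R * (V/(a * u ^ (-γ))+1) * Real.exp (-u^2/(1+δ)) + R^2 * (s0 * Real.exp (-u^2 + u^2 * s0)) := by ring
    _ ≤ K * (1/a+1) * (u ^ (1 + γ) * Real.exp (-κ * u^2)) + K^2 * (2 * η / β) * Real.exp 1 := by
        refine add_le_add ?_ ?_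
        · have c1 : V/(a * u ^ (-γ))+1 ≤ (1/a+1) * (V * u ^ γ) := by
            have : V/(a * u ^ (-γ)) = 1/a * (V * u ^ γ) := by
              rw [Real.rpow_neg hu0.le]; field_simp
            rw [this, add_mul, one_mul]
            have : 1 ≤ V * u ^ γ := one_le_mul_of_one_le_of_one_le hV1 (Real.one_le_rpow hu3 hγ)
            linarith
          have c2 : Real.exp (-κ * u^2) = Real.exp (u^2/2) * V * Real.exp (-u^2/(1+δ)) := by
            rw [hVdef, ← Real.exp_add, ← Real.exp_add]; congr 1; rw [hκdef]; ring
          rw [c2, Real.rpow_add hu0, Real.rpow_one, hR]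
          calc _ ≤ K * (u * Real.exp (u^2/2)) * ((1/a+1) * (V * u ^ γ)) * Real.exp (-u^2/(1+δ)) := by gcongr
            _ = _ := by ring
        · rw [e2, hR, mul_pow, mul_pow, ← Real.exp_nat_mul, Real.exp_add]
          have c3 : Real.exp ((2:ℕ) * (u^2/2)) * Real.exp (-u^2) = 1 := by
            rw [← Real.exp_add, ← Real.exp_zero]; congr 1; push_cast; ring
          calc _ = K^2 * (u^2 * s0) * (Real.exp ((2:ℕ) * (u^2/2)) * Real.exp (-u^2)) * Real.exp (2 * η / β) := by ring
            _ = K^2 * (2 * η / β) * Real.exp (2 * η / β) := by rw [c3, e2, mul_one]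
            _ ≤ _ := by gcongr
    _ < e := by linarith

end P7


section P8

lemma gpa_grid {Ω : Type*} [MeasurableSpace Ω] (P : Measure Ω) [IsProbabilityMeasure P]
    (X : ℝ → Ω → ℝ) (r : ℝ → ℝ)
    (hGauss : ∀ (n : ℕ) (c : Fin n → ℝ) (t : Fin n → ℝ), (∀ i, 0 ≤ t i) →
      Measure.map (fun ω => ∑ i, c i * X (t i) ω) P
        = gaussianReal 0 (Real.toNNReal (∑ i, ∑ j, c i * c j * r (|t i - t j|))))
    (h0 : r 0 = 1) (ε : ℝ) (hε0 : 0 < ε) (δ : ℝ) (hδ1 : δ < 1) (h : ∀ t, ε ≤ t → |r t| ≤ δ)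
    (u q : ℝ) (hu : 0 < u) (hq : 0 < q) (N : ℕ) :
    |(P {ω | ∀ k : ℕ, (∃ j ∈ Finset.Icc 1 N, (k : ℝ) * q ∈ Icc ((j : ℝ) - 1 + ε) (j : ℝ)) →
            X ((k : ℝ) * q) ω ≤ u}).toReal
          - ∏ j ∈ Finset.Icc 1 N, (P {ω | ∀ k : ℕ, (k : ℝ) * q ∈ Icc ((j : ℝ) - 1 + ε) (j : ℝ) →
                  X ((k : ℝ) * q) ω ≤ u}).toReal| ≤
      ((√(1-δ^2))⁻¹ * (2 * ∫ x, |deriv Real.smoothTransition x|)^2) *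
        (((⌊N / q⌋₊ : ℝ) + 1) * ∑ p ∈ Finset.range (⌊N / q⌋₊ + 1), gpaG r ε u (p * q)) := by
  classical
  set M := ⌊N / q⌋₊ with hMdef
  set K₀ := (√(1-δ^2))⁻¹ * (2 * ∫ x, |deriv Real.smoothTransition x|)^2 with hK₀
  have hK₀0 : 0 ≤ K₀ := by positivity
  let S : Finset ℕ := (Finset.range (M+1)).filter
    (fun k => ∃ j ∈ Finset.Icc 1 N, (k : ℝ) * q ∈ Icc ((j : ℝ) - 1 + ε) (j : ℝ))
  have hS : ∀ k : ℕ, (∃ j ∈ Finset.Icc 1 N, (k : ℝ) * q ∈ Icc ((j : ℝ) - 1 + ε) (j : ℝ)) → k ∈ S := by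
    rintro k ⟨j, hj, hk⟩
    refine Finset.mem_filter.2 ⟨?_, j, hj, hk⟩
    rw [Finset.mem_range, Nat.lt_succ_iff]
    refine Nat.le_floor ?_
    rw [le_div_iff₀ hq]
    have : (j:ℝ) ≤ N := by exact_mod_cast (Finset.mem_Icc.1 hj).2
    exact hk.2.trans this
  have hS2 : ∀ k : S, ∃ j ∈ Finset.Icc 1 N, ((k : ℕ) : ℝ) * q ∈ Icc ((j : ℝ) - 1 + ε) (j : ℝ) :=
    fun k => (Finset.mem_filter.1 k.2).2
  choose b hbm hb using hS2
  have huniq : ∀ (x : ℝ) (i j : ℕ), i < j → x ∈ Icc ((i : ℝ) - 1 + ε) (i : ℝ) → ∀ y ∈ Icc ((j : ℝ) - 1 + ε) (j : ℝ), ε ≤ y - x := by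
    intro x i j hij hx y hy
    have : (i:ℝ) + 1 ≤ j := by exact_mod_cast hij
    linarith [hx.2, hy.1]
  have hsep : ∀ k l : S, b k ≠ b l → ε ≤ |((k : ℕ) : ℝ) * q - ((l : ℕ) : ℝ) * q| := by
    intro k l hkl
    rcases lt_or_gt_of_ne hkl with h1 | h1
    · rw [abs_sub_comm]
      exact (huniq _ _ _ h1 (hb k) _ (hb l)).trans (le_abs_self _)
    · exact (huniq _ _ _ h1 (hb l) _ (hb k)).trans (le_abs_self _)
  have hmain := gpa_blocks P X r hGauss h0 (ι := S) (β := Finset.Icc 1 N) (fun k => ((k : ℕ) : ℝ) * q)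
    (fun k => by positivity) (fun k => ⟨b k, hbm k⟩) δ hδ1
    (fun k l hkl => h _ (hsep k l fun h' => hkl (Subtype.ext h'))) u hu
  have e1 : {ω | ∀ k : ℕ, (∃ j ∈ Finset.Icc 1 N, (k : ℝ) * q ∈ Icc ((j : ℝ) - 1 + ε) (j : ℝ)) →
            X ((k : ℝ) * q) ω ≤ u} = {ω | ∀ k : S, X (((k : ℕ) : ℝ) * q) ω ≤ u} := by
    ext ω
    exact ⟨fun hω k => hω k ⟨b k, hbm k, hb k⟩, fun hω k hk => hω ⟨k, hS k hk⟩⟩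
  have e2 : ∏ j ∈ Finset.Icc 1 N, (P {ω | ∀ k : ℕ, (k : ℝ) * q ∈ Icc ((j : ℝ) - 1 + ε) (j : ℝ) →
                  X ((k : ℝ) * q) ω ≤ u}).toReal =
      ∏ j : Finset.Icc 1 N, P.real {ω | ∀ k : S, (⟨b k, hbm k⟩ : Finset.Icc 1 N) = j → X (((k : ℕ) : ℝ) * q) ω ≤ u} := by
    rw [← Finset.prod_coe_sort]
    refine Finset.prod_congr rfl fun j _ => ?_
    rw [measureReal_def]
    congr 2
    ext ω
    refine ⟨fun hω k hk => hω k ?_, fun hω k hk => ?_⟩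
    · rw [← hk]; exact hb k
    · refine hω ⟨k, hS k ⟨j, j.2, hk⟩⟩ (Subtype.ext ?_)
      by_contra hne
      rcases lt_or_gt_of_ne hne with h1 | h1
      · have := huniq _ _ _ h1 (hb ⟨k, hS k ⟨j, j.2, hk⟩⟩) _ hk
        simp at this; linarith
      · have := huniq _ _ _ h1 hk _ (hb ⟨k, hS k ⟨j, j.2, hk⟩⟩)
        simp at this; linarith
  rw [e1, e2]
  refine hmain.trans ?_
  have e3 : ∀ k l : S, (if (⟨b k, hbm k⟩ : Finset.Icc 1 N) = ⟨b l, hbm l⟩ then 0 else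
        |r (|((k : ℕ) : ℝ) * q - ((l : ℕ) : ℝ) * q|)| * ((√(1-δ^2))⁻¹ *
          Real.exp (-u^2/(1+|r (|((k : ℕ) : ℝ) * q - ((l : ℕ) : ℝ) * q|)|)) *
          (2 * ∫ x, |deriv Real.smoothTransition x|)^2)) ≤ K₀ * gpaG r ε u (|((k : ℕ) : ℝ) * q - ((l : ℕ) : ℝ) * q|) := by
    intro k l
    split_ifs with hkl
    · exact mul_nonneg hK₀0 (gpaG_nonneg _ _ _ _)
    · rw [gpaG, if_pos (hsep k l fun h' => hkl (Subtype.ext h'))]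
      refine le_of_eq ?_
      rw [hK₀]; ring
  have e4 : ∀ k : S, ∑ l : S, gpaG r ε u (|((k : ℕ) : ℝ) * q - ((l : ℕ) : ℝ) * q|) ≤
      2 * ∑ p ∈ Finset.range (M+1), gpaG r ε u (p * q) := by
    intro k
    rw [Finset.sum_coe_sort S (fun l : ℕ => gpaG r ε u (|((k : ℕ) : ℝ) * q - (l : ℝ) * q|))]
    refine (Finset.sum_le_sum_of_subset_of_nonneg (Finset.filter_subset _ _) fun _ _ _ => gpaG_nonneg _ _ _ _).trans ?_
    refine gpa_dist_sum (gpaG r ε u) (gpaG_nonneg r ε u) q hq M k ?_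
    have := Finset.mem_range.1 (Finset.mem_filter.1 k.2).1
    omega
  have hsum0 : 0 ≤ ∑ p ∈ Finset.range (M+1), gpaG r ε u (p * q) :=
    Finset.sum_nonneg fun p _ => gpaG_nonneg _ _ _ _
  calc _ ≤ (∑ k : S, ∑ l : S, K₀ * gpaG r ε u (|((k : ℕ) : ℝ) * q - ((l : ℕ) : ℝ) * q|)) / 2 := by
        gcongr with k _ l _
        exact e3 k l
    _ ≤ (∑ k : S, K₀ * (2 * ∑ p ∈ Finset.range (M+1), gpaG r ε u (p * q))) / 2 := by
        gcongr with k _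
        rw [← Finset.mul_sum]
        exact mul_le_mul_of_nonneg_left (e4 k) hK₀0
    _ = K₀ * ((S.card : ℝ) * ∑ p ∈ Finset.range (M+1), gpaG r ε u (p * q)) := by
        rw [Finset.sum_const, Finset.card_univ, Fintype.card_coe, nsmul_eq_mul]; ring
    _ ≤ _ := by
        refine mul_le_mul_of_nonneg_left (mul_le_mul_of_nonneg_right ?_ hsum0) hK₀0
        have hcard : S.card ≤ M + 1 := by
          have := Finset.card_le_card (Finset.filter_subset _ _ : S ⊆ Finset.range (M+1))
          rwa [Finset.card_range] at this
        exact_mod_cast hcard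

end P8

theorem grid_product_approximation
    {Ω : Type*} [MeasurableSpace Ω] (P : Measure Ω) [IsProbabilityMeasure P]
    (X : ℝ → Ω → ℝ) (r : ℝ → ℝ) (C α : ℝ)
    (hα : 0 < α) (hα2 : α ≤ 2) (hC : 0 < C)
    -- centered stationary Gaussian process with covariance function r
    (hGauss : ∀ (n : ℕ) (c : Fin n → ℝ) (t : Fin n → ℝ), (∀ i, 0 ≤ t i) →
      Measure.map (fun ω => ∑ i, c i * X (t i) ω) P
        = gaussianReal 0 (Real.toNNReal (∑ i, ∑ j, c i * c j * r (|t i - t j|))))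
    -- a.s. continuous sample paths
    (hcont : ∀ᵐ ω ∂P, ContinuousOn (fun t => X t ω) (Ici 0))
    -- (A1)
    (hA1 : (fun t => r t - (1 - C * |t| ^ α)) =o[𝓝[>] (0:ℝ)] fun t => |t| ^ α)
    -- (A2)
    (hA2 : ∀ t : ℝ, 0 < t → r t < 1)
    -- (A3)
    (hA3 : Tendsto (fun t => r t * Real.log t) atTop (𝓝 0))
    -- Pickands constant, defined via a standard fractional Brownian motion `B`
    -- with Hurst parameter `α/2`
    {Ω' : Type*} [MeasurableSpace Ω'] (P' : Measure Ω') [IsProbabilityMeasure P']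
    (B : ℝ → Ω' → ℝ)
    (hB : ∀ (n : ℕ) (c : Fin n → ℝ) (t : Fin n → ℝ), (∀ i, 0 ≤ t i) →
      Measure.map (fun ω => ∑ i, c i * B (t i) ω) P'
        = gaussianReal 0 (Real.toNNReal (∑ i, ∑ j,
            c i * c j * ((t i ^ α + t j ^ α - |t i - t j| ^ α) / 2))))
    (HS : ℝ → ℝ)
    (hHS : ∀ S : ℝ, HS S
      = ∫ ω, Real.exp (sSup ((fun t => Real.sqrt 2 * B t ω - t ^ α) '' Icc 0 S)) ∂P')
    (Hα : ℝ) (hHα : Tendsto (fun S => HS S / S) atTop (𝓝 Hα))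
    -- the function m(u) = [C^{1/α} H_α u^{2/α} Ψ(u)]⁻¹
    (m : ℝ → ℝ)
    (hm : ∀ u : ℝ, m u
      = (C ^ (1/α) * Hα * u ^ (2/α) * ((gaussianReal 0 1) (Ioi u)).toReal)⁻¹)
    (ε : ℝ) (hε0 : 0 < ε) (hε1 : ε < 1)
    (A₀ Ainf : ℝ) (hA₀ : 0 < A₀) (hAA : A₀ < Ainf)
    (a : ℝ) (ha : 0 < a)
    (q : ℝ → ℝ) (hq : ∀ u : ℝ, q u = a * u ^ (-(2/α)))
    :
    TendstoUniformlyOn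
      (fun u x =>
        (P {ω | ∀ k : ℕ,
            (∃ j ∈ Finset.Icc 1 ⌊x * m u⌋₊,
              (k : ℝ) * q u ∈ Icc ((j : ℝ) - 1 + ε) (j : ℝ)) →
            X ((k : ℝ) * q u) ω ≤ u}).toReal
          - ∏ j ∈ Finset.Icc 1 ⌊x * m u⌋₊,
              (P {ω | ∀ k : ℕ, (k : ℝ) * q u ∈ Icc ((j : ℝ) - 1 + ε) (j : ℝ) →
                  X ((k : ℝ) * q u) ω ≤ u}).toReal)
      (fun _ => 0) atTop (Icc A₀ Ainf) := by
  have h1 := gpa_r_tendsto_one r C α hα hA1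
  obtain ⟨hr0, hrc⟩ := gpa_r_cont P X r hGauss hcont h1
  obtain ⟨δ, hδ0, hδ1, hδ⟩ := gpa_r_bound P X r hGauss hr0 hrc hA2 (gpa_r_tendsto_zero r hA3) ε hε0
  obtain ⟨c, hc, hmills⟩ := gpa_mills
  rw [Metric.tendstoUniformlyOn_iff]
  intro e he
  simp only [Real.dist_eq, zero_sub, abs_neg]
  have hAi : 0 < Ainf := hA₀.trans hAA
  rcases le_or_gt Hα 0 with hH | hH
  · filter_upwards [eventually_gt_atTop 0] with u hu x hx
    have hmu : m u ≤ 0 := by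
      rw [hm]
      refine inv_nonpos.2 ?_
      have hC' : 0 ≤ C ^ (1/α) := by positivity
      have hu' : 0 ≤ u ^ (2/α) := by positivity
      exact mul_nonpos_of_nonpos_of_nonneg (mul_nonpos_of_nonpos_of_nonneg
        (mul_nonpos_of_nonneg_of_nonpos hC' hH) hu') ENNReal.toReal_nonneg
    have hfl : ⌊x * m u⌋₊ = 0 :=
      Nat.floor_of_nonpos (mul_nonpos_of_nonneg_of_nonpos (hA₀.le.trans hx.1) hmu)
    rw [hfl]
    simpa using he
  · set K₀ := (√(1-δ^2))⁻¹ * (2 * ∫ x, |deriv Real.smoothTransition x|)^2 with hK₀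
    have hK₀0 : 0 ≤ K₀ := by positivity
    have hCp : 0 < C ^ (1/α) := by positivity
    set K₁ := Ainf / (C ^ (1/α) * Hα * a * c) with hK₁
    have hK₁0 : 0 < K₁ := by positivity
    have has := gpa_asymp r hA3 ε δ hδ0 hδ1 hδ a (2/α) (K₁ + 1) ha (by positivity) (by positivity)
      (e / (K₀ + 1)) (by positivity)
    filter_upwards [has, eventually_ge_atTop 1] with u hu hu1 x hx
    have hu0 : 0 < u := by linarith
    have hqu : 0 < q u := by rw [hq]; positivity
    have hΨ := hmills u hu1
    set Ψ := ((gaussianReal 0 1) (Ioi u)).toReal with hΨdef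
    have hΨ0 : 0 < Ψ := lt_of_lt_of_le (by positivity) hΨ
    have hmu : 0 < m u := by rw [hm]; positivity
    have hx0 : 0 < x := hA₀.trans_le hx.1
    have hg := gpa_grid P X r hGauss hr0 ε hε0 δ hδ1 hδ u (q u) hu0 hqu ⌊x * m u⌋₊
    refine hg.trans_lt ?_
    have hM : ((⌊(⌊x * m u⌋₊ : ℝ) / q u⌋₊ : ℝ)) + 1 ≤ (K₁ + 1) * (u * Real.exp (u^2/2)) := by
      have f1 : ((⌊(⌊x * m u⌋₊ : ℝ) / q u⌋₊ : ℝ)) ≤ Ainf * m u / q u := by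
        refine (Nat.floor_le (by positivity)).trans ?_
        gcongr
        refine (Nat.floor_le (by positivity)).trans ?_
        gcongr
        exact hx.2
      have f2 : Ainf * m u / q u = Ainf / (C ^ (1/α) * Hα * a) / Ψ := by
        rw [hm, hq, Real.rpow_neg hu0.le, ← hΨdef]
        have hW : 0 < u ^ (2/α) := by positivity
        generalize u ^ (2/α) = W at hW
        generalize C ^ (1/α) = D at hCp
        clear_value Ψ
        field_simp
      have f3 : Ainf / (C ^ (1/α) * Hα * a) / Ψ ≤ Ainf / (C ^ (1/α) * Hα * a) / (c * Real.exp (-u^2/2) / u) := by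
        gcongr
      have f4 : Ainf / (C ^ (1/α) * Hα * a) / (c * Real.exp (-u^2/2) / u) = K₁ * (u * Real.exp (u^2/2)) := by
        rw [neg_div, Real.exp_neg, hK₁]
        field_simp
      have f5 : 1 ≤ u * Real.exp (u^2/2) :=
        one_le_mul_of_one_le_of_one_le hu1 (Real.one_le_exp (by positivity))
      linarith [add_mul K₁ 1 (u * Real.exp (u^2/2))]
    have hlt := hu _ hM
    rw [← hq u] at hlt
    have hnn : 0 ≤ ((⌊(⌊x * m u⌋₊ : ℝ) / q u⌋₊ : ℝ) + 1) *
        ∑ p ∈ Finset.range (⌊(⌊x * m u⌋₊ : ℝ) / q u⌋₊ + 1), gpaG r ε u (p * q u) :=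
      mul_nonneg (by positivity) (Finset.sum_nonneg fun p _ => gpaG_nonneg _ _ _ _)
    rw [lt_div_iff₀ (by positivity)] at hlt
    nlinarith
end

section
/- Assume (A1)–(A3) and let T be a nonnegative random variable independent of {X(t)} with slowly varying tail, P(T > t) = L(t). Then for every A_0 > 0, as u → ∞, ∫_0^{A_0 m(u)} P(sup_{s ∈ [0,t]} X(s) > u) dF_T(t) ≤ A_0 · P(T > m(u)) · (1 + o(1)), where F_T is the distribution function of T; consequently limsup_{u → ∞} P(sup_{s ∈ [0,T]} X(s) > u) / P(T > m(u)) ≤ 1. -/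
open MeasureTheory ProbabilityTheory Filter Set Topology

lemma gauss_aem {Ω : Type*} [MeasurableSpace Ω] {P : Measure Ω} {f : Ω → ℝ} {v : NNReal}
    (h : P.map f = gaussianReal 0 v) : AEMeasurable f P :=
  aemeasurable_of_map_neZero (by rw [h]; infer_instance)

lemma gauss_tail {Ω : Type*} [MeasurableSpace Ω] {P : Measure Ω} [IsProbabilityMeasure P]
    {f : Ω → ℝ} {v : NNReal}
    (h : P.map f = gaussianReal 0 v) (V : ℝ) (hV : 0 < V) (hvV : (v:ℝ) ≤ V) (y : ℝ) (hy : 0 ≤ y) :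
    P.real {ω | f ω ≤ -y} ≤ Real.exp (-(y^2/(2*V))) := by
  have hm := gauss_aem h
  have hint : Integrable (fun ω => Real.exp ((-(y/V)) * f ω)) P := by
    have := (integrable_exp_mul_gaussianReal (μ := 0) (v := v) (-(y/V)))
    rw [← h] at this
    exact this.comp_aemeasurable hm
  have h1 := measure_le_le_exp_mul_mgf (μ := P) (X := f) (t := -(y/V)) (-y)
    (by have : 0 ≤ y/V := by positivity
        linarith) hint
  refine h1.trans ?_
  rw [mgf_gaussianReal h, ← Real.exp_add]
  apply Real.exp_le_exp.mpr
  have : (v:ℝ) * (-(y/V))^2/2 ≤ V * (-(y/V))^2/2 := by gcongr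
  have e : V * (-(y/V))^2/2 = y^2/(2*V) := by field_simp
  have e2 : - -(y/V) * -y = -(2*(y^2/(2*V))) := by field_simp
  rw [e] at this
  rw [e2]; linarith

lemma psi_ratio (u : ℝ) (hu : 1 ≤ u) :
    gaussianReal 0 1 (Ioi (u - 1/u)) ≤ ENNReal.ofReal (1 + Real.exp 2) * gaussianReal 0 1 (Ioi u) := by
  have hu0 : 0 < u := by linarith
  have h1u : 1/u ≤ u := by rw [div_le_iff₀ hu0]; nlinarith
  have hp : 0 < 1/u := by positivity
  have hmono : ∀ x y : ℝ, 0 ≤ x → x ≤ y → gaussianPDF 0 1 y ≤ gaussianPDF 0 1 x := by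
    intro x y hx hxy
    unfold gaussianPDF gaussianPDFReal
    apply ENNReal.ofReal_le_ofReal
    gcongr
  have hval : gaussianPDF 0 1 (u - 1/u) = ENNReal.ofReal (Real.exp 2) * gaussianPDF 0 1 (u+1/u) := by
    unfold gaussianPDF gaussianPDFReal
    rw [← ENNReal.ofReal_mul (by positivity)]
    congr 1
    rw [mul_left_comm, ← Real.exp_add]
    congr 2
    simp; field_simp; ring
  have hA : gaussianReal 0 1 (Ioc (u - 1/u) u) ≤ ENNReal.ofReal (1/u) * gaussianPDF 0 1 (u - 1/u) := by
    rw [gaussianReal_apply _ one_ne_zero]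
    calc _ ≤ ∫⁻ x in Ioc (u - 1/u) u, gaussianPDF 0 1 (u - 1/u) := by
          apply setLIntegral_mono measurable_const
          intro x hx
          exact hmono _ _ (by linarith) hx.1.le
      _ = _ := by
          rw [setLIntegral_const, Real.volume_Ioc, mul_comm]; congr 2; ring
  have hB : ENNReal.ofReal (1/u) * gaussianPDF 0 1 (u + 1/u) ≤ gaussianReal 0 1 (Ioi u) := by
    refine le_trans ?_ (measure_mono (Ioc_subset_Ioi_self : Ioc u (u+1/u) ⊆ Ioi u))
    rw [gaussianReal_apply _ one_ne_zero]
    calc _ = ∫⁻ x in Ioc u (u+1/u), gaussianPDF 0 1 (u + 1/u) := by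
          rw [setLIntegral_const, Real.volume_Ioc, mul_comm]; congr 2; ring
      _ ≤ _ := by
          apply setLIntegral_mono (measurable_gaussianPDF _ _)
          intro x hx
          exact hmono _ _ (by linarith [hx.1]) hx.2
  have hsub : Ioi (u - 1/u) ⊆ Ioc (u-1/u) u ∪ Ioi u := by
    intro x hx
    rcases le_or_gt x u with h | h
    · exact Or.inl ⟨hx, h⟩
    · exact Or.inr h
  calc _ ≤ gaussianReal 0 1 (Ioc (u-1/u) u) + gaussianReal 0 1 (Ioi u) :=
        (measure_mono hsub).trans (measure_union_le _ _)
    _ ≤ ENNReal.ofReal (Real.exp 2) * gaussianReal 0 1 (Ioi u) + gaussianReal 0 1 (Ioi u) := by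
        gcongr
        refine hA.trans ?_
        rw [hval, mul_left_comm]
        gcongr
    _ = _ := by
        rw [ENNReal.ofReal_add (by norm_num) (by positivity), add_mul, ENNReal.ofReal_one, one_mul, add_comm]

lemma pair_bound {Ω : Type*} [MeasurableSpace Ω] {P : Measure Ω} [IsProbabilityMeasure P]
    {X Y : Ω → ℝ} {ρ : ℝ} (hρ0 : 0 ≤ ρ) (hρ1 : ρ ≤ 1)
    (h : ∀ a b : ℝ, P.map (fun ω => a * X ω + b * Y ω)
      = gaussianReal 0 (Real.toNNReal (a^2 + b^2 + 2*a*b*ρ)))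
    (x v y V : ℝ) (hV : 0 < V) (hVρ : 1 - ρ^2 ≤ V) (hy : 0 ≤ y) (hxy : x - ρ * v ≤ - y) :
    P {ω | X ω ≤ x ∧ v < Y ω} ≤ ENNReal.ofReal (Real.exp (-(y^2/(2*V)))) * gaussianReal 0 1 (Ioi v) := by
  have hW : P.map (fun ω => X ω - ρ * Y ω) = gaussianReal 0 (Real.toNNReal (1 - ρ^2)) := by
    have := h 1 (-ρ)
    convert this using 3
    · ring
    · ring
  have hY : P.map Y = gaussianReal 0 1 := by
    have := h 0 1
    simpa using this
  have hWm := gauss_aem hW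
  have hYm := gauss_aem hY
  have hρ2 : 0 ≤ 1 - ρ^2 := by nlinarith
  have hind : IndepFun (fun ω => X ω - ρ * Y ω) Y P := by
    rw [indepFun_iff_charFun_prod hWm hYm]
    intro t
    have e : charFun (P.map (fun ω => WithLp.toLp 2 (X ω - ρ * Y ω, Y ω))) t
        = charFun (P.map (fun ω => t.ofLp.1 * X ω + (t.ofLp.2 - ρ * t.ofLp.1) * Y ω)) 1 := by
      rw [charFun_apply, charFun_apply, integral_map, integral_map]
      · congr 1
        ext ω
        congr 2
        simp [WithLp.prod_inner_apply]
        ring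
      · exact gauss_aem (h _ _)
      · exact Continuous.aestronglyMeasurable (by fun_prop)
      · fun_prop
      · exact Continuous.aestronglyMeasurable (by fun_prop)
    rw [e, h, hW, hY, charFun_gaussianReal, charFun_gaussianReal, charFun_gaussianReal,
      ← Complex.exp_add]
    have e1 : ((Real.toNNReal (1 - ρ^2) : NNReal) : ℝ) = 1 - ρ^2 := Real.coe_toNNReal _ hρ2
    have e2 : ((Real.toNNReal (t.ofLp.1^2 + (t.ofLp.2 - ρ * t.ofLp.1)^2
        + 2*t.ofLp.1*(t.ofLp.2 - ρ * t.ofLp.1)*ρ) : NNReal) : ℝ) = t.ofLp.1^2*(1-ρ^2) + t.ofLp.2^2 := by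
      rw [Real.coe_toNNReal]
      · ring
      · have : 0 ≤ t.ofLp.1^2*(1-ρ^2) + t.ofLp.2^2 := by positivity
        linarith
    congr 1
    simp only [e1, e2]
    push_cast
    simp
    ring
  have hsub : {ω | X ω ≤ x ∧ v < Y ω} ⊆
      (fun ω => X ω - ρ * Y ω) ⁻¹' (Iic (-y)) ∩ Y ⁻¹' (Ioi v) := by
    rintro ω ⟨h1, h2⟩
    refine ⟨?_, h2⟩
    simp only [mem_preimage, mem_Iic]
    nlinarith
  refine (measure_mono hsub).trans ?_
  rw [hind.measure_inter_preimage_eq_mul _ _ measurableSet_Iic measurableSet_Ioi]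
  gcongr
  · rw [ENNReal.le_ofReal_iff_toReal_le (by finiteness) (by positivity)]
    exact gauss_tail hW V hV (by rw [Real.coe_toNNReal _ hρ2]; exact hVρ) y hy
  · rw [← hY, Measure.map_apply_of_aemeasurable hYm measurableSet_Ioi]

lemma chain_det (f : ℝ → ℝ) (a d u : ℝ) (hd : 0 < d) (hf : ContinuousOn f (Icc a (a+d)))
    (l : ℕ → ℝ) (hl : Monotone l) (hlu : ∀ n, l n ≤ u)
    (t : ℝ) (ht : t ∈ Icc a (a+d)) (hut : u < f t) :
    l 0 < f a ∨ ∃ n : ℕ, ∃ j : ℕ, j < 2^n ∧ f (a + d * ((j:ℝ) / 2^n)) ≤ l n ∧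
      l (n+1) < f (a + d * ((2*j+1) / 2^(n+1))) := by
  by_contra hcon
  push Not at hcon
  obtain ⟨h0, hs⟩ := hcon
  have key : ∀ N : ℕ, ∀ k : ℕ, k < 2^N → f (a + d * (k/2^N)) ≤ l N := by
    intro N
    induction N with
    | zero =>
      intro k hk
      have : k = 0 := by simpa using hk
      subst this
      simpa using h0
    | succ N ih =>
      intro k hk
      rcases Nat.even_or_odd' k with ⟨c, rfl | rfl⟩
      · have : c < 2^N := by rw [pow_succ] at hk; omega
        refine le_trans ?_ ((ih c this).trans (hl (Nat.le_succ N)))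
        apply le_of_eq
        congr 3
        push_cast
        rw [pow_succ]
        field_simp
      · have : c < 2^N := by rw [pow_succ] at hk; omega
        have := hs N c this (ih c this)
        push_cast
        exact this
  set s := (t - a)/d with hsdef
  have hs0 : 0 ≤ s := div_nonneg (by linarith [ht.1]) hd.le
  have hs1 : s ≤ 1 := by rw [hsdef, div_le_one hd]; linarith [ht.2]
  have hts : t = a + d * s := by rw [hsdef]; field_simp; ring
  let k : ℕ → ℕ := fun N => ⌈(2:ℝ)^N * s⌉₊ - 1
  have hk : ∀ N, k N < 2^N := by
    intro N
    have : ⌈(2:ℝ)^N * s⌉₊ ≤ 2^N := by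
      apply Nat.ceil_le.mpr
      push_cast
      have : (0:ℝ) < 2^N := by positivity
      nlinarith
    have h2 : 0 < 2^N := by positivity
    show ⌈(2:ℝ)^N * s⌉₊ - 1 < 2^N
    omega
  have hkle : ∀ N, (k N : ℝ)/2^N ≤ s := by
    intro N
    rw [div_le_iff₀ (by positivity), mul_comm]
    rcases Nat.eq_zero_or_pos ⌈(2:ℝ)^N * s⌉₊ with h | h
    · simp [k, h]; positivity
    · have : (k N) < ⌈(2:ℝ)^N * s⌉₊ := by show _ - 1 < _; omega
      exact (Nat.lt_ceil.mp this).le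
  have hkge : ∀ N, s - (1/2)^N ≤ (k N : ℝ)/2^N := by
    intro N
    rw [le_div_iff₀ (by positivity), sub_mul, ← mul_pow]
    norm_num
    have h1 := Nat.le_ceil ((2:ℝ)^N * s)
    have h2 : ⌈(2:ℝ)^N * s⌉₊ ≤ k N + 1 := by show _ ≤ _ - 1 + 1; omega
    have h3 : ((⌈(2:ℝ)^N * s⌉₊ : ℕ) : ℝ) ≤ k N + 1 := by exact_mod_cast h2
    linarith
  have hlim : Tendsto (fun N => (k N : ℝ)/2^N) atTop (𝓝 s) := by
    refine tendsto_of_tendsto_of_tendsto_of_le_of_le ?_ tendsto_const_nhds hkge hkle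
    have := (tendsto_const_nhds (x := s)).sub (tendsto_pow_atTop_nhds_zero_of_lt_one (r := (1/2:ℝ)) (by norm_num) (by norm_num))
    simpa using this
  have hlim2 : Tendsto (fun N => a + d * ((k N : ℝ)/2^N)) atTop (𝓝[Icc a (a+d)] t) := by
    apply tendsto_nhdsWithin_iff.mpr
    refine ⟨?_, Eventually.of_forall fun N => ?_⟩
    · rw [hts]; exact (hlim.const_mul d).const_add a
    · have : (0:ℝ) ≤ (k N : ℝ)/2^N := by positivity
      have := hkle N
      constructor <;> nlinarith
  have hfl := (hf t ht).tendsto.comp hlim2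
  have : f t ≤ u := le_of_tendsto hfl (Eventually.of_forall fun N => (key N _ (hk N)).trans (hlu N))
  linarith

lemma r_zero {Ω : Type*} [MeasurableSpace Ω] (P : Measure Ω) [IsProbabilityMeasure P]
    (X : ℝ → Ω → ℝ) (r : ℝ → ℝ)
    (hGauss : ∀ (n : ℕ) (c : Fin n → ℝ) (t : Fin n → ℝ), (∀ i, 0 ≤ t i) →
      Measure.map (fun ω => ∑ i, c i * X (t i) ω) P
        = gaussianReal 0 (Real.toNNReal (∑ i, ∑ j, c i * c j * r (|t i - t j|))))
    (hcont : ∀ᵐ ω ∂P, ContinuousOn (fun t => X t ω) (Ici 0))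
    (hr : Tendsto r (𝓝[>] 0) (𝓝 1)) : r 0 = 1 := by
  have key : ∀ n : ℕ, max ((n:ℝ) * r 0 + (n^2 - n)) 0 = max ((n:ℝ)^2 * r 0) 0 := by
    intro n
    have hlaw : ∀ h : ℝ, 0 ≤ h → ∫ ω, Complex.exp ((∑ i : Fin n, 1 * X ((i:ℕ) * h) ω : ℝ) * Complex.I) ∂P
        = Complex.exp (-((max (∑ i : Fin n, ∑ j : Fin n, (1:ℝ) * 1 * r |((i:ℕ):ℝ) * h - ((j:ℕ):ℝ) * h|) 0 : ℝ) : ℂ) / 2) := by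
      intro h hh
      have hG := hGauss n (fun _ => 1) (fun i => (i:ℕ) * h) (fun i => by positivity)
      have e : charFun (P.map (fun ω => ∑ i : Fin n, 1 * X ((i:ℕ) * h) ω)) 1 = 
          ∫ ω, Complex.exp ((∑ i : Fin n, 1 * X ((i:ℕ) * h) ω : ℝ) * Complex.I) ∂P := by
        rw [charFun_apply_real, integral_map (gauss_aem hG)
          (Continuous.aestronglyMeasurable (by fun_prop))]
        simp
      rw [← e, hG, charFun_gaussianReal]
      congr 1
      simp only [Real.coe_toNNReal']
      simp
      ring
    have hlim1 : Tendsto (fun h : ℝ => ∑ i : Fin n, ∑ j : Fin n, (1:ℝ) * 1 * r |((i:ℕ):ℝ) * h - ((j:ℕ):ℝ) * h|)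
        (𝓝[>] 0) (𝓝 (∑ i : Fin n, ∑ j : Fin n, if i = j then r 0 else 1)) := by
      refine tendsto_finsetSum _ fun i _ => tendsto_finsetSum _ fun j _ => ?_
      split_ifs with hij
      · subst hij; simp
      · have hne : ((i:ℕ):ℝ) - ((j:ℕ):ℝ) ≠ 0 := by
          rw [sub_ne_zero]
          intro h
          exact hij (Fin.ext (by exact_mod_cast h))
        have : Tendsto (fun h : ℝ => |((i:ℕ):ℝ) * h - ((j:ℕ):ℝ) * h|) (𝓝[>] 0) (𝓝[>] 0) := by
          apply tendsto_nhdsWithin_iff.mpr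
          constructor
          · have : Continuous (fun h : ℝ => |((i:ℕ):ℝ) * h - ((j:ℕ):ℝ) * h|) := by fun_prop
            have := this.tendsto 0
            simp only [mul_zero, sub_self, abs_zero] at this
            exact this.mono_left nhdsWithin_le_nhds
          · filter_upwards [self_mem_nhdsWithin] with h hh
            rw [← sub_mul]
            exact abs_pos.mpr (mul_ne_zero hne (ne_of_gt hh))
        simpa [Function.comp_def] using hr.comp this
    have hlim2 : Tendsto (fun h : ℝ => ∫ ω, Complex.exp ((∑ i : Fin n, 1 * X ((i:ℕ) * h) ω : ℝ) * Complex.I) ∂P)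
        (𝓝[>] 0) (𝓝 (∫ ω, Complex.exp ((∑ i : Fin n, 1 * X ((i:ℕ) * (0:ℝ)) ω : ℝ) * Complex.I) ∂P)) := by
      apply tendsto_integral_filter_of_dominated_convergence (fun _ => (1:ℝ))
      · filter_upwards [self_mem_nhdsWithin] with h hh
        have hG := hGauss n (fun _ => 1) (fun i => (i:ℕ) * h) (fun i => mul_nonneg (Nat.cast_nonneg _) (le_of_lt (mem_Ioi.mp hh)))
        have := (gauss_aem hG)
        have hc : Continuous (fun x : ℝ => Complex.exp ((x:ℂ) * Complex.I)) := by fun_prop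
        exact (hc.measurable.comp_aemeasurable this).aestronglyMeasurable
      · refine Eventually.of_forall fun h => Eventually.of_forall fun ω => ?_
        rw [Complex.norm_exp_ofReal_mul_I]
      · exact integrable_const _
      · filter_upwards [hcont] with ω hω
        have hc : Continuous (fun x : ℝ => Complex.exp ((x:ℂ) * Complex.I)) := by fun_prop
        refine (hc.tendsto _).comp ?_
        refine tendsto_finsetSum _ fun i _ => ?_
        refine Tendsto.const_mul _ ?_
        have h1 := (hω 0 (mem_Ici.mpr le_rfl)).tendsto
        have h2 : Tendsto (fun h : ℝ => ((i:ℕ):ℝ) * h) (𝓝[>] 0) (𝓝[Ici 0] 0) := by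
          apply tendsto_nhdsWithin_iff.mpr
          constructor
          · have : Continuous (fun h : ℝ => ((i:ℕ):ℝ) * h) := by fun_prop
            have := this.tendsto 0
            simp only [mul_zero] at this
            exact this.mono_left nhdsWithin_le_nhds
          · filter_upwards [self_mem_nhdsWithin] with h hh
            have := le_of_lt (mem_Ioi.mp hh)
            simp only [mem_Ici]; positivity
        simpa [Function.comp_def] using h1.comp h2
    have hlim3 : Tendsto (fun h : ℝ => ∫ ω, Complex.exp ((∑ i : Fin n, 1 * X ((i:ℕ) * h) ω : ℝ) * Complex.I) ∂P)
        (𝓝[>] 0) (𝓝 (Complex.exp (-((max (∑ i : Fin n, ∑ j : Fin n, if i = j then r 0 else 1) 0 : ℝ) : ℂ) / 2))) := by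
      have hc : Continuous (fun x : ℝ => Complex.exp (-((max x 0 : ℝ) : ℂ) / 2)) := by fun_prop
      refine ((hc.tendsto _).comp hlim1).congr' ?_
      filter_upwards [self_mem_nhdsWithin] with h hh
      rw [hlaw h (le_of_lt hh)]; rfl
    have heq := tendsto_nhds_unique hlim2 hlim3
    rw [hlaw 0 le_rfl] at heq
    have heq' := congrArg Complex.re heq
    rw [← Complex.ofReal_neg, ← Complex.ofReal_neg, ← Complex.ofReal_ofNat, ← Complex.ofReal_div, ← Complex.ofReal_div,
      Complex.exp_ofReal_re, Complex.exp_ofReal_re, Real.exp_eq_exp] at heq'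
    have h3 : (∑ i : Fin n, ∑ j : Fin n, if i = j then r 0 else (1:ℝ)) = (n:ℝ) * r 0 + (n^2 - n) := by
      have : ∀ i j : Fin n, (if i = j then r 0 else (1:ℝ)) = 1 + (if i = j then r 0 - 1 else 0) := by
        intro i j; split_ifs <;> ring
      simp only [this, Finset.sum_add_distrib]
      simp
      ring
    rw [h3] at heq'
    simp at heq'
    rw [← heq']
    congr 1; ring
  rcases lt_or_ge 0 (r 0) with h | h
  · have := key 2
    rw [max_eq_left (by norm_num; linarith), max_eq_left (by positivity)] at this
    norm_num at this
    linarith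
  · exfalso
    obtain ⟨n, hn⟩ := exists_nat_gt (1 - r 0)
    have hn0 : (0:ℝ) < n := by linarith
    have := key n
    have h2 : 0 < (n:ℝ) * r 0 + (n^2 - n) := by nlinarith
    rw [max_eq_left h2.le, max_eq_right (by nlinarith)] at this
    linarith

lemma summable_aux (c b : ℝ) (hc : 0 < c) (hb : 1 < b) :
    Summable (fun n : ℕ => (2:ℝ)^n * Real.exp (-(c * b^n))) := by
  obtain ⟨k, hk⟩ := pow_unbounded_of_one_lt 4 hb
  have : Summable (fun n : ℕ => (k.factorial / c^k : ℝ) * (1/2)^n) :=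
    (summable_geometric_of_lt_one (by norm_num) (by norm_num)).mul_left _
  refine Summable.of_nonneg_of_le (fun n => by positivity) (fun n => ?_) this
  have hb0 : 0 < b := by linarith
  have h1 := Real.pow_div_factorial_le_exp (c * b^n) (by positivity) k
  rw [Real.exp_neg]
  have h2 : (c * b^n)^k = c^k * (b^k)^n := by rw [mul_pow, ← pow_mul, ← pow_mul, mul_comm k n]
  have h3 : (4:ℝ)^n ≤ (b^k)^n := by gcongr
  have h4 : c^k * 4^n / k.factorial ≤ Real.exp (c * b^n) := by
    refine le_trans ?_ h1
    rw [h2]; gcongr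
  have hf : (0:ℝ) < k.factorial := by exact_mod_cast Nat.factorial_pos k
  calc (2:ℝ)^n * (Real.exp (c*b^n))⁻¹ ≤ 2^n * (c^k * 4^n / k.factorial)⁻¹ := by gcongr
    _ = _ := by
      have : (4:ℝ)^n = 2^n*2^n := by rw [← mul_pow]; norm_num
      rw [this, div_pow]; field_simp; simp

lemma block_bound {Ω : Type*} [MeasurableSpace Ω] (P : Measure Ω) [IsProbabilityMeasure P]
    (X : ℝ → Ω → ℝ) (r : ℝ → ℝ) (C α h0 : ℝ) (hα : 0 < α) (hC : 0 < C) (hh0 : 0 < h0)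
    (hpair : ∀ p q : ℝ, 0 ≤ p → 0 ≤ q → ∀ a b : ℝ, P.map (fun ω => a * X p ω + b * X q ω)
      = gaussianReal 0 (Real.toNNReal (a^2 + b^2 + 2*a*b*r |p - q|)))
    (hr : ∀ h : ℝ, 0 < h → h < h0 → 0 ≤ r h ∧ r h ≤ 1 ∧ 1 - 2 * C * h^α ≤ r h) :
    ∃ δ > (0:ℝ), ∃ u0 ≥ (1:ℝ), ∃ K ≥ (0:ℝ), ∃ S : ℝ → ℝ → Set (ℝ → ℝ), ∀ u ≥ u0, ∀ a ≥ 0,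
      MeasurableSet (S u a) ∧
      P ((fun ω t => X t ω) ⁻¹' (S u a)) ≤ ENNReal.ofReal K * gaussianReal 0 1 (Ioi u) ∧
      ∀ f : ℝ → ℝ, ContinuousOn f (Ici 0) → ∀ t ∈ Icc a (a + δ * u ^ (-(2/α))), u < f t → f ∈ S u a := by
  set b : ℝ := 2 ^ (-(α/4)) with hbdef
  have hb0 : 0 < b := by positivity
  have hb1 : b < 1 := Real.rpow_lt_one_of_one_lt_of_neg (by norm_num) (by linarith)
  set κ : ℝ := 1 - b with hκdef
  have hκ : 0 < κ := by linarith
  set δ : ℝ := (κ/(4*C))^(1/α) with hδdef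
  have hδ : 0 < δ := by positivity
  have hδα : δ^α = κ/(4*C) := by
    rw [hδdef, ← Real.rpow_mul (by positivity), one_div_mul_cancel hα.ne', Real.rpow_one]
  let d : ℝ → ℝ := fun u => δ * u ^ (-(2/α))
  have hdlim : Tendsto d atTop (𝓝 0) := by
    have := (tendsto_rpow_neg_atTop (y := 2/α) (by positivity)).const_mul δ
    simpa using this
  obtain ⟨u1, hu1⟩ := eventually_atTop.mp (hdlim.eventually (gt_mem_nhds hh0))
  have hb2 : 1 < (b^2)⁻¹ := by
    rw [one_lt_inv₀ (by positivity)]; nlinarith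
  have hsum := summable_aux (κ/8) (b^2)⁻¹ (by positivity) hb2
  set Sg : ℝ := ∑' n : ℕ, (2:ℝ)^n * Real.exp (-(κ/8 * (b^2)⁻¹^n)) with hSg
  have hSg0 : 0 ≤ Sg := tsum_nonneg fun n => by positivity
  let pp : ℝ → ℝ → ℕ → ℕ → ℝ := fun u a n j => a + d u * ((j:ℝ)/2^n)
  let qq : ℝ → ℝ → ℕ → ℕ → ℝ := fun u a n j => a + d u * ((2*(j:ℝ)+1)/2^(n+1))
  let l : ℝ → ℕ → ℝ := fun u n => u - b^n/u
  refine ⟨δ, hδ, max 1 u1, le_max_left _ _, (1 + Sg) * (1 + Real.exp 2), by positivity,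
    fun u a => {f | l u 0 < f a} ∪ ⋃ n : ℕ, ⋃ j ∈ Finset.range (2^n),
      {f | f (pp u a n j) ≤ l u n ∧ l u (n+1) < f (qq u a n j)}, ?_⟩
  intro u hu a ha
  have hu1' : 1 ≤ u := (le_max_left _ _).trans hu
  have hu0 : 0 < u := by linarith
  have hdu : d u < h0 := hu1 u ((le_max_right _ _).trans hu)
  have hd0 : 0 < d u := by positivity
  have hdα : (d u)^α = κ/(4*C)/u^2 := by
    show (δ * u ^ (-(2/α)))^α = _
    rw [Real.mul_rpow hδ.le (by positivity), hδα, ← Real.rpow_mul hu0.le, neg_mul,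
      div_mul_cancel₀ _ hα.ne', Real.rpow_neg hu0.le]
    norm_num
    rfl
  refine ⟨?_, ?_, ?_⟩
  · apply MeasurableSet.union
    · exact measurableSet_lt measurable_const (measurable_pi_apply _)
    · refine MeasurableSet.iUnion fun n => Finset.measurableSet_biUnion _ fun j _ => ?_
      exact (measurableSet_le (measurable_pi_apply _) measurable_const).inter
        (measurableSet_lt measurable_const (measurable_pi_apply _))
  · have hbn1 : ∀ n, b^n ≤ 1 := fun n => pow_le_one₀ hb0.le hb1.le
    have hΨ : ∀ n, gaussianReal 0 1 (Ioi (l u n)) ≤ gaussianReal 0 1 (Ioi (u - 1/u)) := by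
      intro n
      apply measure_mono
      apply Ioi_subset_Ioi
      show u - 1/u ≤ u - b^n/u
      have := hbn1 n
      gcongr
    have hfirst : P {ω | l u 0 < X a ω} ≤ gaussianReal 0 1 (Ioi (u - 1/u)) := by
      have hX : P.map (X a) = gaussianReal 0 1 := by
        have := hpair a a ha ha 1 0
        simpa using this
      refine le_trans (le_of_eq ?_) (hΨ 0)
      rw [← hX, Measure.map_apply_of_aemeasurable (gauss_aem hX) measurableSet_Ioi]; rfl
    have hterm : ∀ n j, P {ω | X (pp u a n j) ω ≤ l u n ∧ l u (n+1) < X (qq u a n j) ω}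
        ≤ ENNReal.ofReal (Real.exp (-(κ/8 * (b^2)⁻¹^n))) * gaussianReal 0 1 (Ioi (u - 1/u)) := by
      intro n j
      set h : ℝ := d u / 2^(n+1) with hh
      have hhpos : 0 < h := by positivity
      have hhlt : h < h0 := by
        refine lt_of_le_of_lt ?_ hdu
        apply div_le_self hd0.le
        exact one_le_pow₀ (by norm_num)
      have hpq : |pp u a n j - qq u a n j| = h := by
        have : pp u a n j - qq u a n j = -h := by
          simp only [pp, qq, hh, pow_succ]; field_simp; ring
        rw [this, abs_neg, abs_of_pos hhpos]
      have hhα : h^α = κ/(4*C)/u^2 * b^(4*(n+1)) := by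
        rw [hh, Real.div_rpow hd0.le (by positivity), hdα, div_eq_mul_inv]
        congr 1
        rw [hbdef, ← Real.rpow_natCast, ← Real.rpow_natCast, ← Real.rpow_mul (by norm_num),
          ← Real.rpow_mul (by norm_num), ← Real.rpow_neg (by norm_num)]
        congr 1
        push_cast; ring
      obtain ⟨hr0, hr1, hr2⟩ := hr h hhpos hhlt
      have hr3 : 1 - r h ≤ κ/2 * b^(4*(n+1)) / u^2 := by
        rw [hhα] at hr2
        have : 2 * C * (κ/(4*C)/u^2 * b^(4*(n+1))) = κ/2 * b^(4*(n+1)) / u^2 := by field_simp; norm_num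
        linarith
      have hbb1 : b^(4*(n+1)) ≤ b^n := pow_le_pow_of_le_one hb0.le hb1.le (by omega)
      have hbb2 : b^(4*(n+1)) ≤ b^(4*n) := pow_le_pow_of_le_one hb0.le hb1.le (by omega)
      have hlu1 : l u (n+1) ≤ u := by
        show u - b^(n+1)/u ≤ u
        have : 0 ≤ b^(n+1)/u := by positivity
        linarith
      have hpl := hpair (pp u a n j) (qq u a n j) (by positivity) (by positivity)
      rw [hpq] at hpl
      have hpb := pair_bound hr0 hr1 hpl (l u n) (l u (n+1)) (κ/2 * b^n/u) (κ * b^(4*n)/u^2)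
        (by positivity) ?_ (by positivity) ?_
      · refine hpb.trans ?_
        have e : (κ/2*b^n/u)^2/(2*(κ * b^(4*n)/u^2)) = κ/8 * (b^2)⁻¹^n := by
          rw [inv_pow, ← pow_mul, show 4*n = n + n + 2*n by ring, pow_add, pow_add]
          field_simp; norm_num
        rw [e]
        exact mul_le_mul_right (hΨ _) _
      · have h1 : κ/2 * b^(4*(n+1)) / u^2 ≤ κ/2 * b^(4*n) / u^2 := by gcongr
        have h2 : κ/2 * b^(4*n) / u^2 = (κ * b^(4*n) / u^2)/2 := by ring
        nlinarith
      · have h1 : (1 - r h) * l u (n+1) ≤ (1 - r h) * u :=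
          mul_le_mul_of_nonneg_left hlu1 (by linarith)
        have h2 : (1 - r h) * u ≤ κ/2 * b^(4*(n+1)) / u^2 * u :=
          mul_le_mul_of_nonneg_right hr3 hu0.le
        have h3 : κ/2 * b^(4*(n+1)) / u^2 * u = κ/2 * b^(4*(n+1)) / u := by field_simp
        have h4 : κ/2 * b^(4*(n+1)) / u ≤ κ/2 * b^n / u := by gcongr
        have h5 : l u n - l u (n+1) = -(κ/2*b^n/u) - κ/2*b^n/u := by
          simp only [l, hκdef, pow_succ]; field_simp; ring
        linarith
    have hpre : (fun ω t => X t ω) ⁻¹' ({f | l u 0 < f a} ∪ ⋃ n : ℕ, ⋃ j ∈ Finset.range (2^n),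
      {f | f (pp u a n j) ≤ l u n ∧ l u (n+1) < f (qq u a n j)})
        = {ω | l u 0 < X a ω} ∪ ⋃ n : ℕ, ⋃ j ∈ Finset.range (2^n),
        {ω | X (pp u a n j) ω ≤ l u n ∧ l u (n+1) < X (qq u a n j) ω} := by
      ext ω; simp
    rw [hpre]
    calc _ ≤ P {ω | l u 0 < X a ω} + ∑' n : ℕ, ∑ j ∈ Finset.range (2^n),
          P {ω | X (pp u a n j) ω ≤ l u n ∧ l u (n+1) < X (qq u a n j) ω} := by
          refine (measure_union_le _ _).trans ?_
          gcongr
          refine (measure_iUnion_le _).trans ?_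
          exact ENNReal.tsum_le_tsum fun n => measure_biUnion_finset_le _ _
      _ ≤ gaussianReal 0 1 (Ioi (u - 1/u)) + ∑' n : ℕ, 
          ENNReal.ofReal ((2:ℝ)^n * Real.exp (-(κ/8 * (b^2)⁻¹^n))) * gaussianReal 0 1 (Ioi (u - 1/u)) := by
          gcongr with n
          refine (Finset.sum_le_sum fun j _ => hterm n j).trans ?_
          rw [Finset.sum_const, Finset.card_range, nsmul_eq_mul, ENNReal.ofReal_mul (by positivity), mul_assoc]
          apply le_of_eq
          congr 1
          rw [ENNReal.ofReal_pow (by norm_num)]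
          simp
      _ = ENNReal.ofReal (1 + Sg) * gaussianReal 0 1 (Ioi (u - 1/u)) := by
          rw [ENNReal.tsum_mul_right, ← ENNReal.ofReal_tsum_of_nonneg (fun n => by positivity) hsum,
            ENNReal.ofReal_add (by norm_num) hSg0, add_mul, ENNReal.ofReal_one, one_mul]
      _ ≤ _ := by
          rw [ENNReal.ofReal_mul (by positivity), mul_assoc]
          gcongr
          exact psi_ratio u hu1'
  · intro f hf t ht hut
    have hlm : Monotone (l u) := by
      intro m n hmn
      show u - b^m/u ≤ u - b^n/u
      have := pow_le_pow_of_le_one hb0.le hb1.le hmn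
      gcongr
    have := chain_det f a (d u) u hd0 (hf.mono (fun x hx => mem_Ici.mpr (ha.trans hx.1))) (l u) hlm
      (fun n => by
        show u - b^n/u ≤ u
        have : 0 ≤ b^n/u := by positivity
        linarith) t ht hut
    rcases this with h | ⟨n, j, hj, h1, h2⟩
    · exact Or.inl h
    · refine Or.inr ?_
      simp only [mem_iUnion]
      exact ⟨n, j, Finset.mem_range.mpr hj, h1, h2⟩

lemma slow_aux (G L : ℝ → ℝ) (hG : Monotone G) (hG0 : ∀ x, 0 ≤ G x)
    (hL0 : ∀ x, 0 < x → 0 < L x) (hLa : ∀ x y, 0 < x → x ≤ y → L y ≤ L x)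
    (hrec : ∀ x, 0 < x → G x ≤ G (x/2) + x * (L (x/2) - L x))
    (hL : Tendsto (fun t => L (1/2 * t) / L t) atTop (𝓝 1)) :
    Tendsto (fun x => G x / (x * L x)) atTop (𝓝 0) := by
  rw [Metric.tendsto_atTop]
  intro ε hε
  set η : ℝ := min (ε/6) (1/2) with hη
  have hη0 : 0 < η := by positivity
  have hη1 : η ≤ 1/2 := min_le_right _ _
  have hηε : η ≤ ε/6 := min_le_left _ _
  obtain ⟨x1, hx1⟩ := eventually_atTop.mp (hL.eventually (gt_mem_nhds (show (1:ℝ) < 1 + η by linarith)))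
  set x0 := max x1 1 with hx0
  have hx0p : 0 < x0 := lt_of_lt_of_le one_pos (le_max_right _ _)
  have hstep : ∀ x, x0 ≤ x → G x / (x * L x) ≤ 3/4 * (G (x/2) / (x/2 * L (x/2))) + η := by
    intro x hx
    have hxp : 0 < x := hx0p.trans_le hx
    have hLx := hL0 x hxp
    have hLx2 := hL0 (x/2) (by positivity)
    have h1 := hx1 x ((le_max_left _ _).trans hx)
    rw [show 1/2 * x = x/2 by ring, div_lt_iff₀ hLx] at h1
    have h2 := hrec x hxp
    have h3 := hG0 (x/2)
    rw [div_le_iff₀ (by positivity)]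
    have e : (3/4 * (G (x/2) / (x/2 * L (x/2))) + η) * (x * L x)
      = 3/2 * G (x/2) * (L x / L (x/2)) + η * x * L x := by field_simp; ring
    rw [e]
    have h4 : 2/3 ≤ L x / L (x/2) := by
      rw [le_div_iff₀ hLx2]; nlinarith
    have h5 : G (x/2) ≤ 3/2 * G (x/2) * (L x / L (x/2)) := by nlinarith
    have h6 : x * (L (x/2) - L x) ≤ x * (η * L x) := by
      apply mul_le_mul_of_nonneg_left _ hxp.le; linarith
    linarith
  set M : ℝ := G (2*x0) / (x0 * L (2*x0)) with hM
  have hM0 : 0 ≤ M := div_nonneg (hG0 _) (mul_nonneg hx0p.le (hL0 _ (by positivity)).le)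
  have hind : ∀ n : ℕ, ∀ x, 2^n * x0 ≤ x → x < 2^(n+1) * x0 → G x / (x * L x) ≤ (3/4)^n * M + 4*η := by
    intro n
    induction n with
    | zero =>
      intro x h1 h2
      simp at h1 h2
      have hxp : 0 < x := hx0p.trans_le h1
      have : G x / (x * L x) ≤ M := by
        have a1 := hG h2.le
        have a2 := hLa x (2*x0) hxp h2.le
        have a3 := hL0 (2*x0) (by positivity)
        have a4 := hG0 (2*x0)
        rw [hM]
        gcongr
      simp; linarith
    | succ n ih =>
      intro x h1 h2
      have hp : (1:ℝ) ≤ 2^(n+1) := one_le_pow₀ (by norm_num)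
      have hx : x0 ≤ x := by nlinarith
      have h3 := ih (x/2) (by rw [pow_succ] at h1; linarith) (by rw [pow_succ] at h2; linarith)
      have h4 := hstep x hx
      rw [pow_succ]
      linarith
  obtain ⟨N, hN⟩ := exists_pow_lt_of_lt_one (show 0 < η/(M+1) by positivity) (show (3/4:ℝ) < 1 by norm_num)
  refine ⟨2^N * x0, fun x hx => ?_⟩
  have hp : (1:ℝ) ≤ 2^N := one_le_pow₀ (by norm_num)
  have hxx : x0 ≤ x := by nlinarith
  have hxp : 0 < x := hx0p.trans_le hxx
  obtain ⟨n, hn1, hn2⟩ := exists_nat_pow_near ((one_le_div hx0p).mpr hxx) (show (1:ℝ) < 2 by norm_num)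
  rw [le_div_iff₀ hx0p] at hn1
  rw [div_lt_iff₀ hx0p] at hn2
  have hb := hind n x hn1 hn2
  have hNn : N ≤ n := by
    by_contra hcon
    push Not at hcon
    have : (2:ℝ)^(n+1) ≤ 2^N := pow_le_pow_right₀ (by norm_num) hcon
    nlinarith
  have h1 : (3/4:ℝ)^n ≤ (3/4)^N := pow_le_pow_of_le_one (by norm_num) (by norm_num) hNn
  have h2 : (3/4:ℝ)^n * M ≤ η := by
    have : (3/4:ℝ)^n ≤ η/(M+1) := h1.trans hN.le
    rw [le_div_iff₀ (by positivity)] at this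
    have h0 : (0:ℝ) ≤ (3/4)^n := by positivity
    linarith
  rw [Real.dist_eq, sub_zero, abs_of_nonneg (div_nonneg (hG0 _) (mul_nonneg hxp.le (hL0 _ hxp).le))]
  linarith

lemma count_aux (d t : ℝ) (hd : 0 < d) (ht : 0 ≤ t) :
    ∑' k : ℕ, (if (k:ℝ) * d ≤ t then (1:ENNReal) else 0) ≤ ENNReal.ofReal (1 + t/d) := by
  rw [tsum_eq_sum (s := Finset.range (⌊t/d⌋₊ + 1))]
  · refine (Finset.sum_le_sum (g := fun _ => (1:ENNReal)) fun k _ => ?_).trans ?_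
    · split_ifs <;> simp
    · simp only [Finset.sum_const, Finset.card_range, nsmul_eq_mul, mul_one]
      rw [← ENNReal.ofReal_natCast]
      apply ENNReal.ofReal_le_ofReal
      push_cast
      linarith [Nat.floor_le (show 0 ≤ t/d by positivity)]
  · intro k hk
    rw [if_neg]
    intro h
    apply hk
    rw [Finset.mem_range, Nat.lt_succ_iff]
    apply Nat.le_floor
    rwa [le_div_iff₀ hd]

lemma main_est {Ω : Type*} [MeasurableSpace Ω] (P : Measure Ω) [IsProbabilityMeasure P]
    (X : ℝ → Ω → ℝ) (α : ℝ) (hα : 0 < α) (hcont : ∀ᵐ ω ∂P, ContinuousOn (fun t => X t ω) (Ici 0))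
    (T : Ω → ℝ) (hT0 : ∀ ω, 0 ≤ T ω) (hTmeas : Measurable T)
    (hindep : IndepFun T (fun ω t => X t ω) P)
    (hblock : ∃ δ > (0:ℝ), ∃ u0 ≥ (1:ℝ), ∃ K ≥ (0:ℝ), ∃ S : ℝ → ℝ → Set (ℝ → ℝ), ∀ u ≥ u0, ∀ a ≥ 0,
      MeasurableSet (S u a) ∧
      P ((fun ω t => X t ω) ⁻¹' (S u a)) ≤ ENNReal.ofReal K * gaussianReal 0 1 (Ioi u) ∧
      ∀ f : ℝ → ℝ, ContinuousOn f (Ici 0) → ∀ t ∈ Icc a (a + δ * u ^ (-(2/α))), u < f t → f ∈ S u a) :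
    ∃ u0 ≥ (1:ℝ), ∃ K ≥ (0:ℝ), ∀ u ≥ u0, ∀ x ≥ (0:ℝ),
      (∫ t in Icc 0 x, (P {ω | u < sSup ((fun s => X s ω) '' Icc 0 t)}).toReal ∂(Measure.map T P)
        ≤ K * (u^(2/α) * (gaussianReal 0 1 (Ioi u)).toReal) * (1 + ∫ t in Icc 0 x, t ∂(Measure.map T P))) ∧
      (P {ω | u < sSup ((fun s => X s ω) '' Icc 0 (T ω))}).toReal ≤ (P {ω | x < T ω}).toReal +
        K * (u^(2/α) * (gaussianReal 0 1 (Ioi u)).toReal) * (1 + ∫ t in Icc 0 x, t ∂(Measure.map T P)) := by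
  obtain ⟨δ, hδ, u0, hu0, K, hK, S, hS⟩ := hblock
  have : IsProbabilityMeasure (Measure.map T P) := Measure.isProbabilityMeasure_map hTmeas.aemeasurable
  set μ := Measure.map T P with hμ
  refine ⟨u0, hu0, K * (1 + δ)/δ, by positivity, ?_⟩
  intro u hu x hx
  have hu1 : 1 ≤ u := hu0.trans hu
  have hup : 0 < u := by linarith
  set d : ℝ := δ * u^(-(2/α)) with hd
  have hd0 : 0 < d := by positivity
  have hdi : 1/d = u^(2/α)/δ := by
    rw [hd, Real.rpow_neg hup.le]; field_simp
  set ψ : ENNReal := gaussianReal 0 1 (Ioi u) with hψ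
  have hψt : ψ ≠ ⊤ := by finiteness
  have hint : IntegrableOn (fun t : ℝ => t) (Icc 0 x) μ :=
    continuous_id.continuousOn.integrableOn_compact isCompact_Icc
  have hint2 : IntegrableOn (fun t : ℝ => 1 + t/d) (Icc 0 x) μ :=
    ContinuousOn.integrableOn_compact isCompact_Icc (by fun_prop)
  have hIpos : 0 ≤ ∫ t in Icc 0 x, t ∂μ := setIntegral_nonneg measurableSet_Icc fun t ht => ht.1
  have hI : ∫ t in Icc 0 x, (1 + t/d) ∂μ ≤ (1+δ)/δ * u^(2/α) * (1 + ∫ t in Icc 0 x, t ∂μ) := by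
    rw [integral_add (integrable_const _) (hint.div_const d), integral_div]
    simp only [integral_const, smul_eq_mul, mul_one]
    have h1 : (μ.restrict (Icc 0 x)).real univ ≤ 1 := by
      rw [measureReal_restrict_apply_univ]; exact measureReal_le_one
    have h2 : 1 ≤ u^(2/α) := Real.one_le_rpow hu1 (by positivity)
    have h3 : (∫ t in Icc 0 x, t ∂μ)/d = u^(2/α)/δ * ∫ t in Icc 0 x, t ∂μ := by
      rw [← hdi]; ring
    rw [h3]
    have h4 : (1+δ)/δ * u^(2/α) * (1 + ∫ t in Icc 0 x, t ∂μ) =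
      u^(2/α)/δ + u^(2/α) + u^(2/α)/δ * (∫ t in Icc 0 x, t ∂μ) + u^(2/α) * (∫ t in Icc 0 x, t ∂μ) := by
      field_simp; ring
    rw [h4]
    have h5 : 0 ≤ u^(2/α)/δ := by positivity
    have h6 : 0 ≤ u^(2/α) * (∫ t in Icc 0 x, t ∂μ) := by positivity
    linarith
  -- locating the block
  have hloc : ∀ f : ℝ → ℝ, ContinuousOn f (Ici 0) → ∀ t : ℝ, 0 ≤ t → u < sSup (f '' Icc 0 t) →
      ∃ k : ℕ, (k:ℝ) * d ≤ t ∧ f ∈ S u (k * d) := by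
    intro f hf t ht hlt
    obtain ⟨_, ⟨s, hs, rfl⟩, hus⟩ := exists_lt_of_lt_csSup ((nonempty_Icc.mpr ht).image f) hlt
    have hf1 := Nat.floor_le (show 0 ≤ s/d from div_nonneg hs.1 hd0.le)
    have hf2 := (Nat.lt_floor_add_one (s/d)).le
    rw [le_div_iff₀ hd0] at hf1
    rw [div_le_iff₀ hd0] at hf2
    refine ⟨⌊s/d⌋₊, hf1.trans hs.2, ?_⟩
    refine (hS u hu _ (by positivity)).2.2 f hf s ⟨hf1, ?_⟩ hus
    rw [add_mul, one_mul] at hf2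
    exact hf2
  constructor
  · have hptw : ∀ t : ℝ, 0 ≤ t → (P {ω | u < sSup ((fun s => X s ω) '' Icc 0 t)}).toReal
        ≤ (1 + t/d) * (K * ψ.toReal) := by
      intro t ht
      have h1 : P {ω | u < sSup ((fun s => X s ω) '' Icc 0 t)} ≤
          P (⋃ k : ℕ, {ω | (k:ℝ) * d ≤ t ∧ (fun s => X s ω) ∈ S u (k*d)}) := by
        apply measure_mono_ae
        filter_upwards [hcont] with ω hω hlt
        obtain ⟨k, hk⟩ := hloc _ hω t ht hlt
        exact mem_iUnion.mpr ⟨k, hk⟩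
      have h2 : P {ω | u < sSup ((fun s => X s ω) '' Icc 0 t)} ≤ ENNReal.ofReal (1 + t/d) * (ENNReal.ofReal K * ψ) := by
        refine h1.trans ((measure_iUnion_le _).trans ?_)
        refine le_trans ?_ (mul_le_mul_left (count_aux d t hd0 ht) _)
        rw [← ENNReal.tsum_mul_right]
        refine ENNReal.tsum_le_tsum fun k => ?_
        split_ifs with hk
        · rw [one_mul]
          refine le_trans (measure_mono ?_) (hS u hu (k*d) (by positivity)).2.1
          exact fun ω hω => hω.2
        · simp [hk]
      have h3 := ENNReal.toReal_mono (by finiteness) h2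
      rwa [ENNReal.toReal_mul, ENNReal.toReal_mul, ENNReal.toReal_ofReal hK, ENNReal.toReal_ofReal (by positivity)] at h3
    calc _ ≤ ∫ t in Icc 0 x, (1 + t/d) * (K * ψ.toReal) ∂μ := by
          apply integral_mono_of_nonneg
          · exact Eventually.of_forall fun t => ENNReal.toReal_nonneg
          · exact hint2.mul_const _
          · filter_upwards [ae_restrict_mem measurableSet_Icc] with t ht
            exact hptw t ht.1
      _ = (∫ t in Icc 0 x, (1 + t/d) ∂μ) * (K * ψ.toReal) := integral_mul_const _ _
      _ ≤ ((1+δ)/δ * u^(2/α) * (1 + ∫ t in Icc 0 x, t ∂μ)) * (K * ψ.toReal) := by gcongr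
      _ = _ := by ring
  · have h1 : P {ω | u < sSup ((fun s => X s ω) '' Icc 0 (T ω))} ≤
        P ({ω | x < T ω} ∪ ⋃ k : ℕ, (T ⁻¹' (Icc (k*d) x) ∩ (fun ω s => X s ω) ⁻¹' (S u (k*d)))) := by
      apply measure_mono_ae
      filter_upwards [hcont] with ω hω hlt
      obtain ⟨k, hk1, hk2⟩ := hloc _ hω (T ω) (hT0 ω) hlt
      rcases lt_or_ge x (T ω) with h | h
      · exact Or.inl h
      · exact Or.inr (mem_iUnion.mpr ⟨k, ⟨hk1, h⟩, hk2⟩)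
    have hsum : ∑' k : ℕ, μ (Icc (k*d) x) ≤ ENNReal.ofReal (∫ t in Icc 0 x, (1 + t/d) ∂μ) := by
      rw [ofReal_integral_eq_lintegral_ofReal hint2]
      · have : ∀ k : ℕ, μ (Icc (k*d) x) = ∫⁻ t in Icc 0 x, (if (k:ℝ) * d ≤ t then (1:ENNReal) else 0) ∂μ := by
          intro k
          have e : (fun t : ℝ => if (k:ℝ) * d ≤ t then (1:ENNReal) else 0) = (Ici ((k:ℝ)*d)).indicator 1 := by
            ext t; simp [indicator]
          rw [e, lintegral_indicator_one measurableSet_Ici, Measure.restrict_apply measurableSet_Ici]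
          congr 1
          ext t
          have : 0 ≤ (k:ℝ)*d := by positivity
          simp only [mem_Icc, mem_inter_iff, mem_Ici]
          constructor
          · rintro ⟨a, b⟩; exact ⟨a, this.trans a, b⟩
          · rintro ⟨a, _, b⟩; exact ⟨a, b⟩
        simp_rw [this]
        rw [← lintegral_tsum]
        · apply setLIntegral_mono (by fun_prop)
          intro t ht
          exact count_aux d t hd0 ht.1
        · intro k
          exact (Measurable.ite measurableSet_Ici measurable_const measurable_const).aemeasurable
      · filter_upwards [ae_restrict_mem measurableSet_Icc] with t ht
        have := ht.1
        simp only [Pi.zero_apply]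
        positivity
    have h2 : P {ω | u < sSup ((fun s => X s ω) '' Icc 0 (T ω))} ≤ P {ω | x < T ω} +
        ENNReal.ofReal (∫ t in Icc 0 x, (1 + t/d) ∂μ) * (ENNReal.ofReal K * ψ) := by
      refine h1.trans ((measure_union_le _ _).trans ?_)
      gcongr
      refine (measure_iUnion_le _).trans ?_
      refine le_trans ?_ (mul_le_mul_left hsum _)
      rw [← ENNReal.tsum_mul_right]
      refine ENNReal.tsum_le_tsum fun k => ?_
      have hSk := hS u hu (k*d) (by positivity)
      rw [hindep.measure_inter_preimage_eq_mul _ _ measurableSet_Icc hSk.1, hμ,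
        Measure.map_apply hTmeas measurableSet_Icc]
      exact mul_le_mul_right hSk.2.1 _
    have hI0 : 0 ≤ ∫ t in Icc 0 x, (1 + t/d) ∂μ := setIntegral_nonneg measurableSet_Icc fun t ht => by
      have := ht.1
      positivity
    have h3 := ENNReal.toReal_mono (by finiteness) h2
    rw [ENNReal.toReal_add (by finiteness) (by finiteness), ENNReal.toReal_mul, ENNReal.toReal_mul,
      ENNReal.toReal_ofReal hK, ENNReal.toReal_ofReal hI0] at h3
    refine h3.trans (add_le_add le_rfl ?_)
    calc _ ≤ ((1+δ)/δ * u^(2/α) * (1 + ∫ t in Icc 0 x, t ∂μ)) * (K * ψ.toReal) := by gcongr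
      _ = _ := by ring

/-- **Upper bound in the proof of Theorem 3.3.** Under (A1)-(A3), for `T` independent
of `X` with slowly varying tail: for every `A_0 > 0`,
`∫_0^{A_0 m(u)} P(sup_{s∈[0,t]} X(s) > u) dF_T(t) ≤ A_0 P(T > m(u)) (1+o(1))`;
consequently `limsup_{u→∞} P(sup_{s∈[0,T]} X(s) > u)/P(T > m(u)) ≤ 1`. -/
theorem limsup_upper_bound_slowly_varying
    {Ω : Type*} [MeasurableSpace Ω] (P : Measure Ω) [IsProbabilityMeasure P]
    (X : ℝ → Ω → ℝ) (r : ℝ → ℝ) (C α : ℝ)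
    (hα : 0 < α) (hα2 : α ≤ 2) (hC : 0 < C)
    -- centered stationary Gaussian process with covariance function r
    (hGauss : ∀ (n : ℕ) (c : Fin n → ℝ) (t : Fin n → ℝ), (∀ i, 0 ≤ t i) →
      Measure.map (fun ω => ∑ i, c i * X (t i) ω) P
        = gaussianReal 0 (Real.toNNReal (∑ i, ∑ j, c i * c j * r (|t i - t j|))))
    -- a.s. continuous sample paths
    (hcont : ∀ᵐ ω ∂P, ContinuousOn (fun t => X t ω) (Ici 0))
    -- (A1)
    (hA1 : (fun t => r t - (1 - C * |t| ^ α)) =o[𝓝[>] (0:ℝ)] fun t => |t| ^ α)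
    -- (A2)
    (hA2 : ∀ t : ℝ, 0 < t → r t < 1)
    -- (A3)
    (hA3 : Tendsto (fun t => r t * Real.log t) atTop (𝓝 0))
    -- Pickands constant, defined via a standard fractional Brownian motion `B`
    -- with Hurst parameter `α/2`
    {Ω' : Type*} [MeasurableSpace Ω'] (P' : Measure Ω') [IsProbabilityMeasure P']
    (B : ℝ → Ω' → ℝ)
    (hB : ∀ (n : ℕ) (c : Fin n → ℝ) (t : Fin n → ℝ), (∀ i, 0 ≤ t i) →
      Measure.map (fun ω => ∑ i, c i * B (t i) ω) P'
        = gaussianReal 0 (Real.toNNReal (∑ i, ∑ j,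
            c i * c j * ((t i ^ α + t j ^ α - |t i - t j| ^ α) / 2))))
    (HS : ℝ → ℝ)
    (hHS : ∀ S : ℝ, HS S
      = ∫ ω, Real.exp (sSup ((fun t => Real.sqrt 2 * B t ω - t ^ α) '' Icc 0 S)) ∂P')
    (Hα : ℝ) (hHα : Tendsto (fun S => HS S / S) atTop (𝓝 Hα))
    -- the function m(u) = [C^{1/α} H_α u^{2/α} Ψ(u)]⁻¹
    (m : ℝ → ℝ)
    (hm : ∀ u : ℝ, m u
      = (C ^ (1/α) * Hα * u ^ (2/α) * ((gaussianReal 0 1) (Ioi u)).toReal)⁻¹)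
    -- the random horizon T : nonnegative, independent of X
    (T : Ω → ℝ) (hT0 : ∀ ω, 0 ≤ T ω) (hTmeas : Measurable T)
    (hindep : IndepFun T (fun ω t => X t ω) P)
    -- slowly varying tail
    (L : ℝ → ℝ)
    (hL : ∀ c : ℝ, 0 < c → Tendsto (fun t => L (c * t) / L t) atTop (𝓝 1))
    (htail : ∀ t : ℝ, 0 < t → (P {ω | t < T ω}).toReal = L t)
    :
    (∀ A₀ : ℝ, 0 < A₀ →
      Filter.limsup (fun u =>
          (∫ t in Icc 0 (A₀ * m u),
              (P {ω | u < sSup ((fun s => X s ω) '' Icc 0 t)}).toReal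
            ∂(Measure.map T P)) /
            (P {ω | m u < T ω}).toReal)
        atTop ≤ A₀) ∧
    Filter.limsup (fun u =>
        (P {ω | u < sSup ((fun s => X s ω) '' Icc 0 (T ω))}).toReal /
          (P {ω | m u < T ω}).toReal)
      atTop ≤ 1 := by
  classical
  -- local behaviour of r
  have hpow0 : Tendsto (fun t : ℝ => |t| ^ α) (𝓝[>] 0) (𝓝 0) := by
    have h1 : ContinuousAt (fun t : ℝ => |t| ^ α) 0 :=
      (continuous_abs.continuousAt).rpow_const (Or.inr hα.le)
    have h2 := h1.tendsto
    simp only [abs_zero, Real.zero_rpow hα.ne'] at h2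
    exact h2.mono_left nhdsWithin_le_nhds
  have hr1 : Tendsto r (𝓝[>] 0) (𝓝 1) := by
    have h1 := hA1.trans_tendsto hpow0
    have h2 := h1.add ((hpow0.const_mul C).const_sub 1)
    simpa using h2
  have hr0 : r 0 = 1 := r_zero P X r hGauss hcont hr1
  obtain ⟨h0, hh0, hr⟩ : ∃ h0 > (0:ℝ), ∀ h : ℝ, 0 < h → h < h0 →
      0 ≤ r h ∧ r h ≤ 1 ∧ 1 - 2 * C * h^α ≤ r h := by
    have e1 := hA1.bound hC
    have e2 : ∀ᶠ t in 𝓝[>] (0:ℝ), 0 < r t := hr1.eventually (lt_mem_nhds one_pos)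
    obtain ⟨h0, hh0, hsub⟩ := mem_nhdsGT_iff_exists_Ioo_subset.mp (e1.and e2)
    refine ⟨h0, hh0, fun h hp hlt => ?_⟩
    obtain ⟨a1, a2⟩ := hsub ⟨hp, hlt⟩
    have hpp : 0 ≤ h^α := by positivity
    rw [abs_of_pos hp, Real.norm_eq_abs, Real.norm_eq_abs, abs_of_nonneg hpp, abs_le] at a1
    refine ⟨le_of_lt a2, (hA2 h hp).le, by linarith [a1.1]⟩
  have hpair : ∀ p q : ℝ, 0 ≤ p → 0 ≤ q → ∀ a b : ℝ, P.map (fun ω => a * X p ω + b * X q ω)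
      = gaussianReal 0 (Real.toNNReal (a^2 + b^2 + 2*a*b*r |p - q|)) := by
    intro p q hp hq a b
    have := hGauss 2 ![a, b] ![p, q] (by intro i; fin_cases i <;> simpa)
    simp only [Fin.sum_univ_two, Matrix.cons_val_zero, Matrix.cons_val_one, sub_self, abs_zero, hr0] at this
    rw [this, abs_sub_comm q p]
    congr 2
    ring
  have hblock := block_bound P X r C α h0 hα hC hh0 hpair hr
  obtain ⟨u0, hu0, K, hK, hmain⟩ := main_est P X α hα hcont T hT0 hTmeas hindep hblock
  have hprob : IsProbabilityMeasure (Measure.map T P) := Measure.isProbabilityMeasure_map hTmeas.aemeasurable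
  -- the tail L
  have hL00 : ∀ x, 0 < x → 0 ≤ L x := fun x hx => by rw [← htail x hx]; exact ENNReal.toReal_nonneg
  have hLa : ∀ x y, 0 < x → x ≤ y → L y ≤ L x := by
    intro x y hx hxy
    rw [← htail x hx, ← htail y (hx.trans_le hxy)]
    refine ENNReal.toReal_mono (by finiteness) (measure_mono fun ω hω => ?_)
    exact lt_of_le_of_lt hxy hω
  have hL0 : ∀ x, 0 < x → 0 < L x := by
    intro x hx
    refine lt_of_le_of_ne (hL00 x hx) fun h => ?_
    have h1 := hL 1 one_pos
    have h2 : Tendsto (fun t => L (1 * t) / L t) atTop (𝓝 0) := by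
      refine tendsto_const_nhds.congr' ?_
      filter_upwards [eventually_ge_atTop x] with t ht
      have : L t = 0 := le_antisymm ((hLa x t hx ht).trans h.symm.le) (hL00 t (hx.trans_le ht))
      simp [this]
    exact one_ne_zero (tendsto_nhds_unique h1 h2)
  -- truncated mean
  set G : ℝ → ℝ := fun x => 1 + ∫ t in Icc 0 x, t ∂(Measure.map T P) with hGdef
  have hint : ∀ x : ℝ, IntegrableOn (fun t : ℝ => t) (Icc 0 x) (Measure.map T P) := fun x =>
    continuous_id.continuousOn.integrableOn_compact isCompact_Icc
  have hG1 : ∀ x, 1 ≤ G x := fun x => by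
    have : 0 ≤ ∫ t in Icc 0 x, t ∂(Measure.map T P) := setIntegral_nonneg measurableSet_Icc fun t ht => ht.1
    simp only [hGdef]; linarith
  have hGm : Monotone G := by
    intro x y hxy
    simp only [hGdef]
    gcongr 1 + ?_
    apply setIntegral_mono_set (hint y)
    · filter_upwards [ae_restrict_mem measurableSet_Icc] with t ht using ht.1
    · exact (Icc_subset_Icc_right hxy).eventuallyLE
  have hGrec : ∀ x, 0 < x → G x ≤ G (x/2) + x * (L (x/2) - L x) := by
    intro x hx
    have hun : Icc 0 x = Icc 0 (x/2) ∪ Ioc (x/2) x := (Icc_union_Ioc_eq_Icc (by linarith) (by linarith)).symm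
    have hdis : Disjoint (Icc 0 (x/2)) (Ioc (x/2) x) := by
      rw [Set.disjoint_left]
      intro t h1 h2
      exact absurd h1.2 (not_le.mpr h2.1)
    have hio : IntegrableOn (fun t : ℝ => t) (Ioc (x/2) x) (Measure.map T P) :=
      (hint x).mono_set (by rw [hun]; exact subset_union_right)
    have h1 : ∫ t in Icc 0 x, t ∂(Measure.map T P) = ∫ t in Icc 0 (x/2), t ∂(Measure.map T P)
        + ∫ t in Ioc (x/2) x, t ∂(Measure.map T P) := by
      rw [hun, setIntegral_union hdis measurableSet_Ioc (hint _) hio]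
    have h2 : ∫ t in Ioc (x/2) x, t ∂(Measure.map T P) ≤ ∫ t in Ioc (x/2) x, x ∂(Measure.map T P) := by
      apply setIntegral_mono_on hio (integrable_const _) measurableSet_Ioc
      intro t ht; exact ht.2
    have h3 : (Measure.map T P).real (Ioc (x/2) x) = L (x/2) - L x := by
      rw [← htail x hx, ← htail (x/2) (by positivity)]
      have e : Ioc (x/2) x = Ioi (x/2) \ Ioi x := by ext t; simp
      rw [e, measureReal_sdiff (Ioi_subset_Ioi (by linarith)) measurableSet_Ioi,
        measureReal_def, measureReal_def, Measure.map_apply hTmeas measurableSet_Ioi,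
        Measure.map_apply hTmeas measurableSet_Ioi]
      rfl
    rw [setIntegral_const, h3, smul_eq_mul] at h2
    simp only [hGdef]
    rw [h1]; linarith
  have hslow := slow_aux G L hGm (fun x => zero_le_one.trans (hG1 x)) hL0 hLa hGrec (hL (1/2) (by norm_num))
  -- the normalisation
  set q : ℝ → ℝ := fun u => u^(2/α) * (gaussianReal 0 1 (Ioi u)).toReal with hq
  have hqpos : ∀ u, 0 < u → 0 < q u := by
    intro u hu
    have : 0 < (gaussianReal 0 1 (Ioi u)).toReal := by
      apply ENNReal.toReal_pos _ (by finiteness)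
      have : (gaussianReal 0 1).IsOpenPosMeasure :=
        (gaussianReal_absolutelyContinuous' 0 one_ne_zero).isOpenPosMeasure
      exact (isOpen_Ioi.measure_pos _ nonempty_Ioi).ne'
    simp only [hq]; positivity
  have hq0 : Tendsto q atTop (𝓝 0) := by
    have h1 := tendsto_rpow_mul_exp_neg_mul_atTop_nhds_zero (2/α) (1/2) (by norm_num)
    refine squeeze_zero' ?_ ?_ h1
    · filter_upwards [eventually_gt_atTop 0] with u hu using (hqpos u hu).le
    · filter_upwards [eventually_ge_atTop 1] with u hu
      simp only [hq]
      gcongr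
      have hmap : (gaussianReal 0 1).map (fun x : ℝ => -x) = gaussianReal 0 1 := by
        rw [gaussianReal_map_neg, neg_zero]
      have h2 := gauss_tail hmap 1 one_pos (by simp) u (by linarith)
      calc (gaussianReal 0 1 (Ioi u)).toReal ≤ (gaussianReal 0 1).real {x : ℝ | -x ≤ -u} := by
            apply ENNReal.toReal_mono (by finiteness)
            apply measure_mono
            intro x hx
            simp only [mem_ofPred_eq, neg_le_neg_iff]
            exact le_of_lt hx
        _ ≤ _ := h2
        _ ≤ _ := by
            apply Real.exp_le_exp.mpr
            nlinarith
  have hqinv : Tendsto (fun u => (q u)⁻¹) atTop atTop := by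
    apply Tendsto.inv_tendsto_nhdsGT_zero
    apply tendsto_nhdsWithin_iff.mpr
    refine ⟨hq0, ?_⟩
    filter_upwards [eventually_gt_atTop 0] with u hu using hqpos u hu
  have hHnn : 0 ≤ Hα := by
    refine ge_of_tendsto hHα ?_
    filter_upwards [eventually_gt_atTop 0] with s hs
    rw [hHS]
    exact div_nonneg (integral_nonneg fun ω => (Real.exp_pos _).le) hs.le
  set c : ℝ := C^(1/α) * Hα with hc
  have hmq : ∀ u, m u = c⁻¹ * (q u)⁻¹ := by
    intro u
    rw [hm, hc, hq, ← mul_inv]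
    congr 1; ring
  have hcnn : 0 ≤ c := by positivity
  have hlimsup : ∀ (f g : ℝ → ℝ) (b : ℝ), (∀ u, 0 ≤ f u) → (∀ᶠ u in atTop, f u ≤ g u) →
      Tendsto g atTop (𝓝 b) → limsup f atTop ≤ b := by
    intro f g b hf hfg hg
    rw [← hg.limsup_eq]
    refine limsup_le_limsup hfg ?_ hg.isBoundedUnder_le
    exact (isBoundedUnder_of ⟨0, fun u => hf u⟩ : IsBoundedUnder (· ≥ ·) atTop f).isCoboundedUnder_le
  rcases hcnn.eq_or_lt with hc0 | hcpos
  · -- degenerate normalisation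
    have hm0 : ∀ u, m u = 0 := fun u => by rw [hmq, ← hc0]; simp
    have hp1 : 0 < (P {ω | 0 < T ω}).toReal := by
      have h1 := hL0 1 one_pos
      rw [← htail 1 one_pos] at h1
      refine h1.trans_le (ENNReal.toReal_mono (by finiteness) (measure_mono fun ω hω => ?_))
      exact lt_trans one_pos (show (1:ℝ) < T ω from hω)
    set p := (P {ω | 0 < T ω}).toReal with hp
    constructor
    · intro A hA
      simp only [hm0, mul_zero]
      refine le_trans (hlimsup _ (fun u => K * q u * G 0 / p) 0 ?_ ?_ ?_) hA.le
      · intro u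
        exact div_nonneg (integral_nonneg fun t => ENNReal.toReal_nonneg) hp1.le
      · filter_upwards [eventually_ge_atTop u0] with u hu
        exact div_le_div_of_nonneg_right (hmain u hu 0 le_rfl).1 hp1.le
      · have := ((hq0.const_mul K).mul_const (G 0)).div_const p
        simpa using this
    · simp only [hm0]
      refine hlimsup _ (fun u => 1 + K * (G (q u)⁻¹ / ((q u)⁻¹ * L (q u)⁻¹)) / p) 1 ?_ ?_ ?_
      · intro u
        exact div_nonneg ENNReal.toReal_nonneg hp1.le
      · filter_upwards [eventually_ge_atTop u0, eventually_gt_atTop 0] with u hu hup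
        have hqp := hqpos u hup
        have hi : 0 < (q u)⁻¹ := by positivity
        have h1 := (hmain u hu (q u)⁻¹ hi.le).2
        have h2 : (P {ω | (q u)⁻¹ < T ω}).toReal ≤ p :=
          ENNReal.toReal_mono (by finiteness) (measure_mono fun ω hω => lt_trans hi hω)
        have hLq := hL0 _ hi
        have hLq1 : L (q u)⁻¹ ≤ 1 := by
          rw [← htail _ hi]
          exact measureReal_le_one
        have hGq := hG1 (q u)⁻¹
        have h3 : K * q u * G (q u)⁻¹ ≤ K * (G (q u)⁻¹ / ((q u)⁻¹ * L (q u)⁻¹)) := by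
          rw [mul_assoc]
          apply mul_le_mul_of_nonneg_left _ hK
          rw [le_div_iff₀ (by positivity)]
          have e : q u * G (q u)⁻¹ * ((q u)⁻¹ * L (q u)⁻¹) = G (q u)⁻¹ * L (q u)⁻¹ := by field_simp
          rw [e]
          nlinarith
        rw [div_le_iff₀ hp1, add_mul, div_mul_cancel₀ _ hp1.ne', one_mul]
        refine h1.trans (add_le_add h2 h3)
      · have := (((hslow.comp hqinv).const_mul K).div_const p).const_add 1
        simpa [Function.comp_def] using this
  · have hmtop : Tendsto m atTop atTop := by
      have : m = fun u => c⁻¹ * (q u)⁻¹ := funext hmq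
      rw [this]
      exact hqinv.const_mul_atTop (by positivity)
    have hg : ∀ A : ℝ, 0 < A → Tendsto (fun u => K * A / c * (G (A * m u) / (A * m u * L (A * m u)))
        * (L (A * m u) / L (m u))) atTop (𝓝 0) := by
      intro A hA
      have h1 : Tendsto (fun u => A * m u) atTop atTop := hmtop.const_mul_atTop hA
      have h2 := ((hslow.comp h1).const_mul (K*A/c)).mul ((hL A hA).comp hmtop)
      simpa [Function.comp_def] using h2
    have hid : ∀ A : ℝ, 0 < A → ∀ u, 0 < u → K * A / c * (G (A * m u) / (A * m u * L (A * m u)))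
        * (L (A * m u) / L (m u)) = K * q u * G (A * m u) / L (m u) := by
      intro A hA u hu
      have hqp := hqpos u hu
      have hmp : 0 < m u := by rw [hmq]; positivity
      have hl1 := hL0 (m u) hmp
      have hl2 := hL0 (A * m u) (by positivity)
      have e : q u = 1/(c * m u) := by rw [hmq]; field_simp
      rw [e]
      field_simp
    constructor
    · intro A hA
      refine le_trans (hlimsup _ _ 0 ?_ ?_ (hg A hA)) hA.le
      · intro u
        exact div_nonneg (integral_nonneg fun t => ENNReal.toReal_nonneg) ENNReal.toReal_nonneg
      · filter_upwards [eventually_ge_atTop u0, eventually_gt_atTop 0] with u hu hup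
        have hqp := hqpos u hup
        have hmp : 0 < m u := by rw [hmq]; positivity
        rw [hid A hA u hup, htail _ hmp]
        exact div_le_div_of_nonneg_right (hmain u hu (A * m u) (by positivity)).1 (hL0 _ hmp).le
    · refine hlimsup _ (fun u => 1 + K * 1 / c * (G (1 * m u) / (1 * m u * L (1 * m u)))
        * (L (1 * m u) / L (m u))) 1 ?_ ?_ ?_
      · intro u
        exact div_nonneg ENNReal.toReal_nonneg ENNReal.toReal_nonneg
      · filter_upwards [eventually_ge_atTop u0, eventually_gt_atTop 0] with u hu hup
        have hqp := hqpos u hup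
        have hmp : 0 < m u := by rw [hmq]; positivity
        have hl := hL0 _ hmp
        rw [hid 1 one_pos u hup, one_mul]
        have h1 := (hmain u hu (m u) hmp.le).2
        rw [htail _ hmp] at h1 ⊢
        rw [div_le_iff₀ hl, add_mul, one_mul, div_mul_cancel₀ _ hl.ne']
        exact h1
      · simpa using (hg 1 one_pos).const_add 1
end
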